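/- arXiv:1011.0323 — 5 statements merged into one kernel-verified Lean document; each statement's English description precedes it below -/
import Mathlib

section
/- Let a, b, c be positive integers such that a+b+c is odd. Then ζ₂PU3(a,b,c) lies in the ℚ-subalgebra of ℂ generated by π, the imaginary unit i, and the Lerch values φ(j, a'/3) = Σ_{m≥1} e^{2πima'/3}·m^{−j} for integers j ≥ 2 and a' ∈ {0,1,2}; i.e., it can be expressed as a polynomial with coefficients in ℚ[π, i] in these Lerch values. -/
/-- The Lerch zeta value φ(j, a/3) = Σ_{m≥1} e^{2πim(a/3)} m^{−j} for a natural
number exponent j and a ∈ ℕ. -/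
noncomputable def lerchValueThird (j : ℕ) (a : ℕ) : ℂ :=
  ∑' m : ℕ, Complex.exp (2 * Real.pi * Complex.I * ((m : ℂ) + 1) * ((a : ℂ) / 3))
    / ((m : ℂ) + 1) ^ j


namespace PU3

open Complex

noncomputable def AA : Subalgebra ℚ ℂ := Algebra.adjoin ℚ
        ({(Real.pi : ℂ), Complex.I} ∪
          {z : ℂ | ∃ j : ℕ, 2 ≤ j ∧ ∃ a' : ℕ, a' ≤ 2 ∧ z = lerchValueThird j a'})

noncomputable def om : ℂ := Complex.exp (2 * Real.pi * Complex.I / 3)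

noncomputable def PP (j : ℕ) : Submodule AA (ℕ → ℂ) :=
  Submodule.span AA {f | ∃ i k : ℕ, j ≤ i ∧ f = fun m : ℕ => (om ^ (m + 1)) ^ k / ((m : ℂ) + 1) ^ i}

lemma om_prim : IsPrimitiveRoot om 3 := by
  have := Complex.isPrimitiveRoot_exp 3 (by norm_num)
  simpa [om] using this

lemma om_cube : om ^ 3 = 1 := om_prim.pow_eq_one

lemma pi_mem : (Real.pi : ℂ) ∈ AA := Algebra.subset_adjoin (by simp)

lemma I_mem : Complex.I ∈ AA := Algebra.subset_adjoin (by simp)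

lemma rat_mem (q : ℚ) : (q : ℂ) ∈ AA := by
  have := AA.algebraMap_mem q
  simpa using this

lemma om_pow_mod (k : ℕ) : om ^ k = om ^ (k % 3) := by
  conv_lhs => rw [← Nat.div_add_mod k 3, pow_add, pow_mul, om_cube, one_pow, one_mul]

lemma lerch_mem (i k : ℕ) (hi : 2 ≤ i) :
    Summable (fun m : ℕ => (om ^ (m + 1)) ^ k / ((m : ℂ) + 1) ^ i) ∧
    ∑' m : ℕ, (om ^ (m + 1)) ^ k / ((m : ℂ) + 1) ^ i ∈ AA := by
  constructor
  · apply Summable.of_norm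
    have h1 : Summable (fun m : ℕ => 1 / ((m : ℝ) + 1) ^ i) := by
      have := (summable_nat_add_iff 1).mpr (Real.summable_one_div_nat_pow.mpr (by omega : 1 < i))
      simpa using this
    refine h1.congr fun m => ?_
    have h2 : ‖om‖ = 1 := om_prim.norm'_eq_one (by norm_num)
    have h3 : ‖(m : ℂ) + 1‖ = (m : ℝ) + 1 := by
      have := Complex.norm_natCast (m + 1)
      simpa using this
    simp [h2, h3]
  · apply Algebra.subset_adjoin
    right
    refine ⟨i, hi, k % 3, by omega, ?_⟩
    unfold lerchValueThird
    congr 1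
    ext m
    congr 1
    rw [← pow_mul, mul_comm, pow_mul, om_pow_mod k, ← pow_mul, om, ← Complex.exp_nat_mul]
    congr 1
    push_cast
    ring

lemma PP_smul {j : ℕ} {f : ℕ → ℂ} (hf : f ∈ PP j) {z : ℂ} (hz : z ∈ AA) :
    (fun m => z * f m) ∈ PP j := by
  have := (PP j).smul_mem (⟨z, hz⟩ : AA) hf
  exact this

lemma PP_basis (j i k : ℕ) (h : j ≤ i) :
    (fun m : ℕ => (om ^ (m + 1)) ^ k / ((m : ℂ) + 1) ^ i) ∈ PP j :=
  Submodule.subset_span ⟨i, k, h, rfl⟩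

lemma PP_add {j : ℕ} {f g : ℕ → ℂ} (hf : f ∈ PP j) (hg : g ∈ PP j) :
    (fun m => f m + g m) ∈ PP j := (PP j).add_mem hf hg

lemma PP_sub {j : ℕ} {f g : ℕ → ℂ} (hf : f ∈ PP j) (hg : g ∈ PP j) :
    (fun m => f m - g m) ∈ PP j := (PP j).sub_mem hf hg

lemma PP_mono {j j' : ℕ} (h : j ≤ j') : PP j' ≤ PP j := by
  apply Submodule.span_mono
  rintro f ⟨i, k, hi, rfl⟩
  exact ⟨i, k, h.trans hi, rfl⟩

lemma PP_div {j : ℕ} {f : ℕ → ℂ} (hf : f ∈ PP j) (l : ℕ) :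
    (fun m : ℕ => f m / ((m : ℂ) + 1) ^ l) ∈ PP (j + l) := by
  induction hf using Submodule.span_induction with
  | mem f hf =>
    obtain ⟨i, k, hi, rfl⟩ := hf
    have := PP_basis (j + l) (i + l) k (by omega)
    convert this using 1
    ext m
    rw [div_div, pow_add _ i l]
  | zero => 
    convert (PP (j + l)).zero_mem using 1
    ext m
    simp
  | add f g _ _ hf hg =>
    convert PP_add hf hg using 1
    ext m
    simp [add_div]
  | smul a f _ hf =>
    convert PP_smul hf a.2 using 1
    ext m
    change (a : ℂ) * f m / _ = _
    ring

lemma PP_sum {f : ℕ → ℂ} (hf : f ∈ PP 2) : Summable f ∧ ∑' m, f m ∈ AA := by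
  induction hf using Submodule.span_induction with
  | mem f hf =>
    obtain ⟨i, k, hi, rfl⟩ := hf
    exact lerch_mem i k hi
  | zero => exact ⟨summable_zero, by simp [AA.zero_mem]⟩
  | add f g _ _ hf hg =>
    refine ⟨hf.1.add hg.1, ?_⟩
    change ∑' m, (f m + g m) ∈ AA
    rw [hf.1.tsum_add hg.1]
    exact AA.add_mem hf.2 hg.2
  | smul a f _ hf =>
    refine ⟨hf.1.mul_left (a : ℂ), ?_⟩
    change ∑' m, ((a : ℂ) * f m) ∈ AA
    rw [tsum_mul_left]
    exact AA.mul_mem a.2 hf.2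

open Classical in
noncomputable def tm (b c m : ℕ) (n : ℤ) : ℂ :=
  if (3 : ℤ) ∣ n - (m + 1) ∧ n ≠ 0 ∧ n + (m + 1) ≠ 0 then
    1 / ((n : ℂ) ^ b * ((n : ℂ) + ((m : ℂ) + 1)) ^ c) else 0

noncomputable def hh (b c m : ℕ) : ℂ := ∑' n : ℤ, tm b c m n

lemma ratio_bound (x y : ℝ) (hx : 1 ≤ x) (hy : 1 ≤ y) (b c : ℕ) (h : 2 ≤ b + c) :
    1 / (x ^ b * y ^ c) ≤ 1 / x ^ 2 + 1 / y ^ 2 := by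
  have hx0 : 0 < x := by linarith
  have hy0 : 0 < y := by linarith
  have key : ∀ z : ℝ, 1 ≤ z → z ≤ x → z ≤ y → 1 / (x ^ b * y ^ c) ≤ 1 / z ^ 2 := by
    intro z hz h1 h2
    have hz0 : 0 < z := by linarith
    apply one_div_le_one_div_of_le (by positivity)
    calc z ^ 2 ≤ z ^ (b + c) := pow_le_pow_right₀ hz h
      _ = z ^ b * z ^ c := pow_add _ _ _
      _ ≤ x ^ b * y ^ c := by gcongr
  rcases le_total x y with hxy | hxy
  · have := key x hx le_rfl hxy
    have h2 : 0 ≤ 1 / y ^ 2 := by positivity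
    linarith
  · have := key y hy hxy le_rfl
    have h2 : 0 ≤ 1 / x ^ 2 := by positivity
    linarith

lemma one_le_abs_real (n : ℤ) (hn : n ≠ 0) : (1 : ℝ) ≤ |(n : ℝ)| := by
  have := Int.one_le_abs hn
  exact_mod_cast this

lemma tm_summable (b c m : ℕ) (h : 2 ≤ b + c) : Summable (tm b c m) := by
  have h1 : Summable (fun n : ℤ => 1 / (n : ℝ) ^ 2) :=
    Real.summable_one_div_int_pow.mpr (by norm_num)
  have h2 : Summable (fun n : ℤ => 1 / ((n + ((m : ℤ) + 1) : ℤ) : ℝ) ^ 2) :=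
    h1.comp_injective (i := fun n : ℤ => n + ((m : ℤ) + 1)) (add_left_injective _)
  refine Summable.of_norm_bounded (h1.add h2) fun n => ?_
  unfold tm
  split_ifs with hc
  · have := ratio_bound _ _ (one_le_abs_real n hc.2.1) (one_le_abs_real _ hc.2.2) b c h
    rw [sq_abs, sq_abs] at this
    refine le_trans (le_of_eq ?_) this
    have e : ((n : ℂ) + ((m : ℂ) + 1)) = ((n + ((m : ℤ) + 1) : ℤ) : ℂ) := by push_cast; ring
    rw [e, norm_div, norm_mul, norm_pow, norm_pow, Complex.norm_intCast, Complex.norm_intCast]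
    simp
  · rw [norm_zero]
    positivity

lemma M_ne (m : ℕ) : (m : ℂ) + 1 ≠ 0 := by exact_mod_cast Nat.succ_ne_zero m

lemma tm_rec (b c m : ℕ) (n : ℤ) :
    tm (b + 1) (c + 1) m n = (tm (b + 1) c m n - tm b (c + 1) m n) / ((m : ℂ) + 1) ^ 1 := by
  unfold tm
  split_ifs with hc
  · have hn : (n : ℂ) ≠ 0 := by exact_mod_cast hc.2.1
    have hnm : (n : ℂ) + ((m : ℂ) + 1) ≠ 0 := by exact_mod_cast hc.2.2
    have hm := M_ne m
    field_simp
    ring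
  · simp

lemma hh_rec (b c m : ℕ) (h : 1 ≤ b + c) :
    hh (b + 1) (c + 1) m = (hh (b + 1) c m - hh b (c + 1) m) / ((m : ℂ) + 1) ^ 1 := by
  unfold hh
  rw [← (tm_summable _ _ _ (by omega)).tsum_sub (tm_summable _ _ _ (by omega)), ← tsum_div_const]
  exact tsum_congr fun n => tm_rec b c m n

lemma hh_symm (b c m : ℕ) : hh b c m = (-1) ^ (b + c) * hh c b m := by
  unfold hh
  rw [← tsum_mul_left, ← (Equiv.subLeft (-((m : ℤ) + 1))).tsum_eq]
  apply tsum_congr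
  intro n
  simp only [Equiv.subLeft_apply]
  unfold tm
  have hiff : ((3 : ℤ) ∣ -((m : ℤ) + 1) - n - (m + 1) ∧ -((m : ℤ) + 1) - n ≠ 0 ∧
      -((m : ℤ) + 1) - n + (m + 1) ≠ 0) ↔ ((3 : ℤ) ∣ n - (m + 1) ∧ n ≠ 0 ∧ n + (m + 1) ≠ 0) := by
    constructor <;> rintro ⟨h1, h2, h3⟩ <;> refine ⟨?_, ?_, ?_⟩ <;> omega
  simp only [hiff]
  split_ifs with hc
  · have e1 : ((-((m : ℤ) + 1) - n : ℤ) : ℂ) = (-1) * ((n : ℂ) + ((m : ℂ) + 1)) := by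
      push_cast; ring
    have e2 : ((-((m : ℤ) + 1) - n : ℤ) : ℂ) + ((m : ℂ) + 1) = (-1) * (n : ℂ) := by
      push_cast; ring
    rw [e2, e1, mul_pow, mul_pow, pow_add]
    have hb : ((-1 : ℂ) ^ b) * (-1) ^ b = 1 := by rw [← mul_pow]; simp
    have hc' : ((-1 : ℂ) ^ c) * (-1) ^ c = 1 := by rw [← mul_pow]; simp
    have hn : (n : ℂ) ≠ 0 := by exact_mod_cast hc.2.1
    have hnm : (n : ℂ) + ((m : ℂ) + 1) ≠ 0 := by exact_mod_cast hc.2.2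
    have i1 : ((-1 : ℂ) ^ b) ≠ 0 := by simp
    have i2 : ((-1 : ℂ) ^ c) ≠ 0 := by simp
    field_simp
    linear_combination (-((-1 : ℂ) ^ c) ^ 2) * hb - hc'
  · simp

/-- Orthogonality. -/
lemma om_orth (u : ℕ) : (1 + om ^ u + om ^ (2 * u)) / 3 = if 3 ∣ u then 1 else 0 := by
  split_ifs with h
  · obtain ⟨v, rfl⟩ := h
    rw [show 2 * (3 * v) = 3 * (2 * v) by ring, pow_mul, pow_mul, om_cube]
    norm_num
  · have h1 : om ^ u ≠ 1 := fun e => h ((om_prim.pow_eq_one_iff_dvd u).mp e)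
    have h2 : (om ^ u - 1) * (1 + om ^ u + om ^ (2 * u)) = 0 := by
      have : (om ^ u) ^ 3 = 1 := by rw [← pow_mul, mul_comm, pow_mul, om_cube, one_pow]
      rw [show 2 * u = u * 2 by ring, pow_mul]
      linear_combination this
    rcases mul_eq_zero.mp h2 with h3 | h3
    · exact absurd (sub_eq_zero.mp h3) h1
    · rw [h3]; simp

/-- Orthogonality, integer version. -/
lemma om_orth_int (n : ℤ) (m : ℕ) :
    (1 + om ^ n * (om ^ (m + 1)) ^ 2 + om ^ (2 * n) * (om ^ (m + 1)) ^ 1) / 3 =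
      if (3 : ℤ) ∣ n - (m + 1) then 1 else 0 := by
  have h0 : om ≠ 0 := om_prim.ne_zero (by norm_num)
  obtain ⟨u, hu⟩ : ∃ u : ℕ, (u : ℤ) = (n + 2 * (m + 1)) % 3 :=
    ⟨((n + 2 * (m + 1)) % 3).toNat, by omega⟩
  have hmod : ∀ z : ℤ, om ^ z = om ^ (z % 3) := by
    intro z
    conv_lhs => rw [← Int.mul_ediv_add_emod z 3, zpow_add₀ h0, zpow_mul]
    rw [show om ^ (3 : ℤ) = 1 by exact_mod_cast om_cube]
    simp
  have e1 : om ^ n * (om ^ (m + 1)) ^ 2 = om ^ u := by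
    rw [← zpow_natCast om u, hu, ← hmod, zpow_add₀ h0, ← pow_mul, ← zpow_natCast om ((m + 1) * 2)]
    congr 2
    push_cast; ring
  have e2 : om ^ (2 * n) * (om ^ (m + 1)) ^ 1 = om ^ (2 * u) := by
    rw [← zpow_natCast om (2 * u), ← pow_mul, ← zpow_natCast om ((m + 1) * 1), ← zpow_add₀ h0, hmod,
      hmod (((2 * u : ℕ)) : ℤ)]
    congr 1
    push_cast
    omega
  rw [e1, e2, om_orth]
  have : (3 ∣ u) ↔ (3 : ℤ) ∣ n - (m + 1) := by omega
  simp only [this]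

lemma hs_congr {β : Type*} {f g : β → ℂ} {a : ℂ} (h : HasSum f a) (e : ∀ x, g x = f x) :
    HasSum g a := by
  rw [show g = f from funext e]
  exact h

noncomputable def be (b k : ℕ) : ℂ :=
  -(2 * Real.pi * I) ^ b / (b.factorial : ℂ) * bernoulliFun b ((k : ℝ) / 3)

lemma be_mem (b k : ℕ) : be b k ∈ AA := by
  unfold be
  have h1 : bernoulliFun b ((k : ℝ) / 3) =
      (((Polynomial.bernoulli b).eval ((k : ℚ) / 3) : ℚ) : ℝ) := by
    unfold bernoulliFun
    have := Polynomial.eval_map_algebraMap (B := ℝ) (Polynomial.bernoulli b) ((k : ℝ) / 3)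
    rw [this]
    have h2 := Polynomial.aeval_algebraMap_apply ℝ ((k : ℚ) / 3) (Polynomial.bernoulli b)
    simp at h2
    rw [h2]
  rw [h1]
  have h3 : -(2 * Real.pi * I) ^ b / (b.factorial : ℂ) *
      (((((Polynomial.bernoulli b).eval ((k : ℚ) / 3) : ℚ) : ℝ)) : ℂ) =
      ((-(1 / (b.factorial : ℚ)) * (Polynomial.bernoulli b).eval ((k : ℚ) / 3) : ℚ) : ℂ) *
      (((2 : ℚ) : ℂ) * Real.pi * I) ^ b := by
    push_cast
    ring
  rw [h3]
  exact AA.mul_mem (rat_mem _) (AA.pow_mem (AA.mul_mem (AA.mul_mem (rat_mem _) pi_mem) I_mem) _)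

lemma be_hasSum (b k : ℕ) (hb : 2 ≤ b) (hk : k ≤ 2) :
    HasSum (fun n : ℤ => 1 / (n : ℂ) ^ b * om ^ ((k : ℤ) * n)) (be b k) := by
  have hx : ((k : ℝ) / 3) ∈ Set.Icc (0 : ℝ) 1 := by
    have : (k : ℝ) ≤ 2 := by exact_mod_cast hk
    constructor
    · positivity
    · linarith
  have := hasSum_one_div_pow_mul_fourier_mul_bernoulliFun hb hx
  refine hs_congr this fun n => ?_
  congr 1
  rw [fourier_coe_apply, om, ← Complex.exp_int_mul]
  congr 1
  push_cast
  ring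

lemma base_b (b : ℕ) (hb : 2 ≤ b) (m : ℕ) :
    hh b 0 m = (be b 0 + (om ^ (m + 1)) ^ 2 * be b 1 + (om ^ (m + 1)) ^ 1 * be b 2) / 3
      - (-1) ^ b * ((1 + (om ^ (m + 1)) ^ 1 + (om ^ (m + 1)) ^ 2) / 3) / ((m : ℂ) + 1) ^ b := by
  have h1 := (((be_hasSum b 0 hb (by norm_num)).add
    ((be_hasSum b 1 hb (by norm_num)).mul_left ((om ^ (m + 1)) ^ 2))).add
    ((be_hasSum b 2 hb (by norm_num)).mul_left ((om ^ (m + 1)) ^ 1))).div_const 3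
  have h2 := hasSum_ite_eq (-((m : ℤ) + 1))
    ((-1) ^ b * ((1 + (om ^ (m + 1)) ^ 1 + (om ^ (m + 1)) ^ 2) / 3) / ((m : ℂ) + 1) ^ b)
  rw [← (h1.sub h2).tsum_eq]
  unfold hh
  apply tsum_congr
  intro n
  have ho := om_orth_int n m
  have ho2 := om_orth (m + 1)
  rw [show 2 * (m + 1) = (m + 1) * 2 by ring, pow_mul] at ho2
  have e : (1 / (n : ℂ) ^ b * om ^ (((0 : ℕ) : ℤ) * n) + (om ^ (m + 1)) ^ 2 *
      (1 / (n : ℂ) ^ b * om ^ (((1 : ℕ) : ℤ) * n)) +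
      (om ^ (m + 1)) ^ 1 * (1 / (n : ℂ) ^ b * om ^ (((2 : ℕ) : ℤ) * n))) / 3 =
      1 / (n : ℂ) ^ b * (if (3 : ℤ) ∣ n - (m + 1) then 1 else 0) := by
    rw [← ho]
    push_cast
    rw [zero_mul, one_mul, zpow_zero]
    ring
  rw [e, pow_one, ho2]
  unfold tm
  have hm := M_ne m
  by_cases hn : n = -((m : ℤ) + 1)
  · subst hn
    have hiff : (3 : ℤ) ∣ -((m : ℤ) + 1) - (m + 1) ↔ 3 ∣ m + 1 := by omega
    rw [if_neg (by omega)]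
    simp only [hiff, if_true]
    split_ifs
    · have hs : ((-1 : ℂ) ^ b) * (-1) ^ b = 1 := by rw [← mul_pow]; simp
      have i1 : ((-1 : ℂ) ^ b) ≠ 0 := by simp
      push_cast
      rw [neg_pow, mul_one, mul_one, eq_comm, sub_eq_zero]
      field_simp
      linear_combination -hs
    · simp
  · rw [if_neg hn]
    by_cases hn0 : n = 0
    · subst hn0
      simp [show b ≠ 0 by omega]
    · have hnm : n + (m + 1) ≠ 0 := by omega
      simp [hn0, hnm]

lemma base_b_mem (b : ℕ) (hb : 2 ≤ b) : hh b 0 ∈ PP 0 := by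
  have q3 : (3 : ℂ)⁻¹ ∈ AA := by simpa using rat_mem (1 / 3)
  have q4 : (-1 : ℂ) ^ b * (3 : ℂ)⁻¹ ∈ AA :=
    AA.mul_mem (AA.pow_mem (AA.neg_mem AA.one_mem) _) q3
  have h := PP_sub (PP_add (PP_add (PP_smul (PP_basis 0 0 0 le_rfl) (AA.mul_mem q3 (be_mem b 0)))
    (PP_smul (PP_basis 0 0 2 le_rfl) (AA.mul_mem q3 (be_mem b 1))))
    (PP_smul (PP_basis 0 0 1 le_rfl) (AA.mul_mem q3 (be_mem b 2))))
    (PP_smul (PP_add (PP_add (PP_basis 0 b 0 (by omega)) (PP_basis 0 b 1 (by omega)))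
      (PP_basis 0 b 2 (by omega))) q4)
  convert h using 1
  ext m
  rw [base_b b hb m]
  simp only [pow_zero, div_one]
  ring

lemma tele_nat : HasSum (fun n : ℕ => 1 / ((n : ℂ) + 1) - 1 / (n : ℂ)) 0 := by
  have hs : Summable (fun n : ℕ => 1 / ((n : ℂ) + 1) - 1 / (n : ℂ)) := by
    rw [← summable_nat_add_iff 1]
    have h1 : Summable (fun m : ℕ => 1 / ((m : ℝ) + 1) ^ 2) := by
      have := (summable_nat_add_iff 1).mpr (Real.summable_one_div_nat_pow.mpr (by norm_num : 1 < 2))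
      simpa using this
    refine Summable.of_norm_bounded h1 fun n => ?_
    have e : 1 / (((n + 1 : ℕ) : ℂ) + 1) - 1 / ((n + 1 : ℕ) : ℂ) =
        -(1 / (((n + 1 : ℕ) : ℂ) * ((n + 2 : ℕ) : ℂ))) := by
      have h1 : ((n + 1 : ℕ) : ℂ) ≠ 0 := by exact_mod_cast Nat.succ_ne_zero n
      have h2 : ((n + 2 : ℕ) : ℂ) ≠ 0 := by exact_mod_cast Nat.succ_ne_zero (n + 1)
      have e2 : ((n + 1 : ℕ) : ℂ) + 1 = ((n + 2 : ℕ) : ℂ) := by push_cast; ring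
      rw [e2]
      field_simp
      push_cast; ring
    rw [e, norm_neg, norm_div, norm_mul, Complex.norm_natCast, Complex.norm_natCast, norm_one]
    push_cast
    apply one_div_le_one_div_of_le (by positivity)
    nlinarith [Nat.cast_nonneg (α := ℝ) n]
  rw [hs.hasSum_iff_tendsto_nat]
  have e : (fun N : ℕ => ∑ i ∈ Finset.range N, (1 / ((i : ℂ) + 1) - 1 / (i : ℂ))) =
      fun N : ℕ => 1 / (N : ℂ) := by
    ext N
    have := Finset.sum_range_sub (fun n : ℕ => 1 / (n : ℂ)) N
    simpa using this
  rw [e]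
  exact tendsto_one_div_atTop_nhds_zero_nat

lemma tele_int : HasSum (fun k : ℤ => 1 / ((k : ℂ) + 1) - 1 / (k : ℂ)) 0 := by
  have := HasSum.of_nat_of_neg_add_one (f := fun k : ℤ => 1 / ((k : ℂ) + 1) - 1 / (k : ℂ))
    (m := 0) (m' := 0) (by simpa using tele_nat) (by
      convert tele_nat using 1
      ext n
      push_cast
      rw [show -((n : ℂ) + 1) + 1 = -(n : ℂ) by ring, one_div, one_div, one_div, one_div,
        inv_neg, inv_neg]
      ring)
  simpa using this

lemma tele_q (q : ℕ) : HasSum (fun k : ℤ => 1 / (k : ℂ) - 1 / ((k : ℂ) + q)) 0 := by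
  induction q with
  | zero => simp
  | succ q ih =>
    have h := (Equiv.addRight (q : ℤ)).hasSum_iff.mpr tele_int
    have h2 := ih.sub h
    rw [sub_zero] at h2
    refine hs_congr h2 fun k => ?_
    simp only [Function.comp_apply, Equiv.coe_addRight]
    push_cast
    rw [add_assoc]
    ring

lemma hh11_dvd (m : ℕ) (h : 3 ∣ m + 1) : hh 1 1 m = 2 / ((m : ℂ) + 1) ^ 2 := by
  obtain ⟨q, hq⟩ := h
  have hq0 : q ≠ 0 := by rintro rfl; simp at hq
  have hqc : (q : ℂ) ≠ 0 := by exact_mod_cast hq0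
  have hM : (m : ℂ) + 1 = 3 * q := by exact_mod_cast hq
  have hMz : (m : ℤ) + 1 = 3 * q := by exact_mod_cast hq
  have h1 := (((tele_q q).add (hasSum_ite_eq (0 : ℤ) (1 / (q : ℂ)))).add
    (hasSum_ite_eq (-(q : ℤ)) (1 / (q : ℂ)))).mul_left (1 / (9 * (q : ℂ)))
  have hinj : Function.Injective (fun k : ℤ => 3 * k) := fun a b hab => by
    simp only at hab; omega
  have h2 : HasSum (tm 1 1 m) (1 / (9 * (q : ℂ)) * (0 + 1 / (q : ℂ) + 1 / (q : ℂ))) := by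
    rw [← hinj.hasSum_iff]
    · refine hs_congr h1 fun k => ?_
      simp only [Function.comp_apply]
      unfold tm
      rw [hM, hMz]
      by_cases hk0 : k = 0
      · subst hk0
        rw [if_neg (by omega)]
        have : ¬ (0 : ℤ) = -(q : ℤ) := by omega
        simp [hq0]
      · by_cases hkq : k = -(q : ℤ)
        · subst hkq
          rw [if_neg (by omega)]
          simp [hq0]
        · rw [if_pos (by omega), if_neg hk0, if_neg hkq]
          have hk0' : (k : ℂ) ≠ 0 := by exact_mod_cast hk0
          have hkq' : (k : ℂ) + q ≠ 0 := by
            have : k + (q : ℤ) ≠ 0 := by omega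
            exact_mod_cast this
          have e : ((3 * k : ℤ) : ℂ) + 3 * q = 3 * ((k : ℂ) + q) := by push_cast; ring
          rw [e]
          push_cast
          field_simp
          ring
    · intro n hn
      unfold tm
      rw [if_neg]
      rintro ⟨⟨v, hv⟩, -⟩
      exact hn ⟨v + q, by simp only; omega⟩
  unfold hh
  rw [h2.tsum_eq, hM]
  field_simp
  ring

lemma int_split (F : ℤ → ℂ) (hs : Summable F) :
    ∑' k, F k = F 0 + ∑' n : ℕ, (F ((n : ℤ) + 1) + F (-((n : ℤ) + 1))) := by
  have s1 : Summable (fun n : ℕ => F ((n : ℤ) + 1)) :=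
    hs.comp_injective (i := fun n : ℕ => (n : ℤ) + 1) (fun a b hab => by simp only at hab; omega)
  have s2 : Summable (fun n : ℕ => F (-((n : ℤ) + 1))) :=
    hs.comp_injective (i := fun n : ℕ => -((n : ℤ) + 1)) (fun a b hab => by simp only at hab; omega)
  rw [tsum_of_add_one_of_neg_add_one s1 s2, s1.tsum_add s2]
  ring

lemma cot_diff (x y : ℂ) (hx : x ∈ integerComplement) (hy : y ∈ integerComplement)
    (hs : Summable (fun k : ℤ => 1 / (x + k) - 1 / (y + k))) :
    ∑' k : ℤ, (1 / (x + k) - 1 / (y + k)) =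
      Real.pi * Complex.cot (Real.pi * x) - Real.pi * Complex.cot (Real.pi * y) := by
  have cx := cot_series_rep' hx
  have cy := cot_series_rep' hy
  have sx : Summable (fun n : ℕ => 1 / (x - (n + 1)) + 1 / (x + (n + 1))) := summable_cotTerm hx
  have sy : Summable (fun n : ℕ => 1 / (y - (n + 1)) + 1 / (y + (n + 1))) := summable_cotTerm hy
  have key2 := sx.tsum_sub sy
  rw [← cx, ← cy] at key2
  rw [int_split _ hs]
  have e : ∀ n : ℕ, (1 / (x + (((n : ℤ) + 1 : ℤ) : ℂ)) - 1 / (y + (((n : ℤ) + 1 : ℤ) : ℂ))) +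
      (1 / (x + ((-((n : ℤ) + 1) : ℤ) : ℂ)) - 1 / (y + ((-((n : ℤ) + 1) : ℤ) : ℂ))) =
      (1 / (x - (n + 1)) + 1 / (x + (n + 1))) - (1 / (y - (n + 1)) + 1 / (y + (n + 1))) := by
    intro n
    push_cast
    rw [← sub_eq_add_neg, ← sub_eq_add_neg]
    ring
  rw [tsum_congr e, key2, Int.cast_zero, add_zero, add_zero]
  ring

lemma hh11_not_dvd (m : ℕ) (h : ¬ 3 ∣ m + 1) : hh 1 1 m =
    (2 * Real.pi / (9 * I)) * ((om ^ (m + 1)) ^ 1 - (om ^ (m + 1)) ^ 2) / ((m : ℂ) + 1) ^ 1 := by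
  set x : ℂ := ((m : ℂ) + 1) / 3 with hx
  have hcomp : ∀ l : ℕ, ¬ 3 ∣ l → (l : ℂ) / 3 ∈ integerComplement := by
    rintro l hl ⟨z, hz⟩
    have : (l : ℂ) = 3 * z := by rw [hz]; ring
    have : (l : ℤ) = 3 * z := by exact_mod_cast this
    omega
  have hx1 : x ∈ integerComplement := by
    have := hcomp (m + 1) h
    push_cast at this; exact this
  have hx2 : 2 * x ∈ integerComplement := by
    have := hcomp (2 * (m + 1)) (by omega)
    push_cast at this
    rw [hx, ← mul_div_assoc]; exact this
  have hm := M_ne m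
  have hinj : Function.Injective (fun k : ℤ => 3 * k + (m + 1)) := fun a b hab => by
    simp only at hab; omega
  have hterm : ∀ k : ℤ, tm 1 1 m (3 * k + (m + 1)) =
      1 / (3 * ((m : ℂ) + 1)) * (1 / (x + k) - 1 / (2 * x + k)) := by
    intro k
    unfold tm
    rw [if_pos (by omega)]
    have n1 : 3 * (k : ℂ) + ((m : ℂ) + 1) ≠ 0 := by
      have : 3 * k + ((m : ℤ) + 1) ≠ 0 := by omega
      exact_mod_cast this
    have n2 : 3 * (k : ℂ) + 2 * ((m : ℂ) + 1) ≠ 0 := by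
      have : 3 * k + 2 * ((m : ℤ) + 1) ≠ 0 := by omega
      exact_mod_cast this
    have e1 : x + k = (3 * (k : ℂ) + ((m : ℂ) + 1)) / 3 := by rw [hx]; ring
    have e2 : 2 * x + k = (3 * (k : ℂ) + 2 * ((m : ℂ) + 1)) / 3 := by rw [hx]; ring
    rw [e1, e2]
    push_cast
    rw [show 3 * (k : ℂ) + ((m : ℂ) + 1) + ((m : ℂ) + 1) = 3 * (k : ℂ) + 2 * ((m : ℂ) + 1) by ring]
    have e3 : 3 * (k : ℂ) + 2 * ((m : ℂ) + 1) = 3 * (k : ℂ) + ((m : ℂ) + 1) + ((m : ℂ) + 1) := by ring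
    rw [e3] at n2 ⊢
    clear e1 e2 e3
    clear_value x
    generalize 3 * (k : ℂ) + ((m : ℂ) + 1) = A at *
    generalize (m : ℂ) + 1 = M at *
    field_simp
    ring
  have hsum := tm_summable 1 1 m (by norm_num)
  have h0 : (1 / (3 * ((m : ℂ) + 1))) ≠ 0 := by
    apply one_div_ne_zero
    exact mul_ne_zero (by norm_num) hm
  have hs : Summable (fun k : ℤ => 1 / (x + k) - 1 / (2 * x + k)) := by
    have := hsum.comp_injective hinj
    rw [← summable_mul_left_iff h0]
    refine this.congr fun k => ?_
    exact hterm k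
  have hval : hh 1 1 m = ∑' k : ℤ, tm 1 1 m (3 * k + (m + 1)) := by
    unfold hh
    symm
    apply hinj.tsum_eq
    intro n hn
    by_contra hcon
    apply hn
    unfold tm
    rw [if_neg]
    rintro ⟨⟨v, hv⟩, -⟩
    exact hcon ⟨v, by simp only; omega⟩
  rw [hval, tsum_congr hterm, tsum_mul_left, cot_diff _ _ hx1 hx2 hs,
    Complex.cot_pi_eq_exp_ratio, Complex.cot_pi_eq_exp_ratio]
  have w1 : Complex.exp (2 * Real.pi * I * x) = om ^ (m + 1) := by
    rw [om, ← Complex.exp_nat_mul]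
    congr 1
    rw [hx]; push_cast; ring
  have w2 : Complex.exp (2 * Real.pi * I * (2 * x)) = (om ^ (m + 1)) ^ 2 := by
    rw [← w1, ← Complex.exp_nat_mul]
    congr 1
    push_cast; ring
  rw [w1, w2]
  have ho := om_orth (m + 1)
  rw [if_neg h, show 2 * (m + 1) = (m + 1) * 2 by ring, pow_mul] at ho
  have hw1 : om ^ (m + 1) ≠ 1 := fun e => h ((om_prim.pow_eq_one_iff_dvd _).mp e)
  generalize om ^ (m + 1) = w at *
  have hw : w ^ 2 = - 1 - w := by linear_combination 3 * ho
  have hd1 : 1 - w ≠ 0 := sub_ne_zero.mpr (Ne.symm hw1)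
  have r1 : (w + 1) / (I * (1 - w)) = (w - w ^ 2) / (3 * I) := by
    have := I_ne_zero
    field_simp
    linear_combination (-w + 3) * hw
  have r2 : (w ^ 2 + 1) / (I * (1 - w ^ 2)) = -(w - w ^ 2) / (3 * I) := by
    have hd2 : 1 - w ^ 2 ≠ 0 := by
      rw [hw]
      intro h'
      have h3 : w = -2 := by linear_combination h'
      rw [h3] at hw; norm_num at hw
    have := I_ne_zero
    field_simp
    linear_combination (w ^ 2 - 2 * w + 3) * hw
  rw [r1, r2]
  have := I_ne_zero
  field_simp
  ring

lemma hh11_mem : hh 1 1 ∈ PP 1 := by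
  have q3 : ((2 / 3 : ℚ) : ℂ) ∈ AA := rat_mem _
  have qi : ((-2 / 9 : ℚ) : ℂ) * Real.pi * I ∈ AA :=
    AA.mul_mem (AA.mul_mem (rat_mem _) pi_mem) I_mem
  have h := PP_add (PP_smul (PP_sub (PP_basis 1 1 1 le_rfl) (PP_basis 1 1 2 le_rfl)) qi)
    (PP_smul (PP_add (PP_add (PP_basis 1 2 0 (by omega)) (PP_basis 1 2 1 (by omega)))
      (PP_basis 1 2 2 (by omega))) q3)
  convert h using 1
  ext m
  have ho := om_orth (m + 1)
  rw [show 2 * (m + 1) = (m + 1) * 2 by ring, pow_mul] at ho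
  have hm := M_ne m
  by_cases hd : 3 ∣ m + 1
  · rw [hh11_dvd m hd, (om_prim.pow_eq_one_iff_dvd _).mpr hd]
    push_cast
    field_simp
    ring
  · rw [if_neg hd] at ho
    rw [hh11_not_dvd m hd]
    generalize om ^ (m + 1) = w at *
    rw [← mul_div_assoc', div_eq_mul_inv (2 * (Real.pi : ℂ)), mul_inv, inv_I]
    push_cast
    field_simp
    linear_combination (-27 : ℂ) * ho

lemma hh_mem_aux (s : ℕ) : ∀ b c : ℕ, b + c = s → 2 ≤ s →
    hh b c ∈ PP 0 ∧ (0 < b → 0 < c → hh b c ∈ PP 1) := by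
  induction s with
  | zero => intro b c _ h; omega
  | succ s ih =>
    intro b c hbc hs
    rcases b with _ | b
    · refine ⟨?_, fun h => absurd h (lt_irrefl 0)⟩
      have hc : 2 ≤ c := by omega
      have := PP_smul (base_b_mem c hc) (AA.pow_mem (AA.neg_mem AA.one_mem) (0 + c))
      convert this using 1
      ext m
      exact hh_symm 0 c m
    · rcases c with _ | c
      · exact ⟨base_b_mem (b + 1) (by omega), fun _ h => absurd h (lt_irrefl 0)⟩
      · have h1 : hh (b + 1) (c + 1) ∈ PP 1 := by
          by_cases h0 : b + c = 0
          · obtain ⟨rfl, rfl⟩ : b = 0 ∧ c = 0 := by omega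
            exact hh11_mem
          · have ha := (ih (b + 1) c (by omega) (by omega)).1
            have hb := (ih b (c + 1) (by omega) (by omega)).1
            have := PP_div (PP_sub ha hb) 1
            convert this using 1
            ext m
            exact hh_rec b c m (by omega)
        exact ⟨PP_mono (Nat.zero_le 1) h1, fun _ _ => h1⟩

lemma hh_mem (b c : ℕ) (hb : 0 < b) (hc : 0 < c) : hh b c ∈ PP 1 :=
  (hh_mem_aux (b + c) b c rfl (by omega)).2 hb hc

noncomputable def tt (a b c : ℕ) (pr : ℕ × ℕ) : ℂ :=
  if (pr.1 + 1) % 3 = (pr.2 + 1) % 3 then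
      (1 : ℂ) / (((pr.1 : ℂ) + 1) ^ a * ((pr.2 : ℂ) + 1) ^ b
        * ((pr.1 : ℂ) + (pr.2 : ℂ) + 2) ^ c) else 0

lemma tt_bound (x y : ℝ) (hx : 1 ≤ x) (hy : 1 ≤ y) (a b c : ℕ) (ha : 0 < a) (hb : 0 < b)
    (hc : 0 < c) : 1 / (x ^ a * y ^ b * (x + y) ^ c) ≤ 1 / x ^ (3 / 2 : ℝ) * (1 / y ^ (3 / 2 : ℝ)) := by
  have hx0 : 0 < x := by linarith
  have hy0 : 0 < y := by linarith
  rw [one_div_mul_one_div]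
  apply one_div_le_one_div_of_le (by positivity)
  have e : ∀ z : ℝ, 0 < z → z ^ (3 / 2 : ℝ) = z * Real.sqrt z := by
    intro z hz
    rw [Real.sqrt_eq_rpow, ← Real.rpow_one_add' hz.le (by norm_num)]
    norm_num
  rw [e x hx0, e y hy0]
  have h1 : x ≤ x ^ a := le_self_pow₀ hx (by omega)
  have h2 : y ≤ y ^ b := le_self_pow₀ hy (by omega)
  have h3 : x + y ≤ (x + y) ^ c := le_self_pow₀ (by linarith) (by omega)
  have h4 : Real.sqrt x * Real.sqrt y ≤ x + y := by
    nlinarith [Real.sq_sqrt hx0.le, Real.sq_sqrt hy0.le, sq_nonneg (Real.sqrt x - Real.sqrt y)]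
  calc x * Real.sqrt x * (y * Real.sqrt y) = x * y * (Real.sqrt x * Real.sqrt y) := by ring
    _ ≤ x * y * (x + y) := by gcongr
    _ ≤ x ^ a * y ^ b * (x + y) ^ c := by gcongr

lemma tt_summable (a b c : ℕ) (ha : 0 < a) (hb : 0 < b) (hc : 0 < c) : Summable (tt a b c) := by
  have h1 : Summable (fun m : ℕ => 1 / ((m : ℝ) + 1) ^ (3 / 2 : ℝ)) := by
    have := (summable_nat_add_iff 1).mpr
      (Real.summable_one_div_nat_rpow.mpr (by norm_num : (1 : ℝ) < 3 / 2))
    simpa using this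
  have h2 := h1.mul_of_nonneg h1 (fun m => by positivity) (fun m => by positivity)
  refine Summable.of_norm_bounded h2 fun p => ?_
  unfold tt
  split_ifs
  · have := tt_bound ((p.1 : ℝ) + 1) ((p.2 : ℝ) + 1) (by simp) (by simp) a b c ha hb hc
    refine le_trans (le_of_eq ?_) this
    have e1 : (p.1 : ℂ) + 1 = ((p.1 + 1 : ℕ) : ℂ) := by push_cast; ring
    have e2 : (p.2 : ℂ) + 1 = ((p.2 + 1 : ℕ) : ℂ) := by push_cast; ring
    have e3 : (p.1 : ℂ) + (p.2 : ℂ) + 2 = ((p.1 + p.2 + 2 : ℕ) : ℂ) := by push_cast; ring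
    rw [e1, e2, e3, norm_div, norm_mul, norm_mul, norm_pow, norm_pow, norm_pow,
      Complex.norm_natCast, Complex.norm_natCast, Complex.norm_natCast, norm_one]
    push_cast
    ring
  · rw [norm_zero]
    positivity

noncomputable def TT (a b c : ℕ) : ℂ := ∑' p, tt a b c p

lemma TT_symm (a b c : ℕ) : TT a b c = TT b a c := by
  unfold TT
  rw [← (Equiv.prodComm ℕ ℕ).tsum_eq]
  apply tsum_congr
  rintro ⟨p, q⟩
  simp only [Equiv.prodComm_apply, Prod.swap_prod_mk]
  unfold tt
  simp only
  rw [add_comm (q : ℂ) p, mul_comm (((q : ℂ) + 1) ^ a)]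
  simp only [eq_comm]

noncomputable def ff (a b c : ℕ) (x : ℕ × ℤ) : ℂ := tm b c x.1 x.2 / ((x.1 : ℂ) + 1) ^ a

lemma piece (F : ℕ × ℤ → ℂ) (g : ℕ × ℕ → ℕ × ℤ) (hg : Function.Injective g) (P : ℕ × ℤ → Prop)
    [DecidablePred P] (hP : ∀ x, P x ↔ x ∈ Set.range g) (G : ℕ × ℕ → ℂ) (s : ℂ) (hG : Summable G)
    (h : ∀ p, F (g p) = s * G p) :
    HasSum (fun x => if P x then F x else 0) (s * ∑' p, G p) := by
  rw [← hg.hasSum_iff]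
  · refine hs_congr (hG.hasSum.mul_left s) fun p => ?_
    have : P (g p) := (hP _).mpr ⟨p, rfl⟩
    simp only [Function.comp_apply, if_pos this]
    exact h p
  · intro x hx
    rw [if_neg]
    rwa [hP]

lemma ff_hasSum (a b c : ℕ) (ha : 0 < a) (hb : 0 < b) (hc : 0 < c) :
    HasSum (ff a b c) (TT a b c + (-1) ^ b * TT b c a + (-1) ^ (b + c) * TT a c b) := by
  have h1 := piece (ff a b c) (fun p => (p.1, (p.2 : ℤ) + 1))
    (fun p q h => by simp only [Prod.mk.injEq] at h; ext <;> omega)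
    (fun x => 0 < x.2)
    (fun x => ⟨fun h => ⟨(x.1, (x.2 - 1).toNat), by ext <;> simp; omega⟩, by
      rintro ⟨p, rfl⟩; simp only; omega⟩)
    (tt a b c) 1 (tt_summable a b c ha hb hc) (by
      rintro ⟨p, q⟩
      simp only [ff, tm, tt]
      have : ((3 : ℤ) ∣ (q : ℤ) + 1 - (p + 1) ∧ (q : ℤ) + 1 ≠ 0 ∧ (q : ℤ) + 1 + (p + 1) ≠ 0) ↔
        (p + 1) % 3 = (q + 1) % 3 := by omega
      simp only [this]
      split_ifs
      · push_cast
        rw [show (q : ℂ) + 1 + (p + 1) = p + q + 2 by ring, div_div, one_mul]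
        congr 1
        ring
      · simp)
  have h2 := piece (ff a b c) (fun p => (p.1 + p.2 + 1, -((p.1 : ℤ) + 1)))
    (fun p q h => by simp only [Prod.mk.injEq] at h; ext <;> omega)
    (fun x => x.2 < 0 ∧ -((x.1 : ℤ) + 1) < x.2)
    (fun x => ⟨fun h => ⟨((-x.2 - 1).toNat, (x.2 + x.1).toNat), by
        ext <;> simp only <;> omega⟩, by
      rintro ⟨p, rfl⟩; simp only; omega⟩)
    (tt b c a) ((-1) ^ b) (tt_summable b c a hb hc ha) (by
      rintro ⟨p, q⟩
      simp only [ff, tm, tt]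
      have : ((3 : ℤ) ∣ -((p : ℤ) + 1) - (((p + q + 1 : ℕ) : ℤ) + 1) ∧ -((p : ℤ) + 1) ≠ 0 ∧
          -((p : ℤ) + 1) + (((p + q + 1 : ℕ) : ℤ) + 1) ≠ 0) ↔
        (p + 1) % 3 = (q + 1) % 3 := by omega
      simp only [this]
      split_ifs
      · push_cast
        have hs : ((-1 : ℂ) ^ b) * (-1) ^ b = 1 := by rw [← mul_pow]; simp
        have i1 : ((-1 : ℂ) ^ b) ≠ 0 := by simp
        rw [show -((p : ℂ) + 1) + (p + q + 1 + 1) = q + 1 by ring, div_div, neg_pow,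
          show (p : ℂ) + q + 1 + 1 = p + q + 2 by ring,
          show (-1 : ℂ) ^ b * ((p : ℂ) + 1) ^ b * ((q : ℂ) + 1) ^ c * ((p : ℂ) + q + 2) ^ a =
            (-1 : ℂ) ^ b * (((p : ℂ) + 1) ^ b * ((q : ℂ) + 1) ^ c * ((p : ℂ) + q + 2) ^ a) by ring,
          one_div, mul_inv, inv_eq_of_mul_eq_one_left hs, one_div]
      · simp)
  have h3 := piece (ff a b c) (fun p => (p.1, -((p.1 : ℤ) + p.2 + 2)))
    (fun p q h => by simp only [Prod.mk.injEq] at h; ext <;> omega)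
    (fun x => x.2 < -((x.1 : ℤ) + 1))
    (fun x => ⟨fun h => ⟨(x.1, (-x.2 - x.1 - 2).toNat), by
        ext <;> simp only <;> omega⟩, by
      rintro ⟨p, rfl⟩; simp only; omega⟩)
    (tt a c b) ((-1) ^ (b + c)) (tt_summable a c b ha hc hb) (by
      rintro ⟨p, q⟩
      simp only [ff, tm, tt]
      have : ((3 : ℤ) ∣ -((p : ℤ) + q + 2) - ((p : ℤ) + 1) ∧ -((p : ℤ) + q + 2) ≠ 0 ∧
          -((p : ℤ) + q + 2) + ((p : ℤ) + 1) ≠ 0) ↔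
        (p + 1) % 3 = (q + 1) % 3 := by omega
      simp only [this]
      split_ifs
      · push_cast
        have hs : ((-1 : ℂ) ^ (b + c)) * (-1) ^ (b + c) = 1 := by rw [← mul_pow]; simp
        rw [show -((p : ℂ) + q + 2) + (p + 1) = -(q + 1) by ring, div_div, neg_pow, neg_pow ((q : ℂ) + 1),
          show (-1 : ℂ) ^ b * ((p : ℂ) + q + 2) ^ b * ((-1) ^ c * ((q : ℂ) + 1) ^ c) * ((p : ℂ) + 1) ^ a =
            (-1 : ℂ) ^ (b + c) * (((p : ℂ) + 1) ^ a * ((q : ℂ) + 1) ^ c * ((p : ℂ) + q + 2) ^ b) by ring,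
          one_div, mul_inv, inv_eq_of_mul_eq_one_left hs, one_div]
      · simp)
  have h := (h1.add h2).add h3
  rw [one_mul] at h
  refine hs_congr h fun x => ?_
  by_cases c1 : 0 < x.2
  · rw [if_pos c1, if_neg (by omega), if_neg (by omega)]; simp
  · by_cases c2 : x.2 < -((x.1 : ℤ) + 1)
    · rw [if_neg c1, if_neg (by omega), if_pos c2]; simp
    · by_cases c3 : x.2 < 0 ∧ -((x.1 : ℤ) + 1) < x.2
      · rw [if_neg c1, if_pos c3, if_neg c2]; simp
      · rw [if_neg c1, if_neg c3, if_neg c2]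
        simp only [ff, tm]
        rw [if_neg (by omega)]
        simp

lemma E_mem (a b c : ℕ) (ha : 0 < a) (hb : 0 < b) (hc : 0 < c) :
    TT a b c + (-1) ^ b * TT b c a + (-1) ^ (b + c) * TT a c b ∈ AA := by
  have h := ff_hasSum a b c ha hb hc
  rw [← h.tsum_eq, h.summable.tsum_prod]
  have e : ∀ m : ℕ, ∑' n : ℤ, ff a b c (m, n) = hh b c m / ((m : ℂ) + 1) ^ a := by
    intro m
    simp only [ff, hh]
    rw [tsum_div_const]
  rw [tsum_congr e]
  exact (PP_sum (PP_mono (by omega) (PP_div (hh_mem b c hb hc) a))).2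

lemma TT_mem (a b c : ℕ) (ha : 0 < a) (hb : 0 < b) (hc : 0 < c) (hodd : Odd (a + b + c)) :
    TT a b c ∈ AA := by
  have h1 := E_mem a b c ha hb hc
  have h2 := E_mem b a c hb ha hc
  have h := AA.mul_mem (rat_mem (1 / 2)) (AA.add_mem h1 h2)
  convert h using 1
  rw [TT_symm b a c]
  have p1 : (-1 : ℂ) ^ (b + c) = - (-1) ^ a := by
    have := hodd.neg_one_pow (α := ℂ)
    have ea : (-1 : ℂ) ^ a * (-1) ^ a = 1 := by rw [← mul_pow]; simp
    rw [show a + b + c = a + (b + c) by ring, pow_add] at this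
    linear_combination (-1) ^ a * this - (-1 : ℂ) ^ (b + c) * ea
  have p2 : (-1 : ℂ) ^ (a + c) = - (-1) ^ b := by
    have := hodd.neg_one_pow (α := ℂ)
    have ea : (-1 : ℂ) ^ b * (-1) ^ b = 1 := by rw [← mul_pow]; simp
    rw [show a + b + c = b + (a + c) by ring, pow_add] at this
    linear_combination (-1) ^ b * this - (-1 : ℂ) ^ (a + c) * ea
  rw [p1, p2]
  push_cast
  ring

end PU3

/-- Parity result for PU(3): if a+b+c is odd, then ζ₂PU3(a,b,c) lies in the
ℚ-subalgebra of ℂ generated by π, i and the Lerch values φ(j, a'/3)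
(j ≥ 2, a' ∈ {0,1,2}). -/
theorem zeta2_PU3_parity (a b c : ℕ) (ha : 0 < a) (hb : 0 < b) (hc : 0 < c)
    (hodd : Odd (a + b + c)) :
    (∑' pr : ℕ × ℕ, (if (pr.1 + 1) % 3 = (pr.2 + 1) % 3 then
      (1 : ℂ) / (((pr.1 : ℂ) + 1) ^ a * ((pr.2 : ℂ) + 1) ^ b
        * ((pr.1 : ℂ) + (pr.2 : ℂ) + 2) ^ c) else 0))
    ∈ Algebra.adjoin ℚ
        ({(Real.pi : ℂ), Complex.I} ∪
          {z : ℂ | ∃ j : ℕ, 2 ≤ j ∧ ∃ a' : ℕ, a' ≤ 2 ∧ z = lerchValueThird j a'}) := by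
  exact PU3.TT_mem a b c ha hb hc hodd
end

section
/- Let a, b, c, d be positive integers such that a+b+c+d is odd. Then ζ₂PSp2(a,b,c,d) lies in the ℚ-subalgebra of ℝ generated by the Riemann zeta values ζ(k) for integers k ≥ 2; i.e., it can be expressed as a polynomial with rational coefficients in the values ζ(2), ζ(3), ζ(4), …. -/
open Filter Topology

namespace PSpAux

noncomputable def AZ : Subalgebra ℚ ℝ := Algebra.adjoin ℚ
  {x : ℝ | ∃ k : ℕ, 2 ≤ k ∧ x = ∑' n : ℕ, (1 : ℝ) / ((n : ℝ) + 1) ^ k}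

lemma rat_mem (r : ℚ) : (r : ℝ) ∈ AZ := by
  have := AZ.algebraMap_mem r
  simpa using this

lemma inv_two_mem : (2 : ℝ)⁻¹ ∈ AZ := by
  have := rat_mem (2⁻¹)
  simpa using this

lemma neg_one_pow_mem (k : ℕ) : (-1 : ℝ) ^ k ∈ AZ :=
  AZ.pow_mem (AZ.neg_mem AZ.one_mem) k

lemma zeta_hasSum (i : ℕ) (hi : 2 ≤ i) :
    ∃ x ∈ AZ, HasSum (fun n : ℕ => ((n : ℝ) + 1)⁻¹ ^ i) x := by
  refine ⟨∑' n : ℕ, (1 : ℝ) / ((n : ℝ) + 1) ^ i,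
    Algebra.subset_adjoin ⟨i, hi, rfl⟩, ?_⟩
  have h : Summable (fun n : ℕ => (1 : ℝ) / ((n : ℝ) + 1) ^ i) := by
    have := (summable_nat_add_iff 1).2 (Real.summable_one_div_nat_pow.2 (by omega : 1 < i))
    simpa using this
  simpa [one_div, inv_pow] using h.hasSum

lemma odd_hasSum (i : ℕ) (hi : 2 ≤ i) :
    ∃ x ∈ AZ, HasSum (fun n : ℕ => (2 * (n : ℝ) + 1)⁻¹ ^ i) x := by
  obtain ⟨x, hx, h⟩ := zeta_hasSum i hi
  have h1 : HasSum (fun n : ℕ => ((2 * n + 1 : ℕ) + 1 : ℝ)⁻¹ ^ i) ((2 : ℝ)⁻¹ ^ i * x) := by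
    refine (h.mul_left ((2 : ℝ)⁻¹ ^ i)).congr_fun ?_
    intro n
    rw [← mul_pow, ← mul_inv]
    push_cast
    ring_nf
  have hinj : Function.Injective (fun n : ℕ => 2 * n) := fun a b h => by
    simpa using h
  have h2 : Summable (fun n : ℕ => ((2 * n : ℕ) + 1 : ℝ)⁻¹ ^ i) :=
    h.summable.comp_injective hinj
  have h3 := HasSum.even_add_odd (f := fun n : ℕ => ((n : ℝ) + 1)⁻¹ ^ i) h2.hasSum h1
  have h4 := h3.unique h
  refine ⟨x - (2 : ℝ)⁻¹ ^ i * x,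
    AZ.sub_mem hx (AZ.mul_mem (AZ.pow_mem inv_two_mem i) hx), ?_⟩
  have h5 := h2.hasSum
  rw [eq_sub_of_add_eq h4] at h5
  simpa using h5

lemma evenind_hasSum (i : ℕ) (hi : 2 ≤ i) :
    ∃ x ∈ AZ, HasSum (fun n : ℕ => if n % 2 = 0 then ((n : ℝ) + 1)⁻¹ ^ i else 0) x := by
  obtain ⟨x, hx, h⟩ := odd_hasSum i hi
  refine ⟨x, hx, ?_⟩
  have hinj : Function.Injective (fun n : ℕ => 2 * n) := fun a b h => by
    simpa using h
  refine (hinj.hasSum_iff ?_).1 ?_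
  · intro n hn
    rw [if_neg]
    intro h0
    exact hn ⟨n / 2, by dsimp only; omega⟩
  · refine h.congr_fun ?_
    intro n
    simp

/-- principal value sums over the integers -/
def PV (f : ℤ → ℝ) (x : ℝ) : Prop :=
  Tendsto (fun N : ℕ => ∑ k ∈ Finset.range N, (f k + f (-((k : ℤ) + 1)))) atTop (𝓝 x)

lemma PV.unique {f : ℤ → ℝ} {x y : ℝ} (h : PV f x) (h' : PV f y) : x = y :=
  tendsto_nhds_unique h h'

lemma PV.of_hasSum {f : ℤ → ℝ} {x : ℝ} (h : HasSum f x) : PV f x :=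
  h.nat_add_neg_add_one.tendsto_sum_nat

lemma PV.add {f g : ℤ → ℝ} {x y : ℝ} (h : PV f x) (h' : PV g y) :
    PV (fun q => f q + g q) (x + y) := by
  refine (Tendsto.add h h').congr fun N => ?_
  rw [← Finset.sum_add_distrib]
  exact Finset.sum_congr rfl fun k _ => by ring

lemma PV.smul {f : ℤ → ℝ} {x : ℝ} (r : ℝ) (h : PV f x) :
    PV (fun q => r * f q) (r * x) := by
  refine (Tendsto.const_mul r h).congr fun N => ?_
  rw [Finset.mul_sum]
  exact Finset.sum_congr rfl fun k _ => by ring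

lemma PV.congr {f g : ℤ → ℝ} {x y : ℝ} (h : PV f x) (hfg : ∀ q, g q = f q) (hxy : y = x) :
    PV g y := by
  have : g = f := funext hfg
  rw [this, hxy]; exact h

lemma PV.single (q₀ : ℤ) (y : ℝ) : PV (fun q => if q = q₀ then y else 0) y :=
  PV.of_hasSum (by simpa using hasSum_ite_eq q₀ y)

/-- deleting one point -/
lemma PV.delete {f : ℤ → ℝ} {x : ℝ} (h : PV f x) (q₀ : ℤ) :
    PV (fun q => if q = q₀ then 0 else f q) (x - f q₀) := by
  refine (h.add (PV.single q₀ (-f q₀))).congr (fun q => ?_) (by ring)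
  by_cases hq : q = q₀ <;> simp [hq]

def Van (f : ℤ → ℝ) : Prop :=
  Tendsto (fun k : ℕ => f k) atTop (𝓝 0) ∧ Tendsto (fun k : ℕ => f (-(k : ℤ))) atTop (𝓝 0)

lemma PV.shift_one {f : ℤ → ℝ} {x : ℝ} (h : PV f x) (hv : Van f) :
    PV (fun q => f (q + 1)) x := by
  have h1 : Tendsto (fun N : ℕ => (f N - f (-(N : ℤ)))) atTop (𝓝 (0 - 0)) := hv.1.sub hv.2
  have h2 := Tendsto.add h h1
  simp only [sub_zero, add_zero] at h2
  refine h2.congr fun N => ?_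
  induction N with
  | zero => simp
  | succ n ih =>
    rw [Finset.sum_range_succ, Finset.sum_range_succ, ← ih]
    push_cast
    rw [show -((n : ℤ) + 1) + 1 = -n by ring]
    ring

lemma Van.shift_one {f : ℤ → ℝ} (hv : Van f) : Van (fun q => f (q + 1)) := by
  refine ⟨?_, ?_⟩
  · have := hv.1.comp (tendsto_add_atTop_nat 1)
    refine this.congr fun k => ?_
    simp
  · refine (tendsto_add_atTop_iff_nat 1).1 ?_
    refine hv.2.congr fun k => ?_
    push_cast
    congr 1
    ring

lemma PV.shift {f : ℤ → ℝ} {x : ℝ} (h : PV f x) (hv : Van f) (k : ℕ) :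
    PV (fun q => f (q + k)) x ∧ Van (fun q => f (q + k)) := by
  induction k with
  | zero => simpa using ⟨h, hv⟩
  | succ n ih =>
    have := And.intro (ih.1.shift_one ih.2) ih.2.shift_one
    push_cast
    simpa only [add_assoc, add_comm (1 : ℤ)] using this

lemma lin_tendsto (r s : ℝ) (hr : 0 < r) (i : ℕ) (hi : 1 ≤ i) :
    Tendsto (fun k : ℕ => (r * (k : ℝ) + s)⁻¹ ^ i) atTop (𝓝 0) := by
  have h1 : Tendsto (fun k : ℕ => r * (k : ℝ) + s) atTop atTop :=
    tendsto_atTop_add_const_right _ _ (tendsto_natCast_atTop_atTop.const_mul_atTop hr)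
  have h2 := (tendsto_inv_atTop_zero.comp h1).pow i
  rw [zero_pow (by omega)] at h2
  exact h2

lemma lin_van (r s : ℝ) (hr : 0 < r) (i : ℕ) (hi : 1 ≤ i) :
    Van (fun q : ℤ => (r * (q : ℝ) + s)⁻¹ ^ i) := by
  refine ⟨by simpa using lin_tendsto r s hr i hi, ?_⟩
  have h := (lin_tendsto r (-s) hr i hi).const_mul ((-1 : ℝ) ^ i)
  rw [mul_zero] at h
  refine h.congr fun k => ?_
  rw [← mul_pow]
  push_cast
  congr 1
  rw [show r * -(k : ℝ) + s = -(r * k + -s) by ring, inv_neg]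
  ring

lemma B1 (i : ℕ) (hi : 1 ≤ i) :
    ∃ x ∈ AZ, PV (fun q : ℤ => (q : ℝ)⁻¹ ^ i) x := by
  rcases Nat.lt_or_ge i 2 with h | h
  · obtain rfl : i = 1 := by omega
    refine ⟨0, AZ.zero_mem, ?_⟩
    have h1 : Tendsto (fun k : ℕ => -((1 : ℝ) * (k : ℝ) + 0)⁻¹ ^ 1) atTop (𝓝 (-0)) :=
      (lin_tendsto 1 0 one_pos 1 le_rfl).neg
    rw [neg_zero] at h1
    refine h1.congr fun N => ?_
    induction N with
    | zero => simp
    | succ n ih =>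
      rw [Finset.sum_range_succ, ← ih]
      push_cast
      rw [inv_neg]
      ring
  · obtain ⟨x, hx, hs⟩ := zeta_hasSum i h
    refine ⟨x + (-1) ^ i * x, AZ.add_mem hx (AZ.mul_mem (neg_one_pow_mem i) hx), ?_⟩
    apply PV.of_hasSum
    refine HasSum.of_nat_of_neg_add_one ?_ ?_
    · refine (hasSum_nat_add_iff' 1).1 ?_
      simpa [show i ≠ 0 by omega] using hs
    · refine (hs.mul_left ((-1) ^ i)).congr_fun fun n => ?_
      rw [← mul_pow]
      push_cast
      rw [inv_neg]
      ring

lemma B2 (i : ℕ) (hi : 1 ≤ i) :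
    ∃ x ∈ AZ, PV (fun q : ℤ => (2 * (q : ℝ) + 1)⁻¹ ^ i) x := by
  rcases Nat.lt_or_ge i 2 with h | h
  · obtain rfl : i = 1 := by omega
    refine ⟨0, AZ.zero_mem, ?_⟩
    refine tendsto_const_nhds.congr fun N => ?_
    symm
    apply Finset.sum_eq_zero
    intro k _
    push_cast
    rw [show (2 : ℝ) * -((k : ℝ) + 1) + 1 = -(2 * k + 1) by ring, inv_neg]
    ring
  · obtain ⟨x, hx, hs⟩ := odd_hasSum i h
    refine ⟨x + (-1) ^ i * x, AZ.add_mem hx (AZ.mul_mem (neg_one_pow_mem i) hx), ?_⟩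
    apply PV.of_hasSum
    refine HasSum.of_nat_of_neg_add_one ?_ ?_
    · simpa using hs
    · refine (hs.mul_left ((-1) ^ i)).congr_fun fun n => ?_
      rw [← mul_pow]
      push_cast
      rw [show (2 : ℝ) * -((n : ℝ) + 1) + 1 = -(2 * n + 1) by ring, inv_neg]
      ring

def Good (p : ℕ → ℝ) (t : ℕ) (f : ℕ → ℤ → ℝ) : Prop :=
  ∃ g : ℕ → ℝ, (∀ u, PV (f u) (g u)) ∧
    ∀ s, t ≤ s → ∃ x ∈ AZ, HasSum (fun u => (p u)⁻¹ ^ s * g u) x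

lemma Good.mono {p : ℕ → ℝ} {t t' : ℕ} {f : ℕ → ℤ → ℝ} (h : Good p t f) (ht : t ≤ t') :
    Good p t' f := by
  obtain ⟨g, h1, h2⟩ := h
  exact ⟨g, h1, fun s hs => h2 s (ht.trans hs)⟩

lemma Good.comb {p : ℕ → ℝ} {t : ℕ} {f f₁ f₂ : ℕ → ℤ → ℝ}
    (h₁ : Good p (t + 1) f₁) (h₂ : Good p (t + 1) f₂) (r₁ r₂ : ℚ)
    (hf : ∀ u q, f u q = (p u)⁻¹ * (r₁ * f₁ u q + r₂ * f₂ u q)) : Good p t f := by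
  obtain ⟨g₁, h1, h1'⟩ := h₁
  obtain ⟨g₂, h2, h2'⟩ := h₂
  refine ⟨fun u => (p u)⁻¹ * (r₁ * g₁ u + r₂ * g₂ u), fun u => ?_, fun s hs => ?_⟩
  · exact ((((h1 u).smul r₁).add ((h2 u).smul r₂)).smul (p u)⁻¹).congr (hf u) rfl
  · obtain ⟨x, hx, hx'⟩ := h1' (s + 1) (by omega)
    obtain ⟨y, hy, hy'⟩ := h2' (s + 1) (by omega)
    refine ⟨r₁ * x + r₂ * y, AZ.add_mem (AZ.mul_mem (rat_mem _) hx)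
      (AZ.mul_mem (rat_mem _) hy), ?_⟩
    refine ((hx'.mul_left (r₁ : ℝ)).add (hy'.mul_left (r₂ : ℝ))).congr_fun fun u => ?_
    ring

open Classical in
noncomputable def pf (L₁ L₂ L₃ : ℕ → ℤ → ℝ) (b c d : ℕ) (u : ℕ) (q : ℤ) : ℝ :=
  if L₁ u q = 0 ∨ L₂ u q = 0 ∨ L₃ u q = 0 then 0
  else (L₁ u q)⁻¹ ^ b * (L₂ u q)⁻¹ ^ c * (L₃ u q)⁻¹ ^ d

section
variable {p : ℕ → ℝ} {L₁ L₂ L₃ : ℕ → ℤ → ℝ}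

lemma pf12 (hp : ∀ u, p u ≠ 0) (r s : ℚ)
    (h : ∀ u q, p u = r * L₁ u q + s * L₂ u q) (b c d : ℕ) (u : ℕ) (q : ℤ) :
    pf L₁ L₂ L₃ (b + 1) (c + 1) d u q =
      (p u)⁻¹ * (r * pf L₁ L₂ L₃ b (c + 1) d u q + s * pf L₁ L₂ L₃ (b + 1) c d u q) := by
  unfold pf
  split_ifs with h0
  · simp
  · push Not at h0
    rw [eq_inv_mul_iff_mul_eq₀ (hp u), h u q]
    have h1 : L₁ u q * (L₁ u q)⁻¹ = 1 := mul_inv_cancel₀ h0.1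
    have h2 : L₂ u q * (L₂ u q)⁻¹ = 1 := mul_inv_cancel₀ h0.2.1
    linear_combination (r * (L₁ u q)⁻¹ ^ b * (L₂ u q)⁻¹ ^ (c + 1) * (L₃ u q)⁻¹ ^ d) * h1 +
      (s * (L₁ u q)⁻¹ ^ (b + 1) * (L₂ u q)⁻¹ ^ c * (L₃ u q)⁻¹ ^ d) * h2

lemma pf13 (hp : ∀ u, p u ≠ 0) (r s : ℚ)
    (h : ∀ u q, p u = r * L₁ u q + s * L₃ u q) (b c d : ℕ) (u : ℕ) (q : ℤ) :
    pf L₁ L₂ L₃ (b + 1) c (d + 1) u q =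
      (p u)⁻¹ * (r * pf L₁ L₂ L₃ b c (d + 1) u q + s * pf L₁ L₂ L₃ (b + 1) c d u q) := by
  unfold pf
  split_ifs with h0
  · simp
  · push Not at h0
    rw [eq_inv_mul_iff_mul_eq₀ (hp u), h u q]
    have h1 : L₁ u q * (L₁ u q)⁻¹ = 1 := mul_inv_cancel₀ h0.1
    have h2 : L₃ u q * (L₃ u q)⁻¹ = 1 := mul_inv_cancel₀ h0.2.2
    linear_combination (r * (L₁ u q)⁻¹ ^ b * (L₂ u q)⁻¹ ^ c * (L₃ u q)⁻¹ ^ (d + 1)) * h1 +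
      (s * (L₁ u q)⁻¹ ^ (b + 1) * (L₂ u q)⁻¹ ^ c * (L₃ u q)⁻¹ ^ d) * h2

lemma pf23 (hp : ∀ u, p u ≠ 0) (r s : ℚ)
    (h : ∀ u q, p u = r * L₂ u q + s * L₃ u q) (b c d : ℕ) (u : ℕ) (q : ℤ) :
    pf L₁ L₂ L₃ b (c + 1) (d + 1) u q =
      (p u)⁻¹ * (r * pf L₁ L₂ L₃ b c (d + 1) u q + s * pf L₁ L₂ L₃ b (c + 1) d u q) := by
  unfold pf
  split_ifs with h0
  · simp
  · push Not at h0
    rw [eq_inv_mul_iff_mul_eq₀ (hp u), h u q]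
    have h1 : L₂ u q * (L₂ u q)⁻¹ = 1 := mul_inv_cancel₀ h0.2.1
    have h2 : L₃ u q * (L₃ u q)⁻¹ = 1 := mul_inv_cancel₀ h0.2.2
    linear_combination (r * (L₁ u q)⁻¹ ^ b * (L₂ u q)⁻¹ ^ c * (L₃ u q)⁻¹ ^ (d + 1)) * h1 +
      (s * (L₁ u q)⁻¹ ^ b * (L₂ u q)⁻¹ ^ (c + 1) * (L₃ u q)⁻¹ ^ d) * h2

lemma pf_good2 (hp : ∀ u, p u ≠ 0) (r s r' s' r'' s'' : ℚ)
    (h : ∀ u q, p u = r * L₁ u q + s * L₂ u q)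
    (h' : ∀ u q, p u = r' * L₁ u q + s' * L₃ u q)
    (h'' : ∀ u q, p u = r'' * L₂ u q + s'' * L₃ u q)
    (b1 : ∀ i, 1 ≤ i → Good p 2 (pf L₁ L₂ L₃ i 0 0))
    (b2 : ∀ i, 1 ≤ i → Good p 2 (pf L₁ L₂ L₃ 0 i 0))
    (b3 : ∀ i, 1 ≤ i → Good p 2 (pf L₁ L₂ L₃ 0 0 i)) (w : ℕ) :
    ∀ b c d, b + c + d = w → 1 ≤ w → Good p 2 (pf L₁ L₂ L₃ b c d) := by
  induction w using Nat.strong_induction_on with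
  | _ w ih =>
  intro b c d hw h1
  match b, c, d with
  | b + 1, c + 1, d =>
    exact (Good.comb (ih (b + (c + 1) + d) (by omega) b (c + 1) d rfl (by omega))
      (ih (b + 1 + c + d) (by omega) (b + 1) c d rfl (by omega)) r s
      (pf12 hp r s h b c d)).mono one_le_two
  | b + 1, 0, d + 1 =>
    exact (Good.comb (ih (b + 0 + (d + 1)) (by omega) b 0 (d + 1) rfl (by omega))
      (ih (b + 1 + 0 + d) (by omega) (b + 1) 0 d rfl (by omega)) r' s'
      (pf13 hp r' s' h' b 0 d)).mono one_le_two
  | 0, c + 1, d + 1 =>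
    exact (Good.comb (ih (0 + c + (d + 1)) (by omega) 0 c (d + 1) rfl (by omega))
      (ih (0 + (c + 1) + d) (by omega) 0 (c + 1) d rfl (by omega)) r'' s''
      (pf23 hp r'' s'' h'' 0 c d)).mono one_le_two
  | b + 1, 0, 0 => exact b1 _ (by omega)
  | 0, c + 1, 0 => exact b2 _ (by omega)
  | 0, 0, d + 1 => exact b3 _ (by omega)
  | 0, 0, 0 => omega

lemma pf_good1 (hp : ∀ u, p u ≠ 0) (r s r' s' r'' s'' : ℚ)
    (h : ∀ u q, p u = r * L₁ u q + s * L₂ u q)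
    (h' : ∀ u q, p u = r' * L₁ u q + s' * L₃ u q)
    (h'' : ∀ u q, p u = r'' * L₂ u q + s'' * L₃ u q)
    (b1 : ∀ i, 1 ≤ i → Good p 2 (pf L₁ L₂ L₃ i 0 0))
    (b2 : ∀ i, 1 ≤ i → Good p 2 (pf L₁ L₂ L₃ 0 i 0))
    (b3 : ∀ i, 1 ≤ i → Good p 2 (pf L₁ L₂ L₃ 0 0 i)) (b c d : ℕ) (hb : 0 < b) (hc : 0 < c) :
    Good p 1 (pf L₁ L₂ L₃ b c d) := by
  obtain ⟨b, rfl⟩ := Nat.exists_eq_succ_of_ne_zero hb.ne'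
  obtain ⟨c, rfl⟩ := Nat.exists_eq_succ_of_ne_zero hc.ne'
  have := pf_good2 hp r s r' s' r'' s'' h h' h'' b1 b2 b3
  exact Good.comb (this _ b (c + 1) d rfl (by omega))
      (this _ (b + 1) c d rfl (by omega)) r s (pf12 hp r s h b c d)
end

/-- the final summation -/
lemma Good.total {p : ℕ → ℝ} {f : ℕ → ℤ → ℝ} (h : Good p 1 f) (a : ℕ) (ha : 0 < a) {T : ℝ}
    (hT : HasSum (fun y : ℕ × ℤ => (p y.1)⁻¹ ^ a * f y.1 y.2) T) : T ∈ AZ := by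
  obtain ⟨g, h1, h2⟩ := h
  obtain ⟨x, hx, hs⟩ := h2 a ha
  have h3 : HasSum (fun u => (p u)⁻¹ ^ a * g u) T := by
    refine hT.prod_fiberwise fun u => ?_
    have h4 : Summable (fun q => (p u)⁻¹ ^ a * f u q) := hT.summable.prod_factor u
    have h5 := h4.hasSum
    rwa [(PV.of_hasSum h5).unique ((h1 u).smul _)] at h5
  rw [h3.unique hs]
  exact hx

noncomputable def zt (a b c d : ℕ) (x : ℕ × ℕ) : ℝ :=
  (2 * (x.1 : ℝ) + 1)⁻¹ ^ a * ((x.2 : ℝ) + 1)⁻¹ ^ b * (2 * (x.1 : ℝ) + x.2 + 2)⁻¹ ^ c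
    * (2 * (x.1 : ℝ) + 2 * x.2 + 3)⁻¹ ^ d

lemma zt_summable (a b c d : ℕ) (ha : 0 < a) (hb : 0 < b) (hc : 0 < c) (hd : 0 < d) :
    Summable (zt a b c d) := by
  obtain ⟨x, -, hx⟩ := zeta_hasSum 2 le_rfl
  have h := hx.summable.mul_of_nonneg hx.summable (fun n => by positivity) (fun n => by positivity)
  refine Summable.of_nonneg_of_le (fun y => by unfold zt; positivity) (fun y => ?_) h
  obtain ⟨u, v⟩ := y
  have key : ∀ (t r : ℝ) (i : ℕ), 0 < i → 1 ≤ r → r ≤ t → t⁻¹ ^ i ≤ r⁻¹ := by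
    intro t r i hi hr ht
    have h1 : t⁻¹ ≤ r⁻¹ := inv_anti₀ (by linarith) ht
    have h0 : 0 ≤ t⁻¹ := inv_nonneg.2 (by linarith)
    have h2 : t⁻¹ ≤ 1 := inv_le_one_of_one_le₀ (by linarith)
    exact (pow_le_of_le_one h0 h2 hi.ne').trans h1
  have hu : (0 : ℝ) ≤ u := Nat.cast_nonneg _
  have hv : (0 : ℝ) ≤ v := Nat.cast_nonneg _
  have e1 := key (2 * (u : ℝ) + 1) (u + 1) a ha (by linarith) (by linarith)
  have e2 := key ((v : ℝ) + 1) (v + 1) b hb (by linarith) (by linarith)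
  have e3 := key (2 * (u : ℝ) + v + 2) (u + 1) c hc (by linarith) (by linarith)
  have e4 := key (2 * (u : ℝ) + 2 * v + 3) (v + 1) d hd (by linarith) (by linarith)
  unfold zt
  dsimp only
  calc _ ≤ ((u : ℝ) + 1)⁻¹ * ((v : ℝ) + 1)⁻¹ * ((u : ℝ) + 1)⁻¹ * ((v : ℝ) + 1)⁻¹ := by
        gcongr
    _ = _ := by ring

noncomputable def Z (a b c d : ℕ) : ℝ := ∑' x, zt a b c d x

open Classical in
lemma region {F : ℕ × ℤ → ℝ} {φ : ℕ × ℕ → ℕ × ℤ} (hinj : Function.Injective φ)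
    (reg : ℕ × ℤ → Prop) (h1 : ∀ x, reg (φ x)) (h2 : ∀ y, reg y → ∃ x, φ x = y) {f : ℕ × ℕ → ℝ}
    {z s : ℝ} (hf : HasSum f z) (hF : ∀ x, F (φ x) = s * f x) :
    HasSum (fun y => if reg y then F y else 0) (s * z) := by
  refine (hinj.hasSum_iff ?_).1 ?_
  · intro y hy
    rw [if_neg]
    intro h
    exact hy (h2 y h)
  · refine (hf.mul_left s).congr_fun fun x => ?_
    simp [h1 x, hF x]

lemma odd_ne (k : ℤ) : (2 * (k : ℝ) + 1) ≠ 0 := by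
  have : (2 * k + 1 : ℤ) ≠ 0 := by omega
  exact_mod_cast this

/-! first relation: fixed odd `m`, summation over `n` -/

noncomputable def P1 (u : ℕ) : ℝ := 2 * (u : ℝ) + 1
def A1 (_ : ℕ) (q : ℤ) : ℝ := (q : ℝ)
noncomputable def A2 (u : ℕ) (q : ℤ) : ℝ := 2 * (u : ℝ) + 1 + q
noncomputable def A3 (u : ℕ) (q : ℤ) : ℝ := 2 * (u : ℝ) + 1 + 2 * q

lemma A1_zero (u : ℕ) (q : ℤ) : A1 u q = 0 ↔ q = 0 := by simp [A1]

lemma A2_zero (u : ℕ) (q : ℤ) : A2 u q = 0 ↔ q = -(2 * (u : ℤ) + 1) := by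
  have : A2 u q = ((2 * (u : ℤ) + 1 + q : ℤ) : ℝ) := by simp [A2]
  rw [this, Int.cast_eq_zero]
  omega

lemma A3_zero (u : ℕ) (q : ℤ) : ¬ A3 u q = 0 := by
  have : A3 u q = ((2 * (u : ℤ) + 1 + 2 * q : ℤ) : ℝ) := by simp [A3]
  rw [this, Int.cast_eq_zero]
  omega

lemma good1 (x y : ℝ) (hx : x ∈ AZ) (hy : y ∈ AZ) (i s : ℕ) (hs : 2 ≤ s) :
    ∃ z ∈ AZ, HasSum (fun u => (P1 u)⁻¹ ^ s * (x - y * (P1 u)⁻¹ ^ i)) z := by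
  obtain ⟨z, hz, h⟩ := odd_hasSum s hs
  obtain ⟨z', hz', h'⟩ := odd_hasSum (s + i) (by omega)
  refine ⟨x * z - y * z', AZ.sub_mem (AZ.mul_mem hx hz) (AZ.mul_mem hy hz'), ?_⟩
  refine ((h.mul_left x).sub (h'.mul_left y)).congr_fun fun u => ?_
  unfold P1
  ring

lemma base11 (i : ℕ) (hi : 1 ≤ i) : Good P1 2 (pf A1 A2 A3 i 0 0) := by
  obtain ⟨x, hx, h⟩ := B1 i hi
  refine ⟨fun u => x - (-1) ^ i * (P1 u)⁻¹ ^ i, fun u => ?_,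
    fun s hs => good1 x _ hx (neg_one_pow_mem i) i s hs⟩
  refine (h.delete (-(2 * (u : ℤ) + 1))).congr (fun q => ?_) ?_
  · unfold pf
    simp only [A1_zero, A2_zero, A3_zero, or_false]
    by_cases h1 : q = 0
    · subst h1; simp [show i ≠ 0 by omega]
    · simp [h1, A1]
  · dsimp only
    rw [← mul_pow]
    simp only [P1]
    push_cast
    rw [inv_neg, neg_one_mul]

lemma base12 (i : ℕ) (hi : 1 ≤ i) : Good P1 2 (pf A1 A2 A3 0 i 0) := by
  obtain ⟨x, hx, h⟩ := B1 i hi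
  refine ⟨fun u => x - 1 * (P1 u)⁻¹ ^ i, fun u => ?_,
    fun s hs => good1 x _ hx AZ.one_mem i s hs⟩
  have hv : Van (fun q : ℤ => (q : ℝ)⁻¹ ^ i) := by
    simpa using lin_van 1 0 one_pos i hi
  have h' := (h.shift hv (2 * u + 1)).1
  refine (h'.delete 0).congr (fun q => ?_) ?_
  · unfold pf
    simp only [A1_zero, A2_zero, A3_zero, or_false]
    by_cases h1 : q = 0
    · simp [h1]
    · by_cases h2 : q = -(2 * (u : ℤ) + 1)
      · subst h2; simp [show i ≠ 0 by omega]
      · simp only [h1, h2, A2]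
        simp
        ring_nf
  · simp [P1]

lemma base13 (i : ℕ) (hi : 1 ≤ i) : Good P1 2 (pf A1 A2 A3 0 0 i) := by
  obtain ⟨x, hx, h⟩ := B2 i hi
  refine ⟨fun u => x - (1 + (-1) ^ i) * (P1 u)⁻¹ ^ i, fun u => ?_,
    fun s hs => good1 x _ hx (AZ.add_mem AZ.one_mem (neg_one_pow_mem i)) i s hs⟩
  have hv : Van (fun q : ℤ => (2 * (q : ℝ) + 1)⁻¹ ^ i) := lin_van 2 1 two_pos i hi
  have h' := (h.shift hv u).1
  refine ((h'.delete 0).delete (-(2 * (u : ℤ) + 1))).congr (fun q => ?_) ?_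
  · unfold pf
    simp only [A1_zero, A2_zero, A3_zero, or_false]
    by_cases h1 : q = 0
    · simp [h1]
    · by_cases h2 : q = -(2 * (u : ℤ) + 1)
      · simp [h2]
      · simp only [h1, h2, A3]
        simp
        ring_nf
  · rw [if_neg (by omega)]
    simp only [P1]
    push_cast
    rw [show (2 : ℝ) * (-(2 * (u : ℝ) + 1) + u) + 1 = -(2 * u + 1) by ring, inv_neg,
      neg_pow (2 * (u : ℝ) + 1)⁻¹]
    ring

lemma P1_ne (u : ℕ) : P1 u ≠ 0 := by
  unfold P1; positivity

lemma pfgood1 (b c d : ℕ) (hb : 0 < b) (hc : 0 < c) : Good P1 1 (pf A1 A2 A3 b c d) := by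
  refine pf_good1 P1_ne (-1) 1 (-2) 1 2 (-1) ?_ ?_ ?_ base11 base12 base13 b c d hb hc <;>
  · intro u q
    simp only [P1, A1, A2, A3]
    push_cast
    ring

/-! second relation: fixed `n`, summation over odd `m` -/

noncomputable def P2 (u : ℕ) : ℝ := (u : ℝ) + 1
noncomputable def C1 (_ : ℕ) (q : ℤ) : ℝ := 2 * (q : ℝ) + 1
noncomputable def C2 (u : ℕ) (q : ℤ) : ℝ := 2 * (q : ℝ) + 1 + (u + 1)
noncomputable def C3 (u : ℕ) (q : ℤ) : ℝ := 2 * (q : ℝ) + 1 + 2 * (u + 1)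

lemma C1_zero (u : ℕ) (q : ℤ) : ¬ C1 u q = 0 := odd_ne q

lemma C2_zero (u : ℕ) (q : ℤ) : C2 u q = 0 ↔ 2 * q + 2 + u = 0 := by
  have : C2 u q = ((2 * q + 2 + u : ℤ) : ℝ) := by simp [C2]; ring
  rw [this, Int.cast_eq_zero]

lemma C3_zero (u : ℕ) (q : ℤ) : ¬ C3 u q = 0 := by
  have : C3 u q = ((2 * q + 1 + 2 * (u + 1) : ℤ) : ℝ) := by simp [C3]
  rw [this, Int.cast_eq_zero]
  omega

lemma good2 (x y r : ℝ) (hx : x ∈ AZ) (hy : y ∈ AZ) (hr : r ∈ AZ) (i s : ℕ) (hs : 2 ≤ s) :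
    ∃ z ∈ AZ, HasSum (fun u => (P2 u)⁻¹ ^ s *
      (if u % 2 = 0 then y - r * (P2 u)⁻¹ ^ i else x)) z := by
  obtain ⟨z, hz, h⟩ := zeta_hasSum s hs
  obtain ⟨z₁, hz₁, h₁⟩ := evenind_hasSum s hs
  obtain ⟨z₂, hz₂, h₂⟩ := evenind_hasSum (s + i) (by omega)
  refine ⟨x * z + (y - x) * z₁ - r * z₂, AZ.sub_mem (AZ.add_mem (AZ.mul_mem hx hz)
    (AZ.mul_mem (AZ.sub_mem hy hx) hz₁)) (AZ.mul_mem hr hz₂), ?_⟩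
  refine (((h.mul_left x).add (h₁.mul_left (y - x))).sub (h₂.mul_left r)).congr_fun fun u => ?_
  unfold P2
  split_ifs <;> ring

lemma base21 (i : ℕ) (hi : 1 ≤ i) : Good P2 2 (pf C1 C2 C3 i 0 0) := by
  obtain ⟨x, hx, h⟩ := B2 i hi
  refine ⟨fun u => if u % 2 = 0 then x - (-1) ^ i * (P2 u)⁻¹ ^ i else x, fun u => ?_,
    fun s hs => good2 x x _ hx hx (neg_one_pow_mem i) i s hs⟩
  by_cases hu : u % 2 = 0
  · obtain ⟨k, rfl⟩ : ∃ k, u = 2 * k := ⟨u / 2, by omega⟩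
    refine (h.delete (-((k : ℤ) + 1))).congr (fun q => ?_) ?_
    · unfold pf
      simp only [C1_zero, C2_zero, C3_zero, or_false, false_or]
      by_cases h1 : q = -((k : ℤ) + 1)
      · rw [if_pos h1, if_pos (by push_cast; omega)]
      · rw [if_neg h1, if_neg (by push_cast; omega)]
        simp [C1]
    · dsimp only
      rw [if_pos hu, ← mul_pow]
      simp only [P2]
      push_cast
      rw [show (2 : ℝ) * -((k : ℝ) + 1) + 1 = -(2 * k + 1) by ring, inv_neg, neg_one_mul]
  · refine h.congr (fun q => ?_) (by dsimp only; rw [if_neg hu])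
    unfold pf
    simp only [C1_zero, C2_zero, C3_zero, or_false, false_or]
    rw [if_neg (by omega)]
    simp [C1]

lemma base22 (i : ℕ) (hi : 1 ≤ i) : Good P2 2 (pf C1 C2 C3 0 i 0) := by
  obtain ⟨x, hx, h⟩ := B2 i hi
  obtain ⟨y, hy, h'⟩ := B1 i hi
  refine ⟨fun u => if u % 2 = 0 then (2 : ℝ)⁻¹ ^ i * y - 0 * (P2 u)⁻¹ ^ i else x, fun u => ?_,
    fun s hs => good2 x _ _ hx (AZ.mul_mem (AZ.pow_mem inv_two_mem i) hy) AZ.zero_mem i s hs⟩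
  by_cases hu : u % 2 = 0
  · obtain ⟨k, rfl⟩ : ∃ k, u = 2 * k := ⟨u / 2, by omega⟩
    have hv : Van (fun q : ℤ => (q : ℝ)⁻¹ ^ i) := by
      simpa using lin_van 1 0 one_pos i hi
    refine ((h'.shift hv (k + 1)).1.smul ((2 : ℝ)⁻¹ ^ i)).congr (fun q => ?_) ?_
    · unfold pf
      simp only [C1_zero, C2_zero, C3_zero, or_false, false_or]
      by_cases h1 : q = -((k : ℤ) + 1)
      · rw [if_pos (by push_cast; omega)]
        subst h1
        simp [show i ≠ 0 by omega]
      · rw [if_neg (by push_cast; omega), ← mul_pow, ← mul_inv]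
        simp only [C2]
        push_cast
        simp only [pow_zero, one_mul, mul_one]
        ring_nf
    · dsimp only
      rw [if_pos hu]
      ring
  · obtain ⟨k, rfl⟩ : ∃ k, u = 2 * k + 1 := ⟨u / 2, by omega⟩
    have hv : Van (fun q : ℤ => (2 * (q : ℝ) + 1)⁻¹ ^ i) := lin_van 2 1 two_pos i hi
    refine (h.shift hv (k + 1)).1.congr (fun q => ?_) (by dsimp only; rw [if_neg hu])
    unfold pf
    simp only [C1_zero, C2_zero, C3_zero, or_false, false_or]
    rw [if_neg (by push_cast; omega)]
    simp only [C2]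
    push_cast
    simp only [pow_zero, one_mul, mul_one]
    ring_nf

lemma base23 (i : ℕ) (hi : 1 ≤ i) : Good P2 2 (pf C1 C2 C3 0 0 i) := by
  obtain ⟨x, hx, h⟩ := B2 i hi
  refine ⟨fun u => if u % 2 = 0 then x - 1 * (P2 u)⁻¹ ^ i else x, fun u => ?_,
    fun s hs => good2 x x _ hx hx AZ.one_mem i s hs⟩
  have hv : Van (fun q : ℤ => (2 * (q : ℝ) + 1)⁻¹ ^ i) := lin_van 2 1 two_pos i hi
  have h' := (h.shift hv (u + 1)).1
  by_cases hu : u % 2 = 0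
  · obtain ⟨k, rfl⟩ : ∃ k, u = 2 * k := ⟨u / 2, by omega⟩
    refine (h'.delete (-((k : ℤ) + 1))).congr (fun q => ?_) ?_
    · unfold pf
      simp only [C1_zero, C2_zero, C3_zero, or_false, false_or]
      by_cases h1 : q = -((k : ℤ) + 1)
      · rw [if_pos h1, if_pos (by push_cast; omega)]
      · rw [if_neg h1, if_neg (by push_cast; omega)]
        simp only [C3]
        push_cast
        simp only [pow_zero, one_mul]
        ring_nf
    · dsimp only
      rw [if_pos hu]
      simp only [P2]
      push_cast
      rw [show (2 : ℝ) * (-((k : ℝ) + 1) + (2 * k + 1)) + 1 = 2 * k + 1 by ring, one_mul]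
  · refine h'.congr (fun q => ?_) (by dsimp only; rw [if_neg hu])
    unfold pf
    simp only [C1_zero, C2_zero, C3_zero, or_false, false_or]
    rw [if_neg (by omega)]
    simp only [C3]
    push_cast
    simp only [pow_zero, one_mul]
    ring_nf

lemma P2_ne (u : ℕ) : P2 u ≠ 0 := by
  unfold P2; positivity

lemma pfgood2 (b c d : ℕ) (hb : 0 < b) (hc : 0 < c) : Good P2 1 (pf C1 C2 C3 b c d) := by
  refine pf_good1 P2_ne (-1) 1 (-1/2) (1/2) (-1) 1 ?_ ?_ ?_ base21 base22 base23 b c d hb hc <;>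
  · intro u q
    simp only [P2, C1, C2, C3]
    push_cast
    ring

lemma Z_hasSum (a b c d : ℕ) (ha : 0 < a) (hb : 0 < b) (hc : 0 < c) (hd : 0 < d) :
    HasSum (zt a b c d) (Z a b c d) := (zt_summable a b c d ha hb hc hd).hasSum

lemma neg_inv_pow (x y : ℝ) (h : x = -y) (i : ℕ) : x⁻¹ ^ i = (-1) ^ i * y⁻¹ ^ i := by
  rw [h, inv_neg, neg_pow]

lemma pos_inv_pow (x y : ℝ) (h : x = y) (i : ℕ) : x⁻¹ ^ i = y⁻¹ ^ i := by
  rw [h]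

lemma rel1 (a b c d : ℕ) (ha : 0 < a) (hb : 0 < b) (hc : 0 < c) (hd : 0 < d) :
    1 * Z a b c d + (-1) ^ b * Z d b c a + (-1) ^ (b + d) * Z d c b a
      + (-1) ^ (b + c + d) * Z a c b d ∈ AZ := by
  refine (pfgood1 b c d hb hc).total a ha ?_
  have h1 := region (F := fun y : ℕ × ℤ => (P1 y.1)⁻¹ ^ a * pf A1 A2 A3 b c d y.1 y.2)
    (φ := fun x => (x.1, (x.2 : ℤ) + 1))
    (fun x y h => by simp only [Prod.mk.injEq] at h; ext <;> omega)
    (fun y => 0 < y.2) (fun x => by dsimp only; omega)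
    (fun y h => ⟨(y.1, (y.2 - 1).toNat), by ext <;> dsimp only; omega⟩)
    (Z_hasSum a b c d ha hb hc hd) (s := 1) (fun x => by
      unfold pf
      simp only [A1_zero, A2_zero, A3_zero, or_false]
      rw [if_neg (by omega)]
      simp only [zt, P1, A1, A2, A3]
      push_cast
      ring_nf)
  have h2 := region (F := fun y : ℕ × ℤ => (P1 y.1)⁻¹ ^ a * pf A1 A2 A3 b c d y.1 y.2)
    (φ := fun x => (x.1 + x.2 + 1, -((x.2 : ℤ) + 1)))
    (fun x y h => by simp only [Prod.mk.injEq] at h; ext <;> omega)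
    (fun y => y.2 < 0 ∧ 0 < 2 * (y.1 : ℤ) + 1 + 2 * y.2) (fun x => by dsimp only; omega)
    (fun y h => ⟨((y.1 + y.2).toNat, (-y.2 - 1).toNat), by ext <;> dsimp only <;> omega⟩)
    (Z_hasSum d b c a hd hb hc ha) (s := (-1) ^ b) (fun x => by
      unfold pf
      simp only [A1_zero, A2_zero, A3_zero, or_false]
      rw [if_neg (by omega)]
      simp only [zt, P1, A1, A2, A3]
      push_cast
      rw [neg_inv_pow _ ((x.2 : ℝ) + 1) rfl b]
      ring_nf)
  have h3 := region (F := fun y : ℕ × ℤ => (P1 y.1)⁻¹ ^ a * pf A1 A2 A3 b c d y.1 y.2)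
    (φ := fun x => (x.1 + x.2 + 1, -(2 * (x.1 : ℤ) + x.2 + 2)))
    (fun x y h => by simp only [Prod.mk.injEq] at h; ext <;> omega)
    (fun y => 2 * (y.1 : ℤ) + 1 + 2 * y.2 < 0 ∧ 0 < 2 * (y.1 : ℤ) + 1 + y.2)
    (fun x => by dsimp only; omega)
    (fun y h => ⟨((-y.2 - 1 - y.1).toNat, (2 * y.1 + y.2).toNat), by
      ext <;> dsimp only <;> omega⟩)
    (Z_hasSum d c b a hd hc hb ha) (s := (-1) ^ (b + d)) (fun x => by
      unfold pf
      simp only [A1_zero, A2_zero, A3_zero, or_false]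
      rw [if_neg (by omega)]
      simp only [zt, P1, A1, A2, A3]
      push_cast
      rw [neg_inv_pow _ (2 * (x.1 : ℝ) + x.2 + 2) rfl b,
        neg_inv_pow (_ + 2 * _) (2 * (x.1 : ℝ) + 1) (by ring) d]
      ring_nf)
  have h4 := region (F := fun y : ℕ × ℤ => (P1 y.1)⁻¹ ^ a * pf A1 A2 A3 b c d y.1 y.2)
    (φ := fun x => (x.1, -(2 * (x.1 : ℤ) + x.2 + 2)))
    (fun x y h => by simp only [Prod.mk.injEq] at h; ext <;> omega)
    (fun y => 2 * (y.1 : ℤ) + 1 + y.2 < 0)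
    (fun x => by dsimp only; omega)
    (fun y h => ⟨(y.1, (-y.2 - 2 - 2 * y.1).toNat), by ext <;> dsimp only; omega⟩)
    (Z_hasSum a c b d ha hc hb hd) (s := (-1) ^ (b + c + d)) (fun x => by
      unfold pf
      simp only [A1_zero, A2_zero, A3_zero, or_false]
      rw [if_neg (by omega)]
      simp only [zt, P1, A1, A2, A3]
      push_cast
      rw [neg_inv_pow _ (2 * (x.1 : ℝ) + x.2 + 2) rfl b,
        neg_inv_pow (_ + -_) ((x.2 : ℝ) + 1) (by ring) c,
        neg_inv_pow (_ + 2 * _) (2 * (x.1 : ℝ) + 2 * x.2 + 3) (by ring) d]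
      ring_nf)
  refine (((h1.add h2).add h3).add h4).congr_fun fun y => ?_
  split_ifs <;> first | omega | simp only [add_zero, zero_add] | skip
  unfold pf
  simp only [A1_zero, A2_zero, A3_zero, or_false]
  rw [if_pos (by omega)]
  simp

lemma rel2 (a b c d : ℕ) (ha : 0 < a) (hb : 0 < b) (hc : 0 < c) (hd : 0 < d) :
    1 * Z a b c d + (-1) ^ a * Z a c b d + (-1) ^ (a + c) * Z d c b a
      + (-1) ^ (a + c + d) * Z d b c a ∈ AZ := by
  refine (pfgood2 a c d ha hc).total b hb ?_
  have h1 := region (F := fun y : ℕ × ℤ => (P2 y.1)⁻¹ ^ b * pf C1 C2 C3 a c d y.1 y.2)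
    (φ := fun x => (x.2, (x.1 : ℤ)))
    (fun x y h => by simp only [Prod.mk.injEq] at h; ext <;> omega)
    (fun y => 0 ≤ y.2) (fun x => by dsimp only; omega)
    (fun y h => ⟨(y.2.toNat, y.1), by ext <;> dsimp only; omega⟩)
    (Z_hasSum a b c d ha hb hc hd) (s := 1) (fun x => by
      unfold pf
      simp only [C1_zero, C2_zero, C3_zero, or_false, false_or]
      rw [if_neg (by omega)]
      simp only [zt, P2, C1, C2, C3]
      push_cast
      ring_nf)
  have h2 := region (F := fun y : ℕ × ℤ => (P2 y.1)⁻¹ ^ b * pf C1 C2 C3 a c d y.1 y.2)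
    (φ := fun x => (2 * x.1 + x.2 + 1, -((x.1 : ℤ) + 1)))
    (fun x y h => by simp only [Prod.mk.injEq] at h; ext <;> omega)
    (fun y => y.2 < 0 ∧ 0 < 2 * y.2 + 2 + y.1) (fun x => by dsimp only; omega)
    (fun y h => ⟨((-y.2 - 1).toNat, (y.1 + 2 * y.2 + 1).toNat), by
      ext <;> dsimp only <;> omega⟩)
    (Z_hasSum a c b d ha hc hb hd) (s := (-1) ^ a) (fun x => by
      unfold pf
      simp only [C1_zero, C2_zero, C3_zero, or_false, false_or]
      rw [if_neg (by omega)]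
      simp only [zt, P2, C1, C2, C3]
      push_cast
      rw [neg_inv_pow (2 * _ + 1) (2 * (x.1 : ℝ) + 1) (by ring) a]
      ring_nf)
  have h3 := region (F := fun y : ℕ × ℤ => (P2 y.1)⁻¹ ^ b * pf C1 C2 C3 a c d y.1 y.2)
    (φ := fun x => (2 * x.1 + x.2 + 1, -((x.1 : ℤ) + x.2 + 2)))
    (fun x y h => by simp only [Prod.mk.injEq] at h; ext <;> omega)
    (fun y => 2 * y.2 + 2 + y.1 < 0 ∧ 0 < 2 * y.2 + 1 + 2 * (y.1 + 1))
    (fun x => by dsimp only; omega)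
    (fun y h => ⟨((y.1 + y.2 + 1).toNat, (-y.1 - 2 * y.2 - 3).toNat), by
      ext <;> dsimp only <;> omega⟩)
    (Z_hasSum d c b a hd hc hb ha) (s := (-1) ^ (a + c)) (fun x => by
      unfold pf
      simp only [C1_zero, C2_zero, C3_zero, or_false, false_or]
      rw [if_neg (by omega)]
      simp only [zt, P2, C1, C2, C3]
      push_cast
      rw [neg_inv_pow (2 * _ + 1) (2 * (x.1 : ℝ) + 2 * x.2 + 3) (by ring) a,
        neg_inv_pow (2 * _ + 1 + (2 * (x.1 : ℝ) + x.2 + 1 + 1)) ((x.2 : ℝ) + 1) (by ring) c]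
      ring_nf)
  have h4 := region (F := fun y : ℕ × ℤ => (P2 y.1)⁻¹ ^ b * pf C1 C2 C3 a c d y.1 y.2)
    (φ := fun x => (x.2, -((x.1 : ℤ) + x.2 + 2)))
    (fun x y h => by simp only [Prod.mk.injEq] at h; ext <;> omega)
    (fun y => 2 * y.2 + 1 + 2 * (y.1 + 1) < 0)
    (fun x => by dsimp only; omega)
    (fun y h => ⟨((-y.2 - 2 - y.1).toNat, y.1), by ext <;> dsimp only; omega⟩)
    (Z_hasSum d b c a hd hb hc ha) (s := (-1) ^ (a + c + d)) (fun x => by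
      unfold pf
      simp only [C1_zero, C2_zero, C3_zero, or_false, false_or]
      rw [if_neg (by omega)]
      simp only [zt, P2, C1, C2, C3]
      push_cast
      rw [neg_inv_pow (2 * _ + 1) (2 * (x.1 : ℝ) + 2 * x.2 + 3) (by ring) a,
        neg_inv_pow (2 * _ + 1 + ((x.2 : ℝ) + 1)) (2 * (x.1 : ℝ) + x.2 + 2) (by ring) c,
        neg_inv_pow (2 * _ + 1 + 2 * _) (2 * (x.1 : ℝ) + 1) (by ring) d]
      ring_nf)
  refine (((h1.add h2).add h3).add h4).congr_fun fun y => ?_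
  split_ifs <;> first | omega | simp only [add_zero, zero_add] | skip
  unfold pf
  simp only [C1_zero, C2_zero, C3_zero, or_false, false_or]
  rw [if_pos (by omega)]
  simp

lemma Z_mem (a b c d : ℕ) (ha : 0 < a) (hb : 0 < b) (hc : 0 < c) (hd : 0 < d)
    (hodd : Odd (a + b + c + d)) : Z a b c d ∈ AZ := by
  have r1 := rel1 a b c d ha hb hc hd
  have r2 := rel1 d b c a hd hb hc ha
  have r3 := rel1 a c b d ha hc hb hd
  have r4 := rel1 d c b a hd hc hb ha
  have r5 := rel2 a b c d ha hb hc hd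
  have q : ∀ k x, x ∈ AZ → (-1 : ℝ) ^ k * x ∈ AZ :=
    fun k x hx => AZ.mul_mem (neg_one_pow_mem k) hx
  have s := AZ.add_mem (AZ.mul_mem (rat_mem (1/4)) (AZ.add_mem r1 (q b _ r2)))
    (AZ.sub_mem (AZ.mul_mem (rat_mem (1/2)) r5)
      (AZ.mul_mem (rat_mem (1/4)) (q a _ (AZ.add_mem r3 (q c _ r4)))))
  convert s using 1
  have hs : (-1 : ℝ) ^ (a + b + c + d) = -1 := hodd.neg_one_pow
  simp only [pow_add] at hs ⊢
  push_cast
  rcases neg_one_pow_eq_or ℝ a with ea | ea <;> rcases neg_one_pow_eq_or ℝ b with eb | eb <;>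
  rcases neg_one_pow_eq_or ℝ c with ec | ec <;> rcases neg_one_pow_eq_or ℝ d with ed | ed <;>
  rw [ea, eb, ec, ed] at hs ⊢ <;> first | (exfalso; norm_num at hs; done) | ring

end PSpAux


/-- Parity result for PSp(2): if a+b+c+d is odd, then ζ₂PSp2(a,b,c,d), i.e. the
sum over m,n ≥ 1 with m odd of 1/(m^a n^b (m+n)^c (m+2n)^d), lies in the
ℚ-subalgebra of ℝ generated by the Riemann zeta values ζ(k), k ≥ 2. -/
theorem zeta2_PSp2_parity (a b c d : ℕ) (ha : 0 < a) (hb : 0 < b) (hc : 0 < c)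
    (hd : 0 < d) (hodd : Odd (a + b + c + d)) :
    (∑' pr : ℕ × ℕ, (if (pr.1 + 1) % 2 = 1 then
      (1 : ℝ) / (((pr.1 : ℝ) + 1) ^ a * ((pr.2 : ℝ) + 1) ^ b
        * ((pr.1 : ℝ) + (pr.2 : ℝ) + 2) ^ c
        * ((pr.1 : ℝ) + 2 * (pr.2 : ℝ) + 3) ^ d) else 0))
    ∈ Algebra.adjoin ℚ
        {x : ℝ | ∃ k : ℕ, 2 ≤ k ∧ x = ∑' n : ℕ, (1 : ℝ) / ((n : ℝ) + 1) ^ k} := by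

  have h := PSpAux.Z_mem a b c d ha hb hc hd hodd
  have h0 := PSpAux.Z_hasSum a b c d ha hb hc hd
  have hinj : Function.Injective (fun x : ℕ × ℕ => (2 * x.1, x.2)) := fun x y h => by
    simp only [Prod.mk.injEq] at h; ext <;> omega
  have key : HasSum (fun pr : ℕ × ℕ => (if (pr.1 + 1) % 2 = 1 then
      (1 : ℝ) / (((pr.1 : ℝ) + 1) ^ a * ((pr.2 : ℝ) + 1) ^ b
        * ((pr.1 : ℝ) + (pr.2 : ℝ) + 2) ^ c
        * ((pr.1 : ℝ) + 2 * (pr.2 : ℝ) + 3) ^ d) else 0)) (PSpAux.Z a b c d) := by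
    refine (hinj.hasSum_iff ?_).1 ?_
    · intro y hy
      rw [if_neg]
      intro h
      exact hy ⟨(y.1 / 2, y.2), by ext <;> dsimp only; omega⟩
    · refine h0.congr_fun fun x => ?_
      simp only [Function.comp]
      rw [if_pos (by omega)]
      simp only [PSpAux.zt, one_div, mul_inv, inv_pow]
      push_cast
      rfl
  rw [key.tsum_eq]
  exact h
end

section
/- Let a, b, c be positive integers with a+b+c odd, and let τ, μ ∈ {1,2}. Then the double series T_{τ,μ}(a,b,c) = Σ_{l≥0, m≥0} 1/((2l+τ)^a·(2m+μ)^b·(2l+2m+τ+μ)^c) lies in the ℚ-subalgebra of ℝ generated by the Riemann zeta values ζ(k) for integers k ≥ 2; i.e., it can be expressed as a polynomial with rational coefficients in the values ζ(2), ζ(3), ζ(4), …. -/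
open Filter Topology

namespace TPar

noncomputable def g (n : ℤ) : ℝ := (n : ℝ)⁻¹

lemma g_zero : g 0 = 0 := by simp [g]
lemma g_neg (n : ℤ) : g (-n) = - g n := by simp [g, inv_neg]

lemma hs_congr {ι : Type*} {f f' : ι → ℝ} {x x' : ℝ} (h : HasSum f x) (hf : ∀ i, f' i = f i)
    (hx : x' = x) : HasSum f' x' := by
  obtain rfl : f' = f := funext hf
  rwa [hx]

/-- the zeta algebra -/
noncomputable def Z : Subalgebra ℚ ℝ := Algebra.adjoin ℚ
        {x : ℝ | ∃ k : ℕ, 2 ≤ k ∧ x = ∑' n : ℕ, (1 : ℝ) / ((n : ℝ) + 1) ^ k}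

lemma zeta_hasSum (k : ℕ) (hk : 2 ≤ k) :
    ∃ z ∈ Z, HasSum (fun n : ℕ => g ((n : ℤ) + 1) ^ k) z := by
  refine ⟨∑' n : ℕ, (1 : ℝ) / ((n : ℝ) + 1) ^ k, Algebra.subset_adjoin ⟨k, hk, rfl⟩, ?_⟩
  have h := (summable_nat_add_iff 1).2 (Real.summable_nat_pow_inv.2 (show 1 < k by omega))
  have h2 : Summable (fun n : ℕ => (1 : ℝ) / ((n : ℝ) + 1) ^ k) := by
    refine h.congr fun n => ?_
    simp
  refine h2.hasSum.congr_fun ?_ |> id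
  intro n
  simp [g]

lemma odd_hasSum (τ : ℕ) (hτ : τ = 1 ∨ τ = 2) (k : ℕ) (hk : 2 ≤ k) :
    ∃ z ∈ Z, HasSum (fun n : ℕ => g (2 * (n : ℤ) + τ) ^ k) z := by
  obtain ⟨z, hz, h⟩ := zeta_hasSum k hk
  have hmul : ∀ q : ℚ, (q : ℝ) * z ∈ Z := fun q => by
    have := Z.smul_mem hz q
    rwa [Rat.smul_def] at this
  have h2 : HasSum (fun n : ℕ => g (2 * (n : ℤ) + 2) ^ k) (((2⁻¹ ^ k : ℚ) : ℝ) * z) := by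
    refine (h.mul_left _).congr_fun ?_ |> id
    intro n
    rw [show (2 * (n : ℤ) + 2) = 2 * ((n : ℤ) + 1) by ring]
    simp only [g]
    push_cast
    rw [mul_inv, mul_pow]
  rcases hτ with rfl | rfl
  · refine ⟨_, Z.sub_mem hz (hmul (2⁻¹ ^ k)), ?_⟩
    have hs : Summable (fun n : ℕ => g (2 * (n : ℤ) + 1) ^ k) := by
      have := h.summable.comp_injective (i := fun n : ℕ => 2 * n) (fun a b hab => by simpa using hab)
      refine this.congr fun n => ?_
      simp
    have h3 := HasSum.even_add_odd (f := fun n : ℕ => g ((n : ℤ) + 1) ^ k) (m := ∑' n : ℕ, g (2 * (n : ℤ) + 1) ^ k)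
      (m' := ((2⁻¹ ^ k : ℚ) : ℝ) * z) (by simpa using hs.hasSum) (by
        convert h2 using 4
        push_cast; ring)
    have := h3.unique h
    exact hs_congr hs.hasSum (fun n => by simp) (by linarith)
  · exact ⟨_, hmul (2⁻¹ ^ k), by simpa using h2⟩

lemma split_int (μ : ℕ) (hμ : μ = 1 ∨ μ = 2) (h : ℤ → ℝ) (h0 : h 0 = 0) (x y : ℝ)
    (hx : HasSum (fun k : ℕ => h (2 * (k : ℤ) + μ)) x)
    (hy : HasSum (fun k : ℕ => h (-(2 * (k : ℤ) + μ))) y) :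
    HasSum (fun k : ℤ => h (2 * k + μ)) (x + y) := by
  refine HasSum.of_nat_of_neg_add_one hx ?_
  rcases hμ with rfl | rfl
  · refine hs_congr hy (fun k => ?_) rfl
    exact congrArg h (by push_cast; ring)
  · rw [← hasSum_nat_add_iff' 1]
    simp only [Finset.range_one, Finset.sum_singleton]
    refine hs_congr hy (fun k => ?_) (by simp [h0])
    exact congrArg h (by push_cast; ring)

lemma shift_hasSum (f : ℤ → ℝ) (d : ℤ) (x : ℝ) (h : HasSum f x) : HasSum (fun k => f (k + d)) x :=
  (Equiv.addRight d).hasSum_iff.2 h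

lemma full_hasSum (m : ℤ) (b : ℕ) (hb : 2 ≤ b) :
    ∃ z ∈ Z, HasSum (fun k : ℤ => g (2 * k + m) ^ b) z := by
  have key : ∀ μ : ℕ, (μ = 1 ∨ μ = 2) → ∃ z ∈ Z, HasSum (fun k : ℤ => g (2 * k + μ) ^ b) z := by
    intro μ hμ
    obtain ⟨z, hz, h⟩ := odd_hasSum μ hμ b hb
    refine ⟨z + (-1) ^ b * z, Z.add_mem hz (Z.mul_mem (Z.pow_mem (Z.neg_mem Z.one_mem) _) hz), ?_⟩
    refine split_int μ hμ (fun n => g n ^ b) (by simp [g_zero]; omega) _ _ h ?_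
    refine hs_congr (h.mul_left ((-1) ^ b)) (fun k => ?_) rfl
    simp only [g_neg]
    rw [neg_pow]
  rcases Int.even_or_odd' m with ⟨d, rfl | rfl⟩
  · obtain ⟨z, hz, h⟩ := key 2 (Or.inr rfl)
    refine ⟨z, hz, ?_⟩
    refine hs_congr (shift_hasSum _ (d - 1) _ h) (fun k => ?_) rfl
    congr 2
    push_cast; ring
  · obtain ⟨z, hz, h⟩ := key 1 (Or.inl rfl)
    refine ⟨z, hz, ?_⟩
    refine hs_congr (shift_hasSum _ d _ h) (fun k => ?_) rfl
    congr 2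
    push_cast; ring

lemma g_mul (q p : ℤ) (hp : p ≠ 0) : g q * g (q + p) =
    g p * (g q - g (q + p) + g p * ((if q = 0 then 1 else 0) + (if q + p = 0 then 1 else 0))) := by
  have hp' : (p : ℝ) ≠ 0 := by exact_mod_cast hp
  by_cases h1 : q = 0
  · subst h1
    simp [g_zero, hp]
  · by_cases h2 : q + p = 0
    · obtain rfl : q = -p := by omega
      simp [g_zero, hp, g_neg]
    · have h1' : (q : ℝ) ≠ 0 := by exact_mod_cast h1
      have h2' : (q : ℝ) + p ≠ 0 := by exact_mod_cast h2
      simp only [g, h1, h2, if_false]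
      push_cast
      field_simp
      ring

lemma summable_uv (m s : ℤ) : Summable (fun k : ℤ => g (2 * k + m) * g (2 * k + m + s)) := by
  obtain ⟨z, -, h⟩ := full_hasSum m 2 le_rfl
  obtain ⟨z', -, h'⟩ := full_hasSum (m + s) 2 le_rfl
  refine Summable.of_norm_bounded (h.summable.add h'.summable) fun k => ?_
  rw [Real.norm_eq_abs, abs_mul, ← add_assoc, ← sq_abs (g (2 * k + m)), ← sq_abs (g (2 * k + m + s))]
  nlinarith [sq_nonneg (|g (2 * k + m)| - |g (2 * k + m + s)|), sq_nonneg (|g (2 * k + m)| + |g (2 * k + m + s)|)]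

lemma summable_ind (m : ℤ) : Summable (fun k : ℤ => (if 2 * k + m = 0 then (1 : ℝ) else 0)) := by
  apply summable_of_hasFiniteSupport
  refine (Set.finite_singleton (-(m / 2))).subset fun k hk => ?_
  simp only [Function.mem_support] at hk
  have : 2 * k + m = 0 := by
    by_contra h
    simp [h] at hk
  simp only [Set.mem_singleton_iff]
  omega

lemma summable_diff (m s : ℤ) (hs : s ≠ 0) :
    Summable (fun k : ℤ => g (2 * k + m) - g (2 * k + m + s)) := by
  have h := ((summable_uv m s).mul_left (s : ℝ)).sub
    (((summable_ind m).add (summable_ind (m + s))).mul_left (g s))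
  refine h.congr fun k => ?_
  rw [g_mul _ _ hs, ← add_assoc]
  have hp' : (s : ℝ) * g s = 1 := by
    have : (s : ℝ) ≠ 0 := by exact_mod_cast hs
    simp [g, this]
  linear_combination (g (2 * k + m) - g (2 * k + m + s) + g s * ((if 2 * k + m = 0 then 1 else 0) + (if 2 * k + m + s = 0 then 1 else 0))) * hp'

lemma g_tendsto_top (m : ℤ) : Tendsto (fun n : ℕ => g (2 * (n : ℤ) + m)) atTop (𝓝 0) := by
  refine tendsto_inv_atTop_zero.comp ?_
  push_cast
  refine tendsto_atTop_add_const_right _ _ ?_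
  exact (tendsto_natCast_atTop_atTop (R := ℝ)).const_mul_atTop (by norm_num)

lemma tele_one (m : ℤ) : HasSum (fun k : ℤ => g (2 * k + m) - g (2 * k + m + 2)) 0 := by
  have hs := (summable_diff m 2 (by norm_num)).hasSum
  have h1 : Tendsto (fun N : ℕ => ∑ k ∈ Finset.Ico (-(N : ℤ)) N, (g (2 * k + m) - g (2 * k + m + 2))) atTop
      (𝓝 (∑' k : ℤ, (g (2 * k + m) - g (2 * k + m + 2)))) := by
      have h0 := hs
      rw [HasSum, SummationFilter.unconditional_filter] at h0
      exact h0.comp (Finset.tendsto_Ico_neg (R := ℤ))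
  have h2 : ∀ N : ℕ, ∑ k ∈ Finset.Ico (-(N : ℤ)) N, (g (2 * k + m) - g (2 * k + m + 2)) =
      - g (2 * (N : ℤ) + (-m)) - g (2 * (N : ℤ) + m) := by
    intro N
    rw [← g_neg]
    induction N with
    | zero => simp
    | succ N ih =>
      have : Finset.Ico (-((N + 1 : ℕ) : ℤ)) ((N + 1 : ℕ) : ℤ) =
          insert (-(N : ℤ) - 1) (insert (N : ℤ) (Finset.Ico (-(N : ℤ)) N)) := by
        ext x; simp; omega
      rw [this, Finset.sum_insert, Finset.sum_insert, ih]
      · push_cast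
        rw [show -(2 * (N : ℤ) + -m) = 2 * (-(N : ℤ) - 1) + m + 2 by ring,
          show -(2 * ((N : ℤ) + 1) + -m) = 2 * (-(N : ℤ) - 1) + m by ring,
          show (2 * ((N : ℤ) + 1) + m) = 2 * (N : ℤ) + m + 2 by ring]
        ring
      · simp
      · simp
  have h3 := ((g_tendsto_top (-m)).neg.sub (g_tendsto_top m)).congr (fun N => (h2 N).symm)
  simp only [neg_zero, sub_zero] at h3
  rw [tendsto_nhds_unique h1 h3] at hs
  exact hs

lemma tele (m : ℤ) (r : ℕ) : HasSum (fun k : ℤ => g (2 * k + m) - g (2 * k + m + 2 * r)) 0 := by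
  induction r with
  | zero => simp [hasSum_zero]
  | succ r ih =>
    have := ih.add (tele_one (m + 2 * r))
    rw [add_zero] at this
    refine hs_congr this (fun k => ?_) rfl
    push_cast
    rw [show 2 * k + (m + 2 * r) = 2 * k + m + 2 * r by ring,
      show 2 * k + m + 2 * ((r : ℤ) + 1) = 2 * k + m + 2 * r + 2 by ring]
    ring

lemma diff_zero (m : ℤ) (p : ℕ) (hp : 0 < p) :
    HasSum (fun k : ℤ => g (2 * k + m) - g (2 * k + m + p)) 0 := by
  obtain ⟨S, hs⟩ := summable_diff m p (by omega)
  have h2 : HasSum ((fun k : ℤ => g (2 * k + m) - g (2 * k + m + p)) ∘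
      ((Equiv.neg ℤ).trans (Equiv.subRight m))) S := (Equiv.hasSum_iff _).2 hs
  have h3 := hs.add h2
  have h5 : HasSum (fun k : ℤ => (g (2 * k + m) - g (2 * k + m + p)) +
      ((fun k : ℤ => g (2 * k + m) - g (2 * k + m + p)) ∘
      ((Equiv.neg ℤ).trans (Equiv.subRight m))) k) 0 := by
    refine hs_congr (tele (m - p) p) (fun k => ?_) rfl
    simp only [Function.comp, Equiv.trans_apply, Equiv.neg_apply, Equiv.subRight_apply]
    rw [show 2 * (-k - m) + m = -(2 * k + m) by ring, g_neg,
      show -(2 * k + m) + p = - (2 * k + (m - p)) by ring, g_neg,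
      show (2 * k + (m - p) + 2 * p) = 2 * k + m + (p : ℤ) by ring]
    ring
  have h4 := h3.unique h5
  have : S = 0 := by linarith
  rwa [this] at hs

end TPar

namespace TPar

noncomputable def X (τ : ℕ) : ℕ → ℝ := fun n => g (2 * (n : ℤ) + τ)

noncomputable def W (τ : ℕ) : Subalgebra Z (ℕ → ℝ) := Algebra.adjoin Z {X τ}

lemma X_mem (τ : ℕ) : X τ ∈ W τ := Algebra.subset_adjoin rfl

lemma const_mem (τ : ℕ) (z : ℝ) (hz : z ∈ Z) : (fun _ => z : ℕ → ℝ) ∈ W τ :=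
  (W τ).algebraMap_mem ⟨z, hz⟩

lemma ind1 (τ μ : ℕ) (hμ : μ = 1 ∨ μ = 2) (b c : ℕ) :
    ∃ w ∈ W τ, ∀ n : ℕ, HasSum (fun k : ℤ => g (2 * k + μ) ^ b *
      g (2 * k + μ + (2 * (n : ℤ) + τ)) ^ c * (if 2 * k + (μ : ℤ) = 0 then 1 else 0)) (w n) := by
  rcases hμ with rfl | rfl
  · refine ⟨0, (W τ).zero_mem, fun n => hs_congr hasSum_zero (fun k => ?_) rfl⟩
    rw [if_neg (by push_cast; omega), mul_zero]
  · refine ⟨(fun _ => (0 : ℝ) ^ b) * X τ ^ c, (W τ).mul_mem (const_mem τ _ (Z.pow_mem Z.zero_mem _))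
      ((W τ).pow_mem (X_mem τ) _), fun n => ?_⟩
    refine hs_congr (hasSum_single (-1 : ℤ) ?_) (fun k => rfl) ?_
    · intro k hk
      rw [if_neg (by push_cast; omega), mul_zero]
    · simp [X, g_zero]

lemma ind2 (τ μ : ℕ) (hτ : τ = 1 ∨ τ = 2) (hμ : μ = 1 ∨ μ = 2) (b c : ℕ) :
    ∃ w ∈ W τ, ∀ n : ℕ, HasSum (fun k : ℤ => g (2 * k + μ) ^ b *
      g (2 * k + μ + (2 * (n : ℤ) + τ)) ^ c *
      (if 2 * k + (μ : ℤ) + (2 * (n : ℤ) + τ) = 0 then 1 else 0)) (w n) := by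
  by_cases h : τ = μ
  · subst h
    refine ⟨(-X τ) ^ b * (fun _ => (0 : ℝ) ^ c), (W τ).mul_mem ((W τ).pow_mem ((W τ).neg_mem (X_mem τ)) _)
       (const_mem τ _ (Z.pow_mem Z.zero_mem _)), fun n => ?_⟩
    refine hs_congr (hasSum_single (-(n : ℤ) - τ) ?_) (fun k => rfl) ?_
    · intro k hk
      rw [if_neg (by omega), mul_zero]
    · rw [if_pos (by ring), show 2 * (-(n : ℤ) - τ) + τ + (2 * (n : ℤ) + τ) = 0 by ring,
        show 2 * (-(n : ℤ) - τ) + τ = - (2 * (n : ℤ) + τ) by ring, g_neg, g_zero]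
      simp [X]
  · refine ⟨0, (W τ).zero_mem, fun n => hs_congr hasSum_zero (fun k => ?_) rfl⟩
    rw [if_neg (by omega), mul_zero]

lemma step (τ μ : ℕ) (hτ : τ = 1 ∨ τ = 2) (hμ : μ = 1 ∨ μ = 2) (b c : ℕ)
    (h : ∃ w ∈ W τ, ∀ n : ℕ, HasSum (fun k : ℤ => g (2 * k + μ) ^ b *
      g (2 * k + μ + (2 * (n : ℤ) + τ)) ^ c *
      (g (2 * k + μ) - g (2 * k + μ + (2 * (n : ℤ) + τ)))) (w n)) :
    ∃ w ∈ W τ, ∀ n : ℕ, HasSum (fun k : ℤ => g (2 * k + μ) ^ (b + 1) *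
      g (2 * k + μ + (2 * (n : ℤ) + τ)) ^ (c + 1)) ((X τ * w) n) := by
  obtain ⟨w, hw, h⟩ := h
  obtain ⟨w1, hw1, h1⟩ := ind1 τ μ hμ b c
  obtain ⟨w2, hw2, h2⟩ := ind2 τ μ hτ hμ b c
  refine ⟨w + X τ * (w1 + w2), (W τ).add_mem hw ((W τ).mul_mem (X_mem τ) ((W τ).add_mem hw1 hw2)),
    fun n => ?_⟩
  refine hs_congr (((h n).add (((h1 n).add (h2 n)).mul_left (X τ n))).mul_left (X τ n)) (fun k => ?_) rfl
  rw [pow_succ, pow_succ, mul_mul_mul_comm, g_mul (2 * k + μ) (2 * (n : ℤ) + τ) (by omega), X]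
  ring

lemma main_ind (τ μ : ℕ) (hτ : τ = 1 ∨ τ = 2) (hμ : μ = 1 ∨ μ = 2) (N : ℕ) : ∀ b c : ℕ, b + c = N + 2 →
    (∃ w ∈ W τ, ∀ n : ℕ, HasSum (fun k : ℤ => g (2 * k + μ) ^ b *
      g (2 * k + μ + (2 * (n : ℤ) + τ)) ^ c) (w n)) ∧ (0 < b → 0 < c →
    ∃ w ∈ W τ, ∀ n : ℕ, HasSum (fun k : ℤ => g (2 * k + μ) ^ b *
      g (2 * k + μ + (2 * (n : ℤ) + τ)) ^ c) ((X τ * w) n)) := by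
  induction N with
  | zero =>
    intro b c hbc
    have hpos : 0 < b → 0 < c → ∃ w ∈ W τ, ∀ n : ℕ, HasSum (fun k : ℤ => g (2 * k + μ) ^ b *
      g (2 * k + μ + (2 * (n : ℤ) + τ)) ^ c) ((X τ * w) n) := by
      intro hb hc
      obtain rfl : b = 0 + 1 := by omega
      obtain rfl : c = 0 + 1 := by omega
      refine step τ μ hτ hμ 0 0 ⟨0, (W τ).zero_mem, fun n => ?_⟩
      refine hs_congr (diff_zero μ (2 * n + τ) (by omega)) (fun k => ?_) rfl
      push_cast
      ring
    refine ⟨?_, hpos⟩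
    rcases Nat.eq_zero_or_pos b with rfl | hb
    · obtain ⟨z, hz, h⟩ := full_hasSum (μ + τ) c (by omega)
      refine ⟨_, const_mem τ z hz, fun n => hs_congr (shift_hasSum _ (n : ℤ) _ h) (fun k => ?_) rfl⟩
      rw [pow_zero, one_mul]
      exact congrArg (fun x => g x ^ c) (by ring)
    rcases Nat.eq_zero_or_pos c with rfl | hc
    · obtain ⟨z, hz, h⟩ := full_hasSum μ b (by omega)
      refine ⟨_, const_mem τ z hz, fun n => hs_congr h (fun k => ?_) rfl⟩
      rw [pow_zero, mul_one]
    obtain ⟨w, hw, h⟩ := hpos hb hc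
    exact ⟨_, (W τ).mul_mem (X_mem τ) hw, h⟩
  | succ N ih =>
    intro b c hbc
    have hpos : 0 < b → 0 < c → ∃ w ∈ W τ, ∀ n : ℕ, HasSum (fun k : ℤ => g (2 * k + μ) ^ b *
      g (2 * k + μ + (2 * (n : ℤ) + τ)) ^ c) ((X τ * w) n) := by
      intro hb hc
      obtain ⟨b, rfl⟩ : ∃ b', b = b' + 1 := ⟨b - 1, by omega⟩
      obtain ⟨c, rfl⟩ : ∃ c', c = c' + 1 := ⟨c - 1, by omega⟩
      obtain ⟨w1, hw1, h1⟩ := (ih (b + 1) c (by omega)).1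
      obtain ⟨w2, hw2, h2⟩ := (ih b (c + 1) (by omega)).1
      refine step τ μ hτ hμ b c ⟨w1 - w2, (W τ).sub_mem hw1 hw2, fun n => ?_⟩
      refine hs_congr ((h1 n).sub (h2 n)) (fun k => ?_) rfl
      ring
    refine ⟨?_, hpos⟩
    rcases Nat.eq_zero_or_pos b with rfl | hb
    · obtain ⟨z, hz, h⟩ := full_hasSum (μ + τ) c (by omega)
      refine ⟨_, const_mem τ z hz, fun n => hs_congr (shift_hasSum _ (n : ℤ) _ h) (fun k => ?_) rfl⟩
      rw [pow_zero, one_mul]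
      exact congrArg (fun x => g x ^ c) (by ring)
    rcases Nat.eq_zero_or_pos c with rfl | hc
    · obtain ⟨z, hz, h⟩ := full_hasSum μ b (by omega)
      refine ⟨_, const_mem τ z hz, fun n => hs_congr h (fun k => ?_) rfl⟩
      rw [pow_zero, mul_one]
    obtain ⟨w, hw, h⟩ := hpos hb hc
    exact ⟨_, (W τ).mul_mem (X_mem τ) hw, h⟩

lemma outer (τ : ℕ) (hτ : τ = 1 ∨ τ = 2) (w : ℕ → ℝ) (hw : w ∈ W τ) (a : ℕ) (ha : 2 ≤ a) :
    ∃ z ∈ Z, HasSum (fun n => X τ n ^ a * w n) z := by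
  rw [W, Algebra.adjoin_singleton_eq_range_aeval] at hw
  obtain ⟨P, rfl⟩ := hw
  induction P using Polynomial.induction_on' with
  | add p q hp hq =>
    obtain ⟨z, hz, h⟩ := hp
    obtain ⟨z', hz', h'⟩ := hq
    refine ⟨z + z', Z.add_mem hz hz', hs_congr (h.add h') (fun n => ?_) rfl⟩
    simp [mul_add]
  | monomial i c =>
    obtain ⟨z, hz, h⟩ := odd_hasSum τ hτ (a + i) (by omega)
    refine ⟨(c : ℝ) * z, Z.mul_mem c.2 hz, hs_congr (h.mul_left (c : ℝ)) (fun n => ?_) rfl⟩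
    have : (Polynomial.aeval (X τ) (Polynomial.monomial i c)) n = (c : ℝ) * X τ n ^ i := by
      rw [Polynomial.aeval_monomial]
      rfl
    change X τ n ^ a * (Polynomial.aeval (X τ) (Polynomial.monomial i c)) n = _
    rw [this, X]
    ring

/-- the general term -/
noncomputable def F (a b c : ℕ) (p q : ℤ) : ℝ := g p ^ a * g q ^ b * g (q + p) ^ c

lemma inner_outer (τ μ : ℕ) (hτ : τ = 1 ∨ τ = 2) (hμ : μ = 1 ∨ μ = 2) (a b c : ℕ)
    (ha : 0 < a) (hb : 0 < b) (hc : 0 < c) :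
    ∃ S : ℕ → ℝ, (∀ n : ℕ, HasSum (fun k : ℤ => F a b c (2 * (n : ℤ) + τ) (2 * k + μ)) (S n)) ∧
      ∃ z ∈ Z, HasSum S z := by
  obtain ⟨w, hw, h⟩ := (main_ind τ μ hτ hμ (b + c - 2) b c (by omega)).2 hb hc
  obtain ⟨z, hz, h'⟩ := outer τ hτ w hw (a + 1) (by omega)
  refine ⟨fun n => X τ n ^ a * (X τ * w) n, fun n => hs_congr ((h n).mul_left (X τ n ^ a)) (fun k => ?_) rfl,
    z, hz, hs_congr h' (fun n => ?_) rfl⟩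
  · rw [F, X]; ring
  · simp; ring

lemma abs_g_le_rpow (x y z : ℤ) (h : x + y + z = 0) : |g x| * |g y| * |g z| ≤
    |(x : ℝ)| ^ (-(3/2) : ℝ) * |(y : ℝ)| ^ (-(3/2) : ℝ) + |(y : ℝ)| ^ (-(3/2) : ℝ) * |(z : ℝ)| ^ (-(3/2) : ℝ)
    + |(x : ℝ)| ^ (-(3/2) : ℝ) * |(z : ℝ)| ^ (-(3/2) : ℝ) := by
  have nn : ∀ t : ℝ, 0 ≤ |t| ^ (-(3/2) : ℝ) := fun t => by positivity
  by_cases hx : x = 0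
  · subst hx; rw [g_zero]; simp only [abs_zero, zero_mul]; positivity
  by_cases hy : y = 0
  · subst hy; rw [g_zero]; simp only [abs_zero, zero_mul, mul_zero]; positivity
  by_cases hz : z = 0
  · subst hz; rw [g_zero]; simp only [abs_zero, mul_zero]; positivity
  have key : ∀ u v w : ℝ, 0 < u → 0 < v → 0 < w → u ≤ w → v ≤ w →
      u⁻¹ * v⁻¹ * w⁻¹ ≤ u ^ (-(3/2) : ℝ) * v ^ (-(3/2) : ℝ) := by
    intro u v w hu hv hw h1 h2
    have hh : ∀ t : ℝ, 0 < t → t ^ (-(3/2) : ℝ) = t⁻¹ * (√t)⁻¹ := by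
      intro t ht
      rw [show (-(3/2) : ℝ) = -1 + -(1/2) by norm_num, Real.rpow_add ht, Real.rpow_neg_one,
        Real.rpow_neg ht.le, Real.sqrt_eq_rpow]
    rw [hh u hu, hh v hv]
    have h3 : √u * √v ≤ w := by
      calc √u * √v ≤ √w * √w := by gcongr
        _ = w := Real.mul_self_sqrt hw.le
    have : w⁻¹ ≤ (√u)⁻¹ * (√v)⁻¹ := by
      rw [← mul_inv]
      exact inv_anti₀ (by positivity) h3
    calc u⁻¹ * v⁻¹ * w⁻¹ ≤ u⁻¹ * v⁻¹ * ((√u)⁻¹ * (√v)⁻¹) := by gcongr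
      _ = _ := by ring
  have hx' : 0 < |(x : ℝ)| := by simpa using hx
  have hy' : 0 < |(y : ℝ)| := by simpa using hy
  have hz' : 0 < |(z : ℝ)| := by simpa using hz
  have p1 := mul_nonneg (nn x) (nn y)
  have p2 := mul_nonneg (nn y) (nn z)
  have p3 := mul_nonneg (nn x) (nn z)
  simp only [g, abs_inv]
  rcases le_total |(x : ℝ)| |(y : ℝ)| with h1 | h1
  · rcases le_total |(y : ℝ)| |(z : ℝ)| with h2 | h2
    · have := key _ _ _ hx' hy' hz' (h1.trans h2) h2
      linarith
    · have := key _ _ _ hx' hz' hy' h1 h2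
      linarith
  · rcases le_total |(x : ℝ)| |(z : ℝ)| with h2 | h2
    · have := key _ _ _ hx' hy' hz' h2 (h1.trans h2)
      linarith
    · have := key _ _ _ hy' hz' hx' h1 h2
      linarith

lemma summable_G : Summable (fun x : ℤ × ℤ => |g x.1| * |g x.2| * |g (x.2 + x.1)|) := by
  have h := Real.summable_abs_int_rpow (show (1 : ℝ) < 3 / 2 by norm_num)
  have h2 := h.mul_of_nonneg h (fun n => by simp; positivity) (fun n => by simp; positivity)
  have e1 : Function.Injective (fun x : ℤ × ℤ => (x.2, -(x.2 + x.1))) := by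
    rintro ⟨a, b⟩ ⟨c, d⟩ h
    simp only [Prod.mk.injEq] at h ⊢
    omega
  have e2 : Function.Injective (fun x : ℤ × ℤ => (x.1, -(x.2 + x.1))) := by
    rintro ⟨a, b⟩ ⟨c, d⟩ h
    simp only [Prod.mk.injEq] at h ⊢
    omega
  refine Summable.of_nonneg_of_le (fun x => by positivity) (fun x => ?_)
    ((h2.add (h2.comp_injective e1)).add (h2.comp_injective e2))
  have := abs_g_le_rpow x.1 x.2 (-(x.2 + x.1)) (by ring)
  rwa [g_neg, abs_neg] at this

lemma abs_g_le_one (n : ℤ) : |g n| ≤ 1 := by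
  by_cases h : n = 0
  · subst h; simp [g_zero]
  · rw [g, abs_inv]
    apply inv_le_one_of_one_le₀
    exact_mod_cast Int.one_le_abs h

lemma summable_F (a b c : ℕ) (ha : 0 < a) (hb : 0 < b) (hc : 0 < c) :
    Summable (fun x : ℤ × ℤ => F a b c x.1 x.2) := by
  have hp : ∀ (n : ℤ) (i : ℕ), 0 < i → |g n| ^ i ≤ |g n| := fun n i hi =>
    pow_le_of_le_one (abs_nonneg _) (abs_g_le_one n) (by omega)
  refine Summable.of_norm_bounded summable_G fun x => ?_
  rw [F, Real.norm_eq_abs, abs_mul, abs_mul, abs_pow, abs_pow, abs_pow]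
  gcongr <;> apply hp <;> assumption

lemma F_neg (a b c : ℕ) (h : Odd (a + b + c)) (p q : ℤ) : F a b c (-p) (-q) = - F a b c p q := by
  rw [F, F, ← neg_add, g_neg, g_neg, g_neg, neg_pow, neg_pow (g q), neg_pow (g (q + p))]
  have : (-1 : ℝ) ^ (a + b + c) = -1 := h.neg_one_pow
  rw [pow_add, pow_add] at this
  linear_combination (g p ^ a * g q ^ b * g (q + p) ^ c) * this

lemma F_swap (a b c : ℕ) (p q : ℤ) : F a b c p q = F b a c q p := by
  rw [F, F, add_comm q p]; ring

lemma half (τ μ : ℕ) (hτ : τ = 1 ∨ τ = 2) (hμ : μ = 1 ∨ μ = 2) (a b c : ℕ)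
    (ha : 0 < a) (hb : 0 < b) (hc : 0 < c) :
    (∑' x : ℕ × ℕ, F a b c (2 * (x.1 : ℤ) + τ) (2 * (x.2 : ℤ) + μ)) +
    (∑' x : ℕ × ℕ, F a b c (2 * (x.1 : ℤ) + τ) (-(2 * (x.2 : ℤ) + μ))) ∈ Z := by
  obtain ⟨S, hS, z, hz, h⟩ := inner_outer τ μ hτ hμ a b c ha hb hc
  have s1 : Summable (fun x : ℕ × ℕ => F a b c (2 * (x.1 : ℤ) + τ) (2 * (x.2 : ℤ) + μ)) :=
    (summable_F a b c ha hb hc).comp_injective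
      (i := fun x : ℕ × ℕ => ((2 * (x.1 : ℤ) + τ : ℤ), (2 * (x.2 : ℤ) + μ : ℤ))) (by
      rintro ⟨a, b⟩ ⟨c, d⟩ h
      simp only [Prod.mk.injEq] at h ⊢
      omega)
  have s2 : Summable (fun x : ℕ × ℕ => F a b c (2 * (x.1 : ℤ) + τ) (-(2 * (x.2 : ℤ) + μ))) :=
    (summable_F a b c ha hb hc).comp_injective
      (i := fun x : ℕ × ℕ => ((2 * (x.1 : ℤ) + τ : ℤ), (-(2 * (x.2 : ℤ) + μ) : ℤ))) (by
      rintro ⟨a, b⟩ ⟨c, d⟩ h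
      simp only [Prod.mk.injEq] at h ⊢
      omega)
  have h1 := s1.hasSum.prod_fiberwise (fun n => (s1.prod_factor n).hasSum)
  have h2 := s2.hasSum.prod_fiberwise (fun n => (s2.prod_factor n).hasSum)
  have h3 : HasSum S _ := hs_congr (h1.add h2) (fun n => by
    refine (hS n).unique ?_
    exact split_int μ hμ (fun q => F a b c (2 * (n : ℤ) + τ) q)
      (by simp only [F, g_zero]; rw [zero_pow (by omega)]; ring) _ _
      (s1.prod_factor n).hasSum (s2.prod_factor n).hasSum) rfl
  rw [h3.unique h]
  exact hz

end TPar

/-- Parity result for the series T_{τ,μ}(a,b,c): if a+b+c is odd and τ,μ ∈ {1,2},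
then Σ_{l,m ≥ 0} 1/((2l+τ)^a (2m+μ)^b (2l+2m+τ+μ)^c) lies in the ℚ-subalgebra of
ℝ generated by the Riemann zeta values ζ(k), k ≥ 2. -/
theorem T_series_parity (a b c : ℕ) (ha : 0 < a) (hb : 0 < b) (hc : 0 < c)
    (hodd : Odd (a + b + c)) (τ μ : ℕ) (hτ : τ = 1 ∨ τ = 2) (hμ : μ = 1 ∨ μ = 2) :
    (∑' pr : ℕ × ℕ,
      (1 : ℝ) / ((2 * (pr.1 : ℝ) + (τ : ℝ)) ^ a * (2 * (pr.2 : ℝ) + (μ : ℝ)) ^ b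
        * (2 * (pr.1 : ℝ) + 2 * (pr.2 : ℝ) + (τ : ℝ) + (μ : ℝ)) ^ c))
    ∈ Algebra.adjoin ℚ
        {x : ℝ | ∃ k : ℕ, 2 ≤ k ∧ x = ∑' n : ℕ, (1 : ℝ) / ((n : ℝ) + 1) ^ k} := by
  have h1 := TPar.half τ μ hτ hμ a b c ha hb hc
  have h2 := TPar.half μ τ hμ hτ b a c hb ha hc
  have e1 : (∑' x : ℕ × ℕ, TPar.F b a c (2 * (x.1 : ℤ) + μ) (2 * (x.2 : ℤ) + τ)) =
      ∑' x : ℕ × ℕ, TPar.F a b c (2 * (x.1 : ℤ) + τ) (2 * (x.2 : ℤ) + μ) := by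
    rw [← (Equiv.prodComm ℕ ℕ).tsum_eq]
    exact tsum_congr fun x => TPar.F_swap _ _ _ _ _
  have e2 : (∑' x : ℕ × ℕ, TPar.F b a c (2 * (x.1 : ℤ) + μ) (-(2 * (x.2 : ℤ) + τ))) =
      - ∑' x : ℕ × ℕ, TPar.F a b c (2 * (x.1 : ℤ) + τ) (-(2 * (x.2 : ℤ) + μ)) := by
    rw [← (Equiv.prodComm ℕ ℕ).tsum_eq, ← tsum_neg]
    refine tsum_congr fun x => ?_
    rw [← TPar.F_neg a b c hodd, neg_neg]
    exact TPar.F_swap _ _ _ _ _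
  rw [e1, e2] at h2
  have h3 := TPar.Z.smul_mem (TPar.Z.add_mem h1 h2) (1 / 2 : ℚ)
  have e3 : (∑' pr : ℕ × ℕ,
      (1 : ℝ) / ((2 * (pr.1 : ℝ) + (τ : ℝ)) ^ a * (2 * (pr.2 : ℝ) + (μ : ℝ)) ^ b
        * (2 * (pr.1 : ℝ) + 2 * (pr.2 : ℝ) + (τ : ℝ) + (μ : ℝ)) ^ c)) =
      ∑' x : ℕ × ℕ, TPar.F a b c (2 * (x.1 : ℤ) + τ) (2 * (x.2 : ℤ) + μ) := by
    refine tsum_congr fun x => ?_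
    rw [TPar.F, TPar.g, TPar.g, TPar.g]
    push_cast
    rw [one_div, mul_inv, mul_inv, inv_pow, inv_pow, inv_pow]
    congr 3
    ring
  rw [e3]
  change _ ∈ TPar.Z
  convert h3 using 1
  rw [Rat.smul_def]
  push_cast
  ring
end

section
/- Σ over integers m,n ≥ 1 with m ≡ n (mod 3) of 1/(m⁴·n⁴·(m+n)⁴) = (3279473/48475988686125)·π¹². -/
open Complex MeasureTheory

/-- exponential -/
noncomputable def puE (n : ℤ) (x : ℝ) : ℂ := Complex.exp (2 * Real.pi * Complex.I * n * x)

/-- Fourier series -/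
noncomputable def puF (x : ℝ) : ℂ := ∑' n : ℤ, 1 / (n : ℂ) ^ 4 * puE n x

lemma puE_norm (n : ℤ) (x : ℝ) : ‖puE n x‖ = 1 := by
  have : puE n x = Complex.exp (((2 * Real.pi * n * x : ℝ) : ℂ) * Complex.I) := by
    unfold puE; congr 1; push_cast; ring
  rw [this, Complex.norm_exp_ofReal_mul_I]

lemma puE_re (n : ℤ) (x : ℝ) : (puE n x).re = Real.cos (2 * Real.pi * n * x) := by
  have : puE n x = Complex.exp (((2 * Real.pi * n * x : ℝ) : ℂ) * Complex.I) := by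
    unfold puE; congr 1; push_cast; ring
  rw [this, Complex.exp_ofReal_mul_I_re]

lemma puE_cont (n : ℤ) : Continuous (puE n) := by
  unfold puE; fun_prop

lemma puE_mul (a b : ℤ) (x t : ℝ) :
    puE a (x + t) * puE b (x - t) = puE (a - b) t * puE (a + b) x := by
  unfold puE; rw [← Complex.exp_add, ← Complex.exp_add]; congr 1; push_cast; ring

lemma puE_add_one (n : ℤ) (x : ℝ) : puE n (x + 1) = puE n x := by
  unfold puE
  have : (2 * Real.pi * Complex.I * n * ((x + 1 : ℝ) : ℂ))
    = 2 * Real.pi * Complex.I * n * x + n * (2 * Real.pi * Complex.I) := by push_cast; ring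
  rw [this, Complex.exp_periodic.int_mul n]

lemma pu_summable : Summable (fun n : ℤ => ‖1 / (n : ℂ) ^ 4‖) := by
  have := (Real.summable_one_div_int_pow (p := 4)).2 (by norm_num)
  refine this.abs.congr fun n => ?_
  simp [abs_inv]

lemma pu_summable' (x : ℝ) : Summable (fun n : ℤ => ‖1 / (n : ℂ) ^ 4 * puE n x‖) := by
  simpa only [norm_mul, puE_norm, mul_one] using pu_summable

lemma puF_cont : Continuous puF := by
  refine continuous_tsum (fun n => (puE_cont n).const_mul _) pu_summable fun n x => ?_
  rw [norm_mul, puE_norm, mul_one]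

lemma puF_norm (x : ℝ) : ‖puF x‖ ≤ ∑' n : ℤ, ‖1 / (n : ℂ) ^ 4‖ := by
  refine (norm_tsum_le_tsum_norm (pu_summable' x)).trans (le_of_eq ?_)
  simp only [norm_mul, puE_norm, mul_one]

lemma puF_periodic : Function.Periodic puF 1 := by
  intro x; unfold puF; simp only [puE_add_one]

lemma pu_bern (x : ℝ) : bernoulliFun 4 x = x ^ 4 - 2 * x ^ 3 + x ^ 2 - 1 / 30 := by
  have h4 : bernoulli 4 = -1/30 := by rw [bernoulli_eq_bernoulli'_of_ne_one (by norm_num), bernoulli'_four]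
  have h3 : bernoulli 3 = 0 := by rw [bernoulli_eq_bernoulli'_of_ne_one (by norm_num), bernoulli'_three]
  have h2 : bernoulli 2 = 1/6 := by rw [bernoulli_eq_bernoulli'_of_ne_one (by norm_num), bernoulli'_two]
  have c : Nat.choose 4 2 = 6 := by decide
  simp [bernoulliFun, Polynomial.bernoulli_def, Finset.sum_range_succ, h4, h3, h2, c]
  ring

lemma puF_eq' {x : ℝ} (hx : x ∈ Set.Icc (0 : ℝ) 1) :
    puF x = (-(2 / 3) * Real.pi ^ 4 : ℂ) * (bernoulliFun 4 x : ℂ) := by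
  have := (hasSum_one_div_pow_mul_fourier_mul_bernoulliFun (k := 4) (by norm_num) hx).tsum_eq
  simp only [fourier_coe_apply, Complex.ofReal_one, div_one] at this
  unfold puF puE
  rw [this]
  congr 1
  simp only [mul_pow, Complex.I_pow_four, Nat.factorial]
  push_cast; ring

lemma puF_eq {x : ℝ} (hx : x ∈ Set.Icc (0 : ℝ) 1) :
    puF x = ((-(2 / 3) * Real.pi ^ 4 * (x ^ 4 - 2 * x ^ 3 + x ^ 2 - 1 / 30) : ℝ) : ℂ) := by
  rw [puF_eq' hx, pu_bern]; push_cast; ring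

lemma puF_coeff (n : ℤ) : ∫ x in (0:ℝ)..1, puE n x * puF x = 1 / (n : ℂ) ^ 4 := by
  have h := bernoulliFourierCoeff_eq (k := 4) (by norm_num) (-n)
  rw [bernoulliFourierCoeff, fourierCoeffOn_eq_integral] at h
  simp only [fourier_coe_apply, neg_neg, sub_zero, Complex.ofReal_one, div_one, one_smul, smul_eq_mul] at h
  have e : ∫ x in (0:ℝ)..1, puE n x * puF x
      = ∫ x in (0:ℝ)..1, (-(2 / 3) * Real.pi ^ 4 : ℂ) *
        (Complex.exp (2 * Real.pi * Complex.I * n * x) * (bernoulliFun 4 x : ℂ)) := by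
    refine intervalIntegral.integral_congr fun x hx => ?_
    rw [Set.uIcc_of_le zero_le_one] at hx
    simp only [puF_eq' hx, puE]; ring
  rw [e, intervalIntegral.integral_const_mul, h]
  simp only [mul_pow, Complex.I_pow_four, Nat.factorial]
  have hp : (Real.pi : ℂ) ≠ 0 := by exact_mod_cast Real.pi_ne_zero
  by_cases hn : n = 0
  · simp [hn]
  have : (n : ℂ) ≠ 0 := by exact_mod_cast hn
  push_cast
  field_simp
  norm_num

lemma pu_hasSum (t : ℝ) :
    HasSum (fun p : ℤ × ℤ => 1 / (p.1 : ℂ) ^ 4 * (1 / (p.2 : ℂ) ^ 4) * (1 / ((p.1 + p.2 : ℤ) : ℂ) ^ 4)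
      * puE (p.1 - p.2) t) (∫ x in (0:ℝ)..1, puF (x + t) * puF (x - t) * puF x) := by
  have key := intervalIntegral.hasSum_integral_of_dominated_convergence (μ := volume) (a := 0) (b := 1)
    (F := fun (p : ℤ × ℤ) x => (1 / (p.1 : ℂ) ^ 4 * puE p.1 (x + t)) * (1 / (p.2 : ℂ) ^ 4 * puE p.2 (x - t)) * puF x)
    (f := fun x => puF (x + t) * puF (x - t) * puF x)
    (fun p _ => ‖1 / (p.1 : ℂ) ^ 4 * (1 / (p.2 : ℂ) ^ 4)‖ * ∑' n : ℤ, ‖1 / (n : ℂ) ^ 4‖)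
    (fun p => ?_) (fun p => ?_) ?_ ?_ ?_
  · convert! key using 1
    funext p
    have : ∀ x : ℝ, (1 / (p.1 : ℂ) ^ 4 * puE p.1 (x + t)) * (1 / (p.2 : ℂ) ^ 4 * puE p.2 (x - t)) * puF x
      = (1 / (p.1 : ℂ) ^ 4 * (1 / (p.2 : ℂ) ^ 4) * puE (p.1 - p.2) t) * (puE (p.1 + p.2) x * puF x) := by
      intro x
      have := puE_mul p.1 p.2 x t
      linear_combination (1 / (p.1 : ℂ) ^ 4 * (1 / (p.2 : ℂ) ^ 4) * puF x) * this
    simp only [this]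
    rw [intervalIntegral.integral_const_mul, puF_coeff]
    ring
  · have := puF_cont
    have := puE_cont
    exact Continuous.aestronglyMeasurable (by fun_prop)
  · refine Filter.Eventually.of_forall fun x _ => ?_
    simp only [norm_mul, puE_norm, mul_one]
    exact mul_le_mul_of_nonneg_left (puF_norm x) (by positivity)
  · exact Filter.Eventually.of_forall fun x _ => (pu_summable.mul_norm pu_summable).mul_right _
  · exact intervalIntegrable_const
  · refine Filter.Eventually.of_forall fun x _ => ?_
    refine HasSum.mul_right _ ?_
    unfold puF
    rw [tsum_mul_tsum_of_summable_norm (pu_summable' _) (pu_summable' _)]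
    exact (summable_mul_of_summable_norm (pu_summable' _) (pu_summable' _)).hasSum

lemma pu_poly (n : ℕ) (c : ℕ → ℝ) (b : ℝ) : ∫ x in (0:ℝ)..b, ∑ i ∈ Finset.range n, c i * x ^ i
    = ∑ i ∈ Finset.range n, c i * (b ^ (i + 1) / (i + 1)) := by
  rw [intervalIntegral.integral_finsetSum]
  · refine Finset.sum_congr rfl fun i _ => ?_
    rw [intervalIntegral.integral_const_mul, integral_pow]; simp
  · intro i _
    exact Continuous.intervalIntegrable (by fun_prop) _ _

lemma pu_int0 : ∫ x in (0:ℝ)..1, puF (x + 0) * puF (x - 0) * puF x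
    = (((-(2 / 3) * Real.pi ^ 4) ^ 3 * (-19 / 13513500) : ℝ) : ℂ) := by
  have e : ∫ x in (0:ℝ)..1, puF (x + 0) * puF (x - 0) * puF x
    = ∫ x in (0:ℝ)..1, (((-(2 / 3) * Real.pi ^ 4) ^ 3 * ∑ i ∈ Finset.range 13,
      (fun i => ([-1/27000, 0, 1/300, -1/150, -29/300, 2/5, 2/5, -28/5, 149/10, -20, 15, -6, 1] : List ℝ).getD i 0) i * x ^ i : ℝ) : ℂ) := by
    refine intervalIntegral.integral_congr fun x hx => ?_
    rw [Set.uIcc_of_le zero_le_one] at hx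
    simp only [add_zero, sub_zero, puF_eq hx]
    rw [← Complex.ofReal_mul, ← Complex.ofReal_mul]
    congr 1
    simp [Finset.sum_range_succ]
    ring
  rw [e, intervalIntegral.integral_ofReal, intervalIntegral.integral_const_mul, pu_poly]
  congr 2
  simp [Finset.sum_range_succ]
  norm_num

lemma pu_int1 : ∫ x in (0:ℝ)..1, puF (x + 1/3) * puF (x - 1/3) * puF x
    = (((-(2 / 3) * Real.pi ^ 4) ^ 3 * (-1078771/797958661500) : ℝ) : ℂ) := by
  have hper : Function.Periodic (fun x => puF (x + 1/3) * puF (x - 1/3) * puF x) (1/3) := by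
    intro x
    have h1 : puF (x + 1/3 + 1/3) = puF (x - 1/3) := by
      rw [← puF_periodic (x - 1/3)]; congr 1; ring
    have h2 : x + 1/3 - 1/3 = x := by ring
    simp only [h1, h2]; ring
  have hc : Continuous (fun x => puF (x + 1/3) * puF (x - 1/3) * puF x) := by
    have := puF_cont
    fun_prop
  have e1 : ∫ x in (0:ℝ)..1, puF (x + 1/3) * puF (x - 1/3) * puF x
    = 3 * ∫ x in (0:ℝ)..(1/3), puF (x + 1/3) * puF (x - 1/3) * puF x := by
    have := hper.intervalIntegral_add_zsmul_eq 3 0 (fun a b => hc.intervalIntegrable a b)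
    norm_num at this
    norm_num
    exact this
  have e : ∫ x in (0:ℝ)..(1/3), puF (x + 1/3) * puF (x - 1/3) * puF x
    = ∫ x in (0:ℝ)..(1/3), (((-(2 / 3) * Real.pi ^ 4) ^ 3 * ∑ i ∈ Finset.range 13,
      (fun i => ([-169/19683000, 0, 883/656100, -169/328050, -28703/656100, 238/3645, 1258/3645, -92/135, -217/270, 20/9, -1/9, -2, 1] : List ℝ).getD i 0) i * x ^ i : ℝ) : ℂ) := by
    refine intervalIntegral.integral_congr fun x hx => ?_
    rw [Set.uIcc_of_le (by norm_num)] at hx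
    obtain ⟨hx0, hx1⟩ := hx
    have h1 : puF (x - 1/3) = puF (x + 2/3) := by
      rw [← puF_periodic (x - 1/3)]; congr 1; ring
    simp only [h1]
    rw [puF_eq (x := x + 1/3) ⟨by linarith, by linarith⟩, puF_eq (x := x + 2/3) ⟨by linarith, by linarith⟩,
      puF_eq (x := x) ⟨by linarith, by linarith⟩]
    rw [← Complex.ofReal_mul, ← Complex.ofReal_mul]
    congr 1
    simp [Finset.sum_range_succ]
    ring
  rw [e1, e, intervalIntegral.integral_ofReal, intervalIntegral.integral_const_mul, pu_poly]
  rw [show (3 : ℂ) = ((3 : ℝ) : ℂ) by norm_num, ← Complex.ofReal_mul]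
  congr 1
  rw [mul_left_comm]
  congr 1
  simp [Finset.sum_range_succ]
  norm_num

/-- summand on the integer lattice -/
noncomputable def puG (p : ℤ × ℤ) : ℝ :=
  if p.1 % 3 = p.2 % 3 then 1 / ((p.1 : ℝ) ^ 4 * (p.2 : ℝ) ^ 4 * ((p.1 : ℝ) + p.2) ^ 4) else 0

lemma pu_cos (n : ℤ) : 1 + 2 * Real.cos (2 * Real.pi * n * (1/3)) = if n % 3 = 0 then 3 else 0 := by
  have hc : Real.cos (2 * Real.pi / 3) = -1/2 := by
    rw [show 2 * Real.pi / 3 = Real.pi - Real.pi / 3 by ring, Real.cos_pi_sub, Real.cos_pi_div_three]; norm_num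
  have hn := Int.emod_add_mul_ediv n 3
  have hr : n % 3 = 0 ∨ n % 3 = 1 ∨ n % 3 = 2 := by omega
  have hn' : (n : ℝ) = ((n % 3 : ℤ) : ℝ) + 3 * ((n / 3 : ℤ) : ℝ) := by exact_mod_cast hn.symm
  have : 2 * Real.pi * n * (1/3) = 2 * Real.pi / 3 * ((n % 3 : ℤ) : ℝ) + (n / 3 : ℤ) * (2 * Real.pi) := by
    rw [hn']; push_cast; ring
  rw [this, Real.cos_add_int_mul_two_pi]
  rcases hr with h | h | h <;> simp only [h]
  · norm_num
  · norm_num [hc]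
  · rw [show 2 * Real.pi / 3 * ((2 : ℤ) : ℝ) = 2 * (2 * Real.pi / 3) by push_cast; ring, Real.cos_two_mul, hc]
    norm_num

lemma pu_G : HasSum puG ((1/3) * ((-(2 / 3) * Real.pi ^ 4) ^ 3 * (-19 / 13513500)
    + 2 * ((-(2 / 3) * Real.pi ^ 4) ^ 3 * (-1078771/797958661500)))) := by
  have h0 := pu_hasSum 0
  have h1 := pu_hasSum (1/3)
  rw [pu_int0] at h0
  rw [pu_int1] at h1
  have k0 := Complex.hasSum_re h0
  have k1 := Complex.hasSum_re h1
  rw [Complex.ofReal_re] at k0 k1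
  have hre : ∀ (p : ℤ × ℤ) (t : ℝ), (1 / (p.1 : ℂ) ^ 4 * (1 / (p.2 : ℂ) ^ 4) * (1 / ((p.1 + p.2 : ℤ) : ℂ) ^ 4)
      * puE (p.1 - p.2) t).re = 1 / ((p.1 : ℝ) ^ 4 * (p.2 : ℝ) ^ 4 * ((p.1 : ℝ) + p.2) ^ 4)
        * Real.cos (2 * Real.pi * (p.1 - p.2 : ℤ) * t) := by
    intro p t
    rw [← puE_re, ← Complex.re_ofReal_mul]
    congr 2
    push_cast
    simp only [one_div, mul_inv]
  simp only [hre] at k0 k1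
  convert! (k0.add (k1.mul_left 2)).mul_left (1/3) using 1
  funext p
  have hc := pu_cos (p.1 - p.2)
  simp only [puG, mul_zero, Real.cos_zero, mul_one]
  by_cases hp : p.1 % 3 = p.2 % 3
  · rw [if_pos (by omega)] at hc
    rw [if_pos hp]
    linear_combination -(1/3) * (1 / ((p.1 : ℝ) ^ 4 * (p.2 : ℝ) ^ 4 * ((p.1 : ℝ) + p.2) ^ 4)) * hc
  · rw [if_neg (by omega)] at hc
    rw [if_neg hp]
    linear_combination -(1/3) * (1 / ((p.1 : ℝ) ^ 4 * (p.2 : ℝ) ^ 4 * ((p.1 : ℝ) + p.2) ^ 4)) * hc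

lemma pu_six (h : Summable puG) : ∑' p, puG p = 6 * ∑' pr : ℕ × ℕ, (if (pr.1 + 1) % 3 = (pr.2 + 1) % 3 then
      (1 : ℝ) / (((pr.1 : ℝ) + 1) ^ 4 * ((pr.2 : ℝ) + 1) ^ 4
        * ((pr.1 : ℝ) + (pr.2 : ℝ) + 2) ^ 4) else 0) := by
  let φ : (ℕ × ℕ) × Fin 6 → ℤ × ℤ := fun q =>
    let m : ℤ := q.1.1 + 1
    let n : ℤ := q.1.2 + 1
    ![(m, n), (-m, -n), (m + n, -n), (-n, m + n), (-(m + n), n), (n, -(m + n))] q.2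
  have hinj : Function.Injective φ := by
    rintro ⟨⟨a, b⟩, i⟩ ⟨⟨c, d⟩, j⟩ hh
    fin_cases i <;> fin_cases j <;> simp [φ] at hh ⊢ <;> omega
  have hsup : Function.support puG ⊆ Set.range φ := by
    rintro ⟨a, b⟩ hab
    have ha : a ≠ 0 := by rintro rfl; simp [puG] at hab
    have hb : b ≠ 0 := by rintro rfl; simp [puG] at hab
    have hs : a + b ≠ 0 := by
      intro hs
      have : (a : ℝ) + b = 0 := by exact_mod_cast hs
      simp [puG, this] at hab
    have mk : ∀ (m n : ℤ) (i : Fin 6), 0 < m → 0 < n →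
        ![(m, n), (-m, -n), (m + n, -n), (-n, m + n), (-(m + n), n), (n, -(m + n))] i = (a, b) →
        (a, b) ∈ Set.range φ := by
      intro m n i hm hn hh
      refine ⟨(((m - 1).toNat, (n - 1).toNat), i), ?_⟩
      have e1 : (((m - 1).toNat : ℕ) : ℤ) + 1 = m := by omega
      have e2 : (((n - 1).toNat : ℕ) : ℤ) + 1 = n := by omega
      simp only [φ, e1, e2, hh]
    rcases lt_or_gt_of_ne ha with ha' | ha' <;> rcases lt_or_gt_of_ne hb with hb' | hb'
    · exact mk (-a) (-b) 1 (by omega) (by omega) (by simp)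
    · rcases lt_or_gt_of_ne hs with hs' | hs'
      · exact mk (-a - b) b 4 (by omega) (by omega) (by simp)
      · exact mk (a + b) (-a) 3 (by omega) (by omega) (by simp)
    · rcases lt_or_gt_of_ne hs with hs' | hs'
      · exact mk (-a - b) a 5 (by omega) (by omega) (by simp)
      · exact mk (a + b) (-b) 2 (by omega) (by omega) (by simp)
    · exact mk a b 0 (by omega) (by omega) (by simp)
  have hval : ∀ (q : ℕ × ℕ) (i : Fin 6), puG (φ (q, i)) = (if (q.1 + 1) % 3 = (q.2 + 1) % 3 then
      (1 : ℝ) / (((q.1 : ℝ) + 1) ^ 4 * ((q.2 : ℝ) + 1) ^ 4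
        * ((q.1 : ℝ) + (q.2 : ℝ) + 2) ^ 4) else 0) := by
    rintro ⟨a, b⟩ i
    fin_cases i <;> simp only [φ, puG] <;> simp <;> congr 1
    all_goals first
      | (apply propext; omega)
      | (simp only [← mul_inv]; congr 1; ring)
  have hs : Summable (fun q => puG (φ q)) := h.comp_injective hinj
  rw [← hinj.tsum_eq hsup, hs.tsum_prod, ← tsum_mul_left]
  refine tsum_congr fun q => ?_
  simp only [hval, tsum_fintype, Finset.sum_const, Finset.card_univ, Fintype.card_fin, nsmul_eq_mul]
  norm_num

/-- The value ζ₂PU3(4,4,4): the sum over m,n ≥ 1 with m ≡ n (mod 3) of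
1/(m⁴n⁴(m+n)⁴) equals (3279473/48475988686125)π¹². -/
theorem zeta2_PU3_four_four_four :
    (∑' pr : ℕ × ℕ, (if (pr.1 + 1) % 3 = (pr.2 + 1) % 3 then
      (1 : ℝ) / (((pr.1 : ℝ) + 1) ^ 4 * ((pr.2 : ℝ) + 1) ^ 4
        * ((pr.1 : ℝ) + (pr.2 : ℝ) + 2) ^ 4) else 0))
    = 3279473 / 48475988686125 * Real.pi ^ 12 := by
  have h6 := pu_six pu_G.summable
  rw [pu_G.tsum_eq] at h6
  linear_combination -(1/6) * h6
end

section
/- Σ over integers m₁, m₂, m₃ ≥ 1 of i^{3m₁+2m₂+m₃}/(m₁²·m₂²·m₃²·(m₁+m₂)²·(m₂+m₃)²·(m₁+m₂+m₃)²) = −(19329337/2678117105664000)·π¹², where i is the imaginary unit. -/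
lemma bern_vals : bernoulli 0 = 1 ∧ bernoulli 1 = -1/2 ∧ bernoulli 2 = 1/6 ∧ bernoulli 3 = 0 ∧
    bernoulli 4 = -1/30 ∧ bernoulli 5 = 0 ∧ bernoulli 6 = 1/42 ∧ bernoulli 7 = 0 ∧
    bernoulli 8 = -1/30 ∧ bernoulli 9 = 0 ∧ bernoulli 10 = 5/66 ∧ bernoulli 11 = 0 ∧
    bernoulli 12 = -691/2730 := by
  have h0 : bernoulli 0 = 1 := bernoulli_zero
  have h1 : bernoulli 1 = -1/2 := bernoulli_one
  have h2 : bernoulli 2 = 1/6 := by rw [bernoulli_two]; norm_num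
  have h3 : bernoulli 3 = 0 := by
    have := sum_bernoulli 4
    simp [Finset.sum_range_succ, h0, h1, h2, Nat.choose] at this; linarith
  have h4 : bernoulli 4 = -1/30 := by
    have := sum_bernoulli 5
    simp [Finset.sum_range_succ, h0, h1, h2, h3, Nat.choose] at this; linarith
  have h5 : bernoulli 5 = 0 := by
    have := sum_bernoulli 6
    simp [Finset.sum_range_succ, h0, h1, h2, h3, h4, Nat.choose] at this; linarith
  have h6 : bernoulli 6 = 1/42 := by
    have := sum_bernoulli 7
    simp [Finset.sum_range_succ, h0, h1, h2, h3, h4, h5, Nat.choose] at this; linarith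
  have h7 : bernoulli 7 = 0 := by
    have := sum_bernoulli 8
    simp [Finset.sum_range_succ, h0, h1, h2, h3, h4, h5, h6, Nat.choose] at this; linarith
  have h8 : bernoulli 8 = -1/30 := by
    have := sum_bernoulli 9
    simp [Finset.sum_range_succ, h0, h1, h2, h3, h4, h5, h6, h7, Nat.choose] at this; linarith
  have h9 : bernoulli 9 = 0 := by
    have := sum_bernoulli 10
    simp [Finset.sum_range_succ, h0, h1, h2, h3, h4, h5, h6, h7, h8, Nat.choose] at this; linarith
  have h10 : bernoulli 10 = 5/66 := by
    have := sum_bernoulli 11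
    simp [Finset.sum_range_succ, h0, h1, h2, h3, h4, h5, h6, h7, h8, h9, Nat.choose] at this
    linarith
  have h11 : bernoulli 11 = 0 := by
    have := sum_bernoulli 12
    simp [Finset.sum_range_succ, h0, h1, h2, h3, h4, h5, h6, h7, h8, h9, h10, Nat.choose] at this
    linarith
  have h12 : bernoulli 12 = -691/2730 := by
    have := sum_bernoulli 13
    simp [Finset.sum_range_succ, h0, h1, h2, h3, h4, h5, h6, h7, h8, h9, h10, h11,
      Nat.choose] at this
    linarith
  exact ⟨h0, h1, h2, h3, h4, h5, h6, h7, h8, h9, h10, h11, h12⟩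

lemma bfun_eq (k : ℕ) (x : ℝ) : bernoulliFun k x =
    ∑ i ∈ Finset.range (k+1), ((bernoulli i : ℚ) : ℝ) * (k.choose i : ℝ) * x^(k-i) := by
  simp [bernoulliFun, Polynomial.bernoulli, Polynomial.eval_finsetSum, Polynomial.map_sum, Polynomial.map_monomial, Polynomial.eval_monomial]

noncomputable def E (n : ℤ) : ℂ := Complex.I ^ n
noncomputable def J (n : ℤ) : ℂ := ((n : ℤ) : ℂ)⁻¹
noncomputable def pv (k : ℕ) : ℂ :=
  -(2 * (Real.pi:ℂ) * Complex.I) ^ k / (k.factorial : ℂ) * (bernoulliFun k (1/4) : ℂ)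
noncomputable def qv (k : ℕ) : ℂ :=
  -(2 * (Real.pi:ℂ) * Complex.I) ^ k / (k.factorial : ℂ) * (bernoulliFun k (1/2) : ℂ)

lemma E_add (a b : ℤ) : E (a + b) = E a * E b := zpow_add₀ Complex.I_ne_zero a b
lemma E_sub (a b : ℤ) : E (a - b) = E a / E b := zpow_sub₀ Complex.I_ne_zero a b
lemma E_ne (a : ℤ) : E a ≠ 0 := zpow_ne_zero _ Complex.I_ne_zero
lemma E_neg (a : ℤ) : E (-a) = (E a)⁻¹ := zpow_neg _ _
lemma E_zero : E 0 = 1 := zpow_zero _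
lemma E_one : E 1 = Complex.I := zpow_one _
lemma E_four (a : ℤ) : E a ^ 4 = 1 := by
  have : E a ^ 4 = (Complex.I ^ (4:ℕ)) ^ a := by
    rw [E, ← zpow_natCast, ← zpow_mul, mul_comm, zpow_mul, zpow_natCast]
  rw [this, Complex.I_pow_four, one_zpow]
lemma E_norm (a : ℤ) : ‖E a‖ = 1 := by simp [E]
lemma J_zero : J 0 = 0 := by simp [J]
lemma J_neg (a : ℤ) : J (-a) = - J a := by simp [J, inv_neg]
lemma J_norm (a : ℤ) : ‖J a‖ ≤ 1 := by
  rcases eq_or_ne a 0 with rfl | h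
  · simp [J]
  · rw [J, norm_inv, Complex.norm_intCast]
    apply inv_le_one_of_one_le₀
    exact_mod_cast Int.one_le_abs h

lemma E_exp (n : ℤ) : E n = Complex.exp (n * (Real.pi / 2 * Complex.I)) := by
  rw [Complex.exp_int_mul, Complex.exp_pi_div_two_mul_I, E]

lemma hasSum_p (k : ℕ) (hk : 2 ≤ k) : HasSum (fun n : ℤ => E n * J n ^ k) (pv k) := by
  have := hasSum_one_div_pow_mul_fourier_mul_bernoulliFun hk (x := 1/4)
    (by constructor <;> norm_num)
  refine this.congr_fun ?_
  intro n
  rw [fourier_coe_apply, E_exp, J, inv_pow, one_div, mul_comm]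
  congr 2; push_cast; ring

lemma hasSum_q (k : ℕ) (hk : 2 ≤ k) : HasSum (fun n : ℤ => E n * E n * J n ^ k) (qv k) := by
  have := hasSum_one_div_pow_mul_fourier_mul_bernoulliFun hk (x := 1/2)
    (by constructor <;> norm_num)
  refine this.congr_fun ?_
  intro n
  rw [fourier_coe_apply, E_exp, J, inv_pow, one_div, mul_comm, ← Complex.exp_add]
  congr 2; push_cast; ring

lemma summable_J2 : Summable (fun n : ℤ => ‖J n‖ ^ 2) := by
  have h := (hasSum_p 2 le_rfl).summable.norm
  refine h.congr ?_
  intro n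
  rw [norm_mul, E_norm, norm_pow, one_mul]

lemma ipow : Complex.I^2 = -1 ∧ Complex.I^3 = -Complex.I ∧ Complex.I^4 = 1 ∧ Complex.I^5 = Complex.I ∧
    Complex.I^6 = -1 ∧ Complex.I^7 = -Complex.I ∧ Complex.I^8 = 1 ∧ Complex.I^9 = Complex.I ∧
    Complex.I^10 = -1 ∧ Complex.I^11 = -Complex.I ∧ Complex.I^12 = 1 := by
  have h2 := Complex.I_sq
  have h4 := Complex.I_pow_four
  refine ⟨h2, ?_, h4, ?_, ?_, ?_, ?_, ?_, ?_, ?_, ?_⟩ <;> simp [pow_succ]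

lemma bf_pv : bernoulliFun 2 (1/4) = -1/48 ∧ bernoulliFun 3 (1/4) = 3/64 ∧ bernoulliFun 4 (1/4) = 7/3840 ∧ bernoulliFun 5 (1/4) = -25/1024 ∧ bernoulliFun 6 (1/4) = -31/86016 ∧ bernoulliFun 7 (1/4) = 427/16384 ∧ bernoulliFun 8 (1/4) = 127/983040 ∧ bernoulliFun 9 (1/4) = -12465/262144 ∧ bernoulliFun 10 (1/4) = -2555/34603008 ∧ bernoulliFun 11 (1/4) = 555731/4194304 ∧ bernoulliFun 12 (1/4) = 1414477/22900899840 := by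
  obtain ⟨h0, h1, h2, h3, h4, h5, h6, h7, h8, h9, h10, h11, h12⟩ := bern_vals
  refine ⟨?_, ?_, ?_, ?_, ?_, ?_, ?_, ?_, ?_, ?_, ?_⟩ <;>
  · rw [bfun_eq]
    simp only [Finset.sum_range_succ, Finset.sum_range_zero, h0, h1, h2, h3, h4, h5, h6, h7, h8, h9, h10, h11, h12]
    norm_num [Nat.choose]

lemma pv_vals : pv 2 = (-1/24) * (Real.pi:ℂ)^2 ∧ pv 3 = (1/16) * Complex.I * (Real.pi:ℂ)^3 ∧ pv 4 = (-7/5760) * (Real.pi:ℂ)^4 ∧ pv 5 = (5/768) * Complex.I * (Real.pi:ℂ)^5 ∧ pv 6 = (-31/967680) * (Real.pi:ℂ)^6 ∧ pv 7 = (61/92160) * Complex.I * (Real.pi:ℂ)^7 ∧ pv 8 = (-127/154828800) * (Real.pi:ℂ)^8 ∧ pv 9 = (277/4128768) * Complex.I * (Real.pi:ℂ)^9 ∧ pv 10 = (-73/3503554560) * (Real.pi:ℂ)^10 ∧ pv 11 = (50521/7431782400) * Complex.I * (Real.pi:ℂ)^11 ∧ pv 12 = (-1414477/2678117105664000) * (Real.pi:ℂ)^12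 := by
  obtain ⟨h2, h3, h4, h5, h6, h7, h8, h9, h10, h11, h12⟩ := bf_pv
  refine ⟨?_, ?_, ?_, ?_, ?_, ?_, ?_, ?_, ?_, ?_, ?_⟩ <;>
  · simp only [pv, h2, h3, h4, h5, h6, h7, h8, h9, h10, h11, h12, mul_pow, ipow]
    norm_num [Nat.factorial]
    try ring

lemma bf_qv : bernoulliFun 8 (1/2) = 127/3840 ∧ bernoulliFun 9 (1/2) = 0 ∧ bernoulliFun 10 (1/2) = -2555/33792 ∧ bernoulliFun 11 (1/2) = 0 ∧ bernoulliFun 12 (1/2) = 1414477/5591040 := by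
  obtain ⟨h0, h1, h2, h3, h4, h5, h6, h7, h8, h9, h10, h11, h12⟩ := bern_vals
  refine ⟨?_, ?_, ?_, ?_, ?_⟩ <;>
  · rw [bfun_eq]
    simp only [Finset.sum_range_succ, Finset.sum_range_zero, h0, h1, h2, h3, h4, h5, h6, h7, h8, h9, h10, h11, h12]
    norm_num [Nat.choose]

lemma qv_vals : qv 8 = (-127/604800) * (Real.pi:ℂ)^8 ∧ qv 9 = (0) * Complex.I * (Real.pi:ℂ)^9 ∧ qv 10 = (-73/3421440) * (Real.pi:ℂ)^10 ∧ qv 11 = (0) * Complex.I * (Real.pi:ℂ)^11 ∧ qv 12 = (-1414477/653837184000) * (Real.pi:ℂ)^12 := by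
  obtain ⟨h8, h9, h10, h11, h12⟩ := bf_qv
  refine ⟨?_, ?_, ?_, ?_, ?_⟩ <;>
  · simp only [qv, h8, h9, h10, h11, h12, mul_pow, ipow]
    norm_num [Nat.factorial]
    try ring


noncomputable def p1 : ℂ := Complex.I * Real.pi / 2

lemma E_even (k : ℕ) : E (2 * k) = (-1)^k := by
  have : (2 * (k:ℤ)) = ((2*k : ℕ) : ℤ) := by push_cast; rfl
  rw [E, this, zpow_natCast, pow_mul, Complex.I_sq]

lemma partial_formula (K : ℕ) :
    ∑ n ∈ Finset.range (2*K), ((E n * J n - Complex.I * (E (n-1) * J (n-1)))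
      + (E (-(n+1)) * J (-(n+1)) - Complex.I * (E (-(n+1)-1) * J (-(n+1)-1))))
    = (1 - Complex.I) * (2 * Complex.I * ((∑ i ∈ Finset.range K, (-1 : ℝ) ^ i / (2 * i + 1) : ℝ) : ℂ)
        + E (-(2*K)) * J (-(2*K))) + Complex.I * (E (2*K-1) * J (2*K-1))
        - Complex.I * (E (-(2*K)-1) * J (-(2*K)-1)) := by
  induction K with
  | zero => simp [J_zero]
  | succ K ih =>
    rw [show 2 * (K+1) = 2*K+1+1 by ring, Finset.sum_range_succ, Finset.sum_range_succ, ih,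
      Finset.sum_range_succ]
    have h1 : E (2*K+1) * J (2*K+1) + E (-(2*K)-1) * J (-(2*K)-1)
        = 2 * Complex.I * (-1)^K / (2*K+1) := by
      rw [show (-(2*(K:ℤ))-1) = -(2*K+1) by ring, J_neg, E_neg, E_add, E_one, E_even, J]
      have : ((-1:ℂ)^K)⁻¹ = (-1)^K := by
        rw [← inv_pow]; norm_num
      rw [mul_inv, this, Complex.inv_I]
      push_cast
      ring
    have h2 : E (2*K) * J (2*K) + E (-(2*K)) * J (-(2*K)) = 0 := by
      rw [J_neg, E_neg, E_even]
      have : ((-1:ℂ)^K)⁻¹ = (-1)^K := by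
        rw [← inv_pow]; norm_num
      rw [this]; ring
    push_cast
    rw [show (2 * (K:ℤ) + 1 - 1) = 2 * K by ring, show (2*((K:ℤ)+1)) = 2*K+1+1 by ring]
    rw [show (2 * (K:ℤ) + 1 + 1 - 1) = 2 * K + 1 by ring, show -(2 * (K:ℤ) + 1) = -(2*K) - 1 by ring,
      show -(2 * (K:ℤ) + 1 + 1) = -(2*K) - 1 - 1 by ring]
    linear_combination (1 - Complex.I) * h1 + (1 - Complex.I) * h2

lemma tendsto_EJ (u : ℕ → ℤ) (hu : Filter.Tendsto (fun k => |u k|) Filter.atTop Filter.atTop) :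
    Filter.Tendsto (fun k => E (u k) * J (u k)) Filter.atTop (nhds 0) := by
  rw [tendsto_zero_iff_norm_tendsto_zero]
  have : ∀ k, ‖E (u k) * J (u k)‖ = ((|u k| : ℤ) : ℝ)⁻¹ := by
    intro k; rw [norm_mul, E_norm, one_mul, J, norm_inv, Complex.norm_intCast]; push_cast; rfl
  simp only [this]
  exact tendsto_inv_atTop_zero.comp (tendsto_intCast_atTop_atTop.comp hu)

lemma summable_D : Summable (fun b : ℤ => E b * J b - Complex.I * (E (b-1) * J (b-1))) := by
  have hs : Summable (fun b : ℤ => ‖J b‖^2 + ‖J (b-1)‖^2) :=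
    summable_J2.add ((Equiv.subRight (1:ℤ)).summable_iff.mpr summable_J2)
  refine Summable.of_norm_bounded hs ?_
  intro b
  have he : Complex.I * E (b-1) = E b := by
    rw [E_sub, E_one]; field_simp
  rcases eq_or_ne b 0 with rfl | h0
  · simp [E_norm, J]
  rcases eq_or_ne b 1 with rfl | h1
  · simp [E_norm, J]
  have h0' : (b:ℂ) ≠ 0 := by exact_mod_cast h0
  have h1' : (b:ℂ) - 1 ≠ 0 := by
    have : b - 1 ≠ 0 := sub_ne_zero.mpr h1
    exact_mod_cast this
  have : E b * J b - Complex.I * (E (b-1) * J (b-1)) = - (E b * (J b * J (b-1))) := by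
    rw [← mul_assoc, he, J, J]; push_cast; field_simp; ring
  rw [this, norm_neg, norm_mul, E_norm, one_mul, norm_mul]
  nlinarith [sq_nonneg (‖J b‖ - ‖J (b-1)‖), sq_nonneg (‖J b‖), sq_nonneg (‖J (b-1)‖)]

lemma hasSum_D1 : HasSum (fun b : ℤ => E b * J b - Complex.I * (E (b-1) * J (b-1)))
    (p1 * (1 - Complex.I)) := by
  have h := summable_D.hasSum
  have h2 := h.nat_add_neg_add_one.tendsto_sum_nat
  have h3 := h2.comp (Filter.tendsto_id.const_mul_atTop' (two_pos : (0:ℕ) < 2))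
  have h4 : Filter.Tendsto (fun K : ℕ => (1 - Complex.I) * (2 * Complex.I * ((∑ i ∈ Finset.range K, (-1 : ℝ) ^ i / (2 * i + 1) : ℝ) : ℂ)
        + E (-(2*K)) * J (-(2*K))) + Complex.I * (E (2*K-1) * J (2*K-1))
        - Complex.I * (E (-(2*K)-1) * J (-(2*K)-1))) Filter.atTop
      (nhds ((1 - Complex.I) * (2 * Complex.I * ((Real.pi / 4 : ℝ) : ℂ) + 0) + Complex.I * 0 - Complex.I * 0)) := by
    have hn : Filter.Tendsto (fun k : ℕ => (k:ℤ)) Filter.atTop Filter.atTop := tendsto_natCast_atTop_atTop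
    refine (((((Complex.continuous_ofReal.tendsto _).comp Real.tendsto_sum_pi_div_four).const_mul _).add (tendsto_EJ _ ?_)).const_mul _ |>.add ((tendsto_EJ _ ?_).const_mul _)).sub ((tendsto_EJ _ ?_).const_mul _)
    all_goals
      refine Filter.tendsto_atTop_mono' _ ?_ hn
      filter_upwards [Filter.eventually_ge_atTop 1] with k hk
      rw [le_abs]
      omega
  have h5 := tendsto_nhds_unique h3 (h4.congr (fun K => (partial_formula K).symm))
  convert h using 1
  rw [h5, p1]; push_cast; ring

lemma hs_congr {α : Type*} {f g : α → ℂ} {a b : ℂ} (h : HasSum f a) (hf : ∀ x, g x = f x)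
    (hab : b = a) : HasSum g b := by
  rw [hab, show g = f from funext hf]; exact h

lemma hasSum_D (a : ℤ) : HasSum (fun b : ℤ => E b * (J b - J (b-a))) (p1 * (1 - E a)) := by
  have hstep : ∀ a : ℤ, HasSum (fun b : ℤ => E b * (J (b - a) - J (b-(a+1))))
      (p1 * (E a - E (a+1))) := by
    intro a
    have h := ((Equiv.subRight a).hasSum_iff.mpr hasSum_D1).mul_left (E a)
    refine hs_congr h (fun b => ?_) ?_
    · simp only [Function.comp, Equiv.subRight_apply]
      rw [show b - a - 1 = b - (a+1) by ring, E_sub, E_sub, E_add, E_one]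
      have := E_ne a
      field_simp
    · rw [E_add, E_one]; ring
  induction a using Int.induction_on with
  | zero => simp [E_zero]
  | succ i ih => exact hs_congr (ih.add (hstep i)) (fun b => by ring) (by ring)
  | pred i ih =>
    have := hstep (-i - 1)
    rw [sub_add_cancel] at this
    exact hs_congr (ih.sub this) (fun b => by ring) (by ring)

lemma hasSum_ps (k : ℕ) (hk : 2 ≤ k) (a : ℤ) :
    HasSum (fun n : ℤ => E n * J (n - a) ^ k) (E a * pv k) := by
  have h := ((Equiv.subRight a).hasSum_iff.mpr (hasSum_p k hk)).mul_left (E a)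
  refine hs_congr h (fun b => ?_) rfl
  simp only [Function.comp, Equiv.subRight_apply]
  rw [E_sub]
  have := E_ne a
  field_simp

lemma J_sub_self (a : ℤ) : J (a - a) = 0 := by simp [J]

lemma hasSum_G4 (a : ℤ) (ha : a ≠ 0) : HasSum (fun b : ℤ => E b * J b ^ 4 * J (a - b) ^ 2)
    (J a ^ 2 * pv 4 + 2 * J a ^ 3 * pv 3 + 3 * J a ^ 4 * pv 2 + 4 * J a ^ 5 * (p1 * (1 - E a))
      + J a ^ 4 * (E a * pv 2) - 5 * J a ^ 6 - 10 * E a * J a ^ 6) := by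
  have h := ((((((hasSum_p 4 (by norm_num)).mul_left (J a ^ 2)).add
    ((hasSum_p 3 (by norm_num)).mul_left (2 * J a ^ 3))).add
    ((hasSum_p 2 (by norm_num)).mul_left (3 * J a ^ 4))).add
    ((hasSum_D a).mul_left (4 * J a ^ 5))).add
    ((hasSum_ps 2 (by norm_num) a).mul_left (J a ^ 4))).sub
    (hasSum_ite_eq (0:ℤ) (5 * J a ^ 6)) |>.sub (hasSum_ite_eq a (10 * E a * J a ^ 6))
  refine hs_congr h (fun b => ?_) rfl
  rcases eq_or_ne b 0 with rfl | h0
  · simp [J_zero, E_zero, J_neg, ha.symm]; ring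
  rcases eq_or_ne b a with rfl | h1
  · simp [J_zero, h0]; ring
  have hb : (b:ℂ) ≠ 0 := by exact_mod_cast h0
  have ha : (a:ℂ) ≠ 0 := by exact_mod_cast ha
  have hab : (b:ℂ) - a ≠ 0 := by
    have : b - a ≠ 0 := sub_ne_zero.mpr h1
    exact_mod_cast this
  have hab' : (a:ℂ) - b ≠ 0 := by rw [← neg_sub]; exact neg_ne_zero.mpr hab
  rw [show a - b = -(b - a) by ring, J_neg]
  simp only [h0, h1, if_false, J]
  push_cast
  field_simp
  ring

lemma hasSum_G5 (a : ℤ) (ha : a ≠ 0) : HasSum (fun b : ℤ => E b * J b ^ 5 * J (a - b) ^ 2)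
    (J a ^ 2 * pv 5 + 2 * J a ^ 3 * pv 4 + 3 * J a ^ 4 * pv 3 + 4 * J a ^ 5 * pv 2
      + 5 * J a ^ 6 * (p1 * (1 - E a))
      + J a ^ 5 * (E a * pv 2) - 6 * J a ^ 7 - 15 * E a * J a ^ 7) := by
  have h := (((((((hasSum_p 5 (by norm_num)).mul_left (J a ^ 2)).add
    ((hasSum_p 4 (by norm_num)).mul_left (2 * J a ^ 3))).add
    ((hasSum_p 3 (by norm_num)).mul_left (3 * J a ^ 4))).add
    ((hasSum_p 2 (by norm_num)).mul_left (4 * J a ^ 5))).add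
    ((hasSum_D a).mul_left (5 * J a ^ 6))).add
    ((hasSum_ps 2 (by norm_num) a).mul_left (J a ^ 5))).sub
    (hasSum_ite_eq (0:ℤ) (6 * J a ^ 7)) |>.sub (hasSum_ite_eq a (15 * E a * J a ^ 7))
  refine hs_congr h (fun b => ?_) rfl
  rcases eq_or_ne b 0 with rfl | h0
  · simp [J_zero, E_zero, J_neg, ha.symm]; ring
  rcases eq_or_ne b a with rfl | h1
  · simp [J_zero, h0]; ring
  have hb : (b:ℂ) ≠ 0 := by exact_mod_cast h0
  have ha : (a:ℂ) ≠ 0 := by exact_mod_cast ha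
  have hab : (b:ℂ) - a ≠ 0 := by
    have : b - a ≠ 0 := sub_ne_zero.mpr h1
    exact_mod_cast this
  rw [show a - b = -(b - a) by ring, J_neg]
  simp only [h0, h1, if_false, J]
  push_cast
  field_simp
  ring

noncomputable def mtt (p q : ℕ) (x : ℤ × ℤ) : ℂ :=
  E (x.1 + x.2) * J x.1 ^ p * J x.2 ^ q * J (x.1 - x.2) ^ 2

lemma J_pow_norm (a : ℤ) (p : ℕ) (hp : 2 ≤ p) : ‖J a ^ p‖ ≤ ‖J a‖ ^ 2 := by
  rw [norm_pow]; exact pow_le_pow_of_le_one (norm_nonneg _) (J_norm a) hp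

lemma summable_JJ : Summable (fun x : ℤ × ℤ => ‖J x.1‖ ^ 2 * ‖J x.2‖ ^ 2) :=
  summable_J2.mul_of_nonneg summable_J2 (fun _ => by positivity) (fun _ => by positivity)

lemma summable_mt (p q : ℕ) (hp : 2 ≤ p) (hq : 2 ≤ q) : Summable (mtt p q) := by
  refine Summable.of_norm_bounded summable_JJ ?_
  intro x
  rw [mtt, norm_mul, norm_mul, norm_mul, E_norm, one_mul]
  have h1 := J_pow_norm x.1 p hp
  have h2 := J_pow_norm x.2 q hq
  have h3 : ‖J (x.1 - x.2) ^ 2‖ ≤ 1 := by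
    rw [norm_pow]; exact pow_le_one₀ (norm_nonneg _) (J_norm _)
  calc _ ≤ ‖J x.1‖ ^ 2 * ‖J x.2‖ ^ 2 * 1 := by gcongr
    _ = _ := mul_one _

noncomputable def M4 (p : ℕ) : ℂ :=
  pv 4 * pv (p+2) + 2 * pv 3 * pv (p+3) + 3 * pv 2 * pv (p+4) + 4 * p1 * (pv (p+5) - qv (p+5))
    + pv 2 * qv (p+4) - 5 * pv (p+6) - 10 * qv (p+6)

noncomputable def M5 (p : ℕ) : ℂ :=
  pv 5 * pv (p+2) + 2 * pv 4 * pv (p+3) + 3 * pv 3 * pv (p+4) + 4 * pv 2 * pv (p+5)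
    + 5 * p1 * (pv (p+6) - qv (p+6))
    + pv 2 * qv (p+5) - 6 * pv (p+7) - 15 * qv (p+7)

lemma hasSum_M4 (p : ℕ) (hp : 2 ≤ p) : HasSum (mtt p 4) (M4 p) := by
  have h := (summable_mt p 4 hp (by norm_num)).hasSum
  have h2 := h.prod_fiberwise (g := fun a => E a * J a ^ p * (J a ^ 2 * pv 4 + 2 * J a ^ 3 * pv 3 + 3 * J a ^ 4 * pv 2 + 4 * J a ^ 5 * (p1 * (1 - E a))
      + J a ^ 4 * (E a * pv 2) - 5 * J a ^ 6 - 10 * E a * J a ^ 6)) (fun a => by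
    rcases eq_or_ne a 0 with rfl | ha
    · have : p ≠ 0 := by omega
      simp [mtt, J_zero, this]
    · refine hs_congr ((hasSum_G4 a ha).mul_left (E a * J a ^ p)) (fun b => ?_) rfl
      simp only [mtt, E_add]; ring)
  have h3 := (((((((hasSum_p (p+2) (by omega)).mul_left (pv 4)).add
    ((hasSum_p (p+3) (by omega)).mul_left (2 * pv 3))).add
    ((hasSum_p (p+4) (by omega)).mul_left (3 * pv 2))).add
    (((hasSum_p (p+5) (by omega)).sub (hasSum_q (p+5) (by omega))).mul_left (4 * p1))).add
    ((hasSum_q (p+4) (by omega)).mul_left (pv 2))).sub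
    ((hasSum_p (p+6) (by omega)).mul_left 5)).sub
    ((hasSum_q (p+6) (by omega)).mul_left 10)
  have h4 := h2.unique (hs_congr h3 (fun a => by ring) rfl)
  rw [h4] at h
  exact h

lemma hasSum_M5 (p : ℕ) (hp : 2 ≤ p) : HasSum (mtt p 5) (M5 p) := by
  have h := (summable_mt p 5 hp (by norm_num)).hasSum
  have h2 := h.prod_fiberwise (g := fun a => E a * J a ^ p * (J a ^ 2 * pv 5 + 2 * J a ^ 3 * pv 4 + 3 * J a ^ 4 * pv 3 + 4 * J a ^ 5 * pv 2
      + 5 * J a ^ 6 * (p1 * (1 - E a))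
      + J a ^ 5 * (E a * pv 2) - 6 * J a ^ 7 - 15 * E a * J a ^ 7)) (fun a => by
    rcases eq_or_ne a 0 with rfl | ha
    · have : p ≠ 0 := by omega
      simp [mtt, J_zero, this]
    · refine hs_congr ((hasSum_G5 a ha).mul_left (E a * J a ^ p)) (fun b => ?_) rfl
      simp only [mtt, E_add]; ring)
  have h3 := ((((((((hasSum_p (p+2) (by omega)).mul_left (pv 5)).add
    ((hasSum_p (p+3) (by omega)).mul_left (2 * pv 4))).add
    ((hasSum_p (p+4) (by omega)).mul_left (3 * pv 3))).add
    ((hasSum_p (p+5) (by omega)).mul_left (4 * pv 2))).add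
    (((hasSum_p (p+6) (by omega)).sub (hasSum_q (p+6) (by omega))).mul_left (5 * p1))).add
    ((hasSum_q (p+5) (by omega)).mul_left (pv 2))).sub
    ((hasSum_p (p+7) (by omega)).mul_left 6)).sub
    ((hasSum_q (p+7) (by omega)).mul_left 15)
  have h4 := h2.unique (hs_congr h3 (fun a => by ring) rfl)
  rw [h4] at h
  exact h

lemma hasSum_mt_swap (p q : ℕ) (s : ℂ) (h : HasSum (mtt p q) s) : HasSum (mtt q p) s := by
  refine hs_congr ((Equiv.prodComm ℤ ℤ).hasSum_iff.mpr h) (fun x => ?_) rfl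
  simp only [mtt, Function.comp, Equiv.prodComm_apply, Prod.fst_swap, Prod.snd_swap]
  rw [show x.2 - x.1 = -(x.1 - x.2) by ring, J_neg, add_comm x.2 x.1]; ring

noncomputable def t0 (a b : ℤ) : ℂ :=
  E (a + b) * J a ^ 4 * J b ^ 4 * J (a - b) ^ 2 *
    (pv 2 + 2 * p1 * (J a + J b) - (3 * J a ^ 2 + 4 * J a * J b + 3 * J b ^ 2))

noncomputable def Kv : ℂ := pv 2 * M4 4 + 4 * p1 * M4 5 - 6 * M4 6 - 4 * M5 5

lemma hasSum_t0 : HasSum (fun x : ℤ × ℤ => t0 x.1 x.2) Kv := by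
  have h44 := hasSum_M4 4 (by norm_num)
  have h54 := hasSum_M4 5 (by norm_num)
  have h45 := hasSum_mt_swap _ _ _ h54
  have h64 := hasSum_M4 6 (by norm_num)
  have h46 := hasSum_mt_swap _ _ _ h64
  have h55 := hasSum_M5 5 (by norm_num)
  refine hs_congr ((((h44.mul_left (pv 2)).add ((h54.add h45).mul_left (2 * p1))).sub
    ((h64.add h46).mul_left 3)).sub (h55.mul_left 4)) (fun x => ?_) ?_
  · simp only [mtt, t0]; ring
  · simp only [Kv]; ring

lemma Kv_val : Kv = 8 * (-(19329337 / 2678117105664000) * (Real.pi : ℂ) ^ 12) := by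
  obtain ⟨h2, h3, h4, h5, h6, h7, h8, h9, h10, h11, h12⟩ := pv_vals
  obtain ⟨q8, q9, q10, q11, q12⟩ := qv_vals
  simp only [Kv, M4, M5, Nat.reduceAdd, h2, h3, h4, h5, h6, h7, h8, h9, h10, h11, h12,
    q8, q9, q10, q11, q12, p1]
  ring_nf
  simp only [ipow]
  ring

noncomputable def F (x : (ℤ × ℤ) × ℤ) : ℂ :=
  E (x.1.1 + x.1.2 + x.2) * (J x.1.1 * J x.1.2 * J x.2 * J (x.1.1 - x.1.2) * J (x.1.1 - x.2)
    * J (x.1.2 - x.2)) ^ 2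

lemma summable_F : Summable F := by
  have h : Summable (fun x : (ℤ × ℤ) × ℤ => (‖J x.1.1‖ ^ 2 * ‖J x.1.2‖ ^ 2) * ‖J x.2‖ ^ 2) :=
    summable_JJ.mul_of_nonneg summable_J2 (fun _ => by positivity) (fun _ => by positivity)
  refine Summable.of_norm_bounded h ?_
  intro x
  simp only [F, norm_mul, norm_pow, E_norm, one_mul, mul_pow]
  have h1 : ∀ n, ‖J n‖ ^ 2 ≤ 1 := fun n => pow_le_one₀ (norm_nonneg _) (J_norm _)
  calc _ ≤ (‖J x.1.1‖ ^ 2 * ‖J x.1.2‖ ^ 2) * ‖J x.2‖ ^ 2 * 1 * 1 * 1 := by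
        gcongr <;> exact h1 _
    _ = _ := by ring

lemma hasSum_T (a b : ℤ) (ha : a ≠ 0) (hb : b ≠ 0) (hab : a ≠ b) :
    HasSum (fun c : ℤ => E c * (J c * J (a - c) * J (b - c)) ^ 2)
     (J a ^ 2 * J b ^ 2 * (pv 2 + 2 * p1 * (J a + J b) - (3 * J a ^ 2 + 4 * J a * J b + 3 * J b ^ 2))
      + E a * (J a ^ 2 * J (a - b) ^ 2 * (pv 2 - 2 * p1 * (J a + J (a - b)) -
          (3 * J a ^ 2 + 4 * J a * J (a - b) + 3 * J (a - b) ^ 2)))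
      + E b * (J b ^ 2 * J (a - b) ^ 2 * (pv 2 - 2 * p1 * (J b - J (a - b)) -
          (3 * J b ^ 2 - 4 * J b * J (a - b) + 3 * J (a - b) ^ 2)))) := by
  have ha' : (a:ℂ) ≠ 0 := by exact_mod_cast ha
  have hb' : (b:ℂ) ≠ 0 := by exact_mod_cast hb
  have hab' : (a:ℂ) - b ≠ 0 := by
    have : a - b ≠ 0 := sub_ne_zero.mpr hab
    exact_mod_cast this
  have h := ((((((((hasSum_p 2 (by norm_num)).mul_left (J a ^ 2 * J b ^ 2)).add
    ((hasSum_ps 2 (by norm_num) a).mul_left (J a ^ 2 * J (a - b) ^ 2))).add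
    ((hasSum_ps 2 (by norm_num) b).mul_left (J b ^ 2 * J (a - b) ^ 2))).add
    ((hasSum_D a).mul_left (2 * (J a ^ 2 * J (a - b) ^ 2 * (J a + J (a - b)))))).add
    ((hasSum_D b).mul_left (2 * (J b ^ 2 * J (a - b) ^ 2 * (J b - J (a - b)))))).sub
    (hasSum_ite_eq (0:ℤ) (J a ^ 2 * J b ^ 2 * (3 * J a ^ 2 + 4 * J a * J b + 3 * J b ^ 2)))).sub
    (hasSum_ite_eq a (E a * (J a ^ 2 * J (a - b) ^ 2 *
      (3 * J a ^ 2 + 4 * J a * J (a - b) + 3 * J (a - b) ^ 2))))).sub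
    (hasSum_ite_eq b (E b * (J b ^ 2 * J (a - b) ^ 2 *
      (3 * J b ^ 2 - 4 * J b * J (a - b) + 3 * J (a - b) ^ 2))))
  have hba : J (b - a) = - J (a - b) := by rw [← J_neg]; congr 1; ring
  refine hs_congr h (fun c => ?_) ?_
  · rcases eq_or_ne c 0 with rfl | h0
    · simp only [E_zero, zero_sub, ha.symm, hb.symm, if_true, if_false, J]
      push_cast
      field_simp
      ring
    rcases eq_or_ne c a with rfl | h1
    · simp only [ha, hab, sub_self, if_true, if_false, J]
      push_cast
      field_simp
      ring
    rcases eq_or_ne c b with rfl | h2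
    · rw [hba]
      simp only [hb, hab.symm, sub_self, if_true, if_false, J]
      push_cast
      field_simp
      ring
    have hc : (c:ℂ) ≠ 0 := by exact_mod_cast h0
    have hca : (c:ℂ) - a ≠ 0 := by
      have : c - a ≠ 0 := sub_ne_zero.mpr h1
      exact_mod_cast this
    have hcb : (c:ℂ) - b ≠ 0 := by
      have : c - b ≠ 0 := sub_ne_zero.mpr h2
      exact_mod_cast this
    rw [show a - c = -(c - a) by ring, show b - c = -(c - b) by ring, J_neg, J_neg]
    simp only [h0, h1, h2, if_false, J]
    push_cast
    field_simp
    ring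
  · simp only [J]
    push_cast
    field_simp
    ring

def e1 : ℤ × ℤ ≃ ℤ × ℤ where
  toFun x := (-x.1, x.2 - x.1)
  invFun x := (-x.1, x.2 - x.1)
  left_inv x := by ext <;> simp
  right_inv x := by ext <;> simp

def e2 : ℤ × ℤ ≃ ℤ × ℤ where
  toFun x := (x.1 - x.2, -x.2)
  invFun x := (x.1 - x.2, -x.2)
  left_inv x := by ext <;> simp
  right_inv x := by ext <;> simp

lemma hasSum_F : HasSum F (3 * Kv) := by
  have h := summable_F.hasSum
  have h2 := h.prod_fiberwise
    (g := fun x => t0 x.1 x.2 + t0 (-x.1) (x.2 - x.1) + t0 (x.1 - x.2) (-x.2)) (fun x => by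
    obtain ⟨a, b⟩ := x
    rcases eq_or_ne a 0 with rfl | ha
    · simp [F, t0, J_zero]
    rcases eq_or_ne b 0 with rfl | hb
    · simp [F, t0, J_zero]
    rcases eq_or_ne a b with rfl | hab
    · simp [F, t0, J_zero]
    refine hs_congr ((hasSum_T a b ha hb hab).mul_left (E (a + b) * (J a * J b * J (a - b)) ^ 2))
      (fun c => ?_) ?_
    · simp only [F, E_add]; ring
    · have e1 : E (-a + (b - a)) = E a ^ 2 * E b := by
        have := E_four a
        have h0 := E_ne a
        rw [E_add, E_sub, E_neg]
        field_simp
        linear_combination (-E b) * this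
      have e2 : E (a - b + -b) = E b ^ 2 * E a := by
        have := E_four b
        have h0 := E_ne b
        rw [E_add, E_sub, E_neg]
        field_simp
        linear_combination (-E a) * this
      simp only [t0]
      rw [e1, e2, E_add, show b - a = -(a - b) by ring, show -a - -(a - b) = -b by ring,
        show a - b - -b = a by ring]
      simp only [J_neg]
      ring)
  have h3 := (hasSum_t0.add (e1.hasSum_iff.mpr hasSum_t0)).add (e2.hasSum_iff.mpr hasSum_t0)
  have h4 := h2.unique (hs_congr h3 (fun a => rfl) rfl)
  rw [h4] at h
  exact hs_congr h (fun _ => rfl) (by ring)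

lemma ind_step {α : Type*} (f : α → ℂ) (e : α ≃ α) (s t : Set α) (he : ∀ x, f (e x) = f x)
    (hst : ∀ x, e x ∈ s ↔ x ∈ t) : ∑' x, t.indicator f x = ∑' x, s.indicator f x := by
  classical
  rw [← e.tsum_eq (s.indicator f)]
  congr 1
  funext x
  simp only [Set.indicator, he, hst]

lemma F_swap12 (a b c : ℤ) : F ((b, a), c) = F ((a, b), c) := by
  simp only [F]
  rw [show b - a = -(a - b) by ring, J_neg, add_comm b a]; ring

lemma F_swap23 (a b c : ℤ) : F ((a, c), b) = F ((a, b), c) := by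
  simp only [F]
  rw [show c - b = -(b - c) by ring, J_neg, show a + c + b = a + b + c by ring]; ring

lemma F_shift (a b c : ℤ) : F ((-a, b - a), c - a) = F ((a, b), c) := by
  simp only [F]
  have h : E (-a + (b - a) + (c - a)) = E (a + b + c) := by
    rw [show -a + (b - a) + (c - a) = (a + b + c) - (a + a + a + a) by ring, E_sub, E_add (a+a+a),
      E_add (a+a), E_add a a, show E a * E a * E a * E a = E a ^ 4 by ring, E_four, div_one]
  rw [h, show -a - (b - a) = -b by ring, show -a - (c - a) = -c by ring,
    show b - a - (c - a) = b - c by ring, show b - a = -(a - b) by ring,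
    show c - a = -(a - c) by ring]
  simp only [J_neg]
  ring

lemma F_zero (a b c : ℤ) (h : a = 0 ∨ b = 0 ∨ c = 0 ∨ a = b ∨ a = c ∨ b = c) :
    F ((a, b), c) = 0 := by
  rcases h with rfl | rfl | rfl | rfl | rfl | rfl <;> simp [F, J_zero]

def s12 : (ℤ × ℤ) × ℤ ≃ (ℤ × ℤ) × ℤ where
  toFun x := ((x.1.2, x.1.1), x.2)
  invFun x := ((x.1.2, x.1.1), x.2)
  left_inv _ := rfl
  right_inv _ := rfl

def s23 : (ℤ × ℤ) × ℤ ≃ (ℤ × ℤ) × ℤ where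
  toFun x := ((x.1.1, x.2), x.1.2)
  invFun x := ((x.1.1, x.2), x.1.2)
  left_inv _ := rfl
  right_inv _ := rfl

def sh : (ℤ × ℤ) × ℤ ≃ (ℤ × ℤ) × ℤ where
  toFun x := ((-x.1.1, x.1.2 - x.1.1), x.2 - x.1.1)
  invFun x := ((-x.1.1, x.1.2 - x.1.1), x.2 - x.1.1)
  left_inv x := by ext <;> simp
  right_inv x := by ext <;> simp

lemma F_s12 (x) : F (s12 x) = F x := F_swap12 _ _ _
lemma F_s23 (x) : F (s23 x) = F x := F_swap23 _ _ _
lemma F_sh (x) : F (sh x) = F x := F_shift _ _ _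

def R1 : Set ((ℤ × ℤ) × ℤ) := {x | 0 < x.1.1 ∧ x.1.1 < x.1.2 ∧ x.1.2 < x.2}
def R2 : Set ((ℤ × ℤ) × ℤ) := {x | x.1.1 < 0 ∧ 0 < x.1.2 ∧ x.1.2 < x.2}
def R3 : Set ((ℤ × ℤ) × ℤ) := {x | x.1.1 < x.1.2 ∧ x.1.2 < 0 ∧ 0 < x.2}
def R4 : Set ((ℤ × ℤ) × ℤ) := {x | x.1.1 < x.1.2 ∧ x.1.2 < x.2 ∧ x.2 < 0}
def S2 : Set ((ℤ × ℤ) × ℤ) := {x | x.1.1 < x.1.2 ∧ x.1.2 < x.2}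
def S2b : Set ((ℤ × ℤ) × ℤ) := {x | x.1.1 < x.2 ∧ x.2 < x.1.2}
def S2c : Set ((ℤ × ℤ) × ℤ) := {x | x.2 < x.1.1 ∧ x.1.1 < x.1.2}
def S3 : Set ((ℤ × ℤ) × ℤ) := {x | x.1.1 < x.1.2}
def S3b : Set ((ℤ × ℤ) × ℤ) := {x | x.1.2 < x.1.1}

lemma sum_S3 : ∑' x, F x = 2 * ∑' x, S3.indicator F x := by
  classical
  have h : ∀ x, F x = S3.indicator F x + S3b.indicator F x := by
    rintro ⟨⟨a, b⟩, c⟩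
    simp only [Set.indicator, S3, S3b, Set.mem_setOf_eq]
    rcases lt_trichotomy a b with h | h | h
    · simp [h, h.not_gt]
    · simp [F_zero a b c (by tauto)]
    · simp [h, h.not_gt]
  rw [tsum_congr h, (summable_F.indicator S3).tsum_add (summable_F.indicator S3b),
    ind_step F s12 S3 S3b F_s12 (fun x => Iff.rfl)]
  ring

lemma sum_S2 : ∑' x, S3.indicator F x = 3 * ∑' x, S2.indicator F x := by
  classical
  have h : ∀ x, S3.indicator F x
      = S2.indicator F x + S2b.indicator F x + S2c.indicator F x := by
    rintro ⟨⟨a, b⟩, c⟩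
    by_cases hz : F ((a, b), c) = 0
    · simp [Set.indicator, hz]
    have h1 : ¬ (a = 0 ∨ b = 0 ∨ c = 0 ∨ a = b ∨ a = c ∨ b = c) := fun h => hz (F_zero _ _ _ h)
    simp only [Set.indicator, S3, S2, S2b, S2c, Set.mem_setOf_eq]
    split_ifs <;> first | omega | simp
  have hb := ind_step F s23 S2 S2b F_s23 (fun x => Iff.rfl)
  have hc := ind_step F (s23.trans s12) S2 S2c
    (fun x => by rw [Equiv.trans_apply, F_s12, F_s23]) (fun x => Iff.rfl)
  rw [tsum_congr h, ((summable_F.indicator S2).add (summable_F.indicator S2b)).tsum_add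
    (summable_F.indicator S2c), (summable_F.indicator S2).tsum_add (summable_F.indicator S2b),
    hc, hb]
  ring

lemma sum_R1 : ∑' x, S2.indicator F x = 4 * ∑' x, R1.indicator F x := by
  classical
  have h : ∀ x, S2.indicator F x
      = R1.indicator F x + R2.indicator F x + R3.indicator F x + R4.indicator F x := by
    rintro ⟨⟨a, b⟩, c⟩
    by_cases hz : F ((a, b), c) = 0
    · simp [Set.indicator, hz]
    have h1 : ¬ (a = 0 ∨ b = 0 ∨ c = 0 ∨ a = b ∨ a = c ∨ b = c) := fun h => hz (F_zero _ _ _ h)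
    simp only [Set.indicator, R1, R2, R3, R4, S2, Set.mem_setOf_eq]
    split_ifs <;> first | omega | simp
  have h2 := ind_step F sh R1 R2 F_sh (fun x => by
    simp only [R1, R2, sh, Set.mem_setOf_eq, Equiv.coe_fn_mk]; omega)
  have h3 := ind_step F (sh.trans s12) R1 R3
    (fun x => by rw [Equiv.trans_apply, F_s12, F_sh]) (fun x => by
    simp only [R1, R3, sh, s12, Set.mem_setOf_eq, Equiv.coe_fn_mk, Equiv.trans_apply]; omega)
  have h4 := ind_step F ((sh.trans s12).trans s23) R1 R4
    (fun x => by rw [Equiv.trans_apply, Equiv.trans_apply, F_s23, F_s12, F_sh]) (fun x => by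
    simp only [R1, R4, sh, s12, s23, Set.mem_setOf_eq, Equiv.coe_fn_mk, Equiv.trans_apply]; omega)
  have i1 := summable_F.indicator R1
  have i2 := summable_F.indicator R2
  have i3 := summable_F.indicator R3
  have i4 := summable_F.indicator R4
  rw [tsum_congr h, ((i1.add i2).add i3).tsum_add i4, (i1.add i2).tsum_add i3, i1.tsum_add i2,
    h2, h3, h4]
  ring

def phi (m : ℕ × ℕ × ℕ) : (ℤ × ℤ) × ℤ :=
  (((m.1 : ℤ) + 1, (m.1 : ℤ) + m.2.1 + 2), (m.1 : ℤ) + m.2.1 + m.2.2 + 3)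

lemma phi_inj : Function.Injective phi := by
  rintro ⟨a, b, c⟩ ⟨a', b', c'⟩ h
  simp only [phi, Prod.mk.injEq] at h ⊢
  omega

lemma sum_phi : ∑' m, R1.indicator F (phi m) = ∑' x, R1.indicator F x := by
  refine phi_inj.tsum_eq ?_
  rintro ⟨⟨a, b⟩, c⟩ hx
  have hm : ((a, b), c) ∈ R1 := Set.mem_of_indicator_ne_zero hx
  simp only [R1, Set.mem_setOf_eq] at hm
  refine ⟨((a - 1).toNat, (b - a - 1).toNat, (c - b - 1).toNat), ?_⟩
  simp only [phi, Prod.mk.injEq]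
  omega

/-- The sum over m₁,m₂,m₃ ≥ 1 of i^{3m₁+2m₂+m₃}/(m₁²m₂²m₃²(m₁+m₂)²(m₂+m₃)²(m₁+m₂+m₃)²)
equals −(19329337/2678117105664000)π¹².  (The value ζ₃((2,…,2), λ₁^∨; SU(4)).) -/
theorem zeta3_SU4_twisted_value :
    (∑' m : ℕ × ℕ × ℕ,
      Complex.I ^ (3 * (m.1 + 1) + 2 * (m.2.1 + 1) + (m.2.2 + 1))
        / (((m.1 : ℂ) + 1) ^ 2 * ((m.2.1 : ℂ) + 1) ^ 2 * ((m.2.2 : ℂ) + 1) ^ 2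
          * ((m.1 : ℂ) + (m.2.1 : ℂ) + 2) ^ 2
          * ((m.2.1 : ℂ) + (m.2.2 : ℂ) + 2) ^ 2
          * ((m.1 : ℂ) + (m.2.1 : ℂ) + (m.2.2 : ℂ) + 3) ^ 2))
    = -(19329337 / 2678117105664000) * (Real.pi : ℂ) ^ 12 := by
  have h1 := hasSum_F.tsum_eq
  rw [sum_S3, sum_S2, sum_R1, ← sum_phi, Kv_val] at h1
  have h2 : ∀ m : ℕ × ℕ × ℕ, R1.indicator F (phi m) =
      Complex.I ^ (3 * (m.1 + 1) + 2 * (m.2.1 + 1) + (m.2.2 + 1))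
        / (((m.1 : ℂ) + 1) ^ 2 * ((m.2.1 : ℂ) + 1) ^ 2 * ((m.2.2 : ℂ) + 1) ^ 2
          * ((m.1 : ℂ) + (m.2.1 : ℂ) + 2) ^ 2
          * ((m.2.1 : ℂ) + (m.2.2 : ℂ) + 2) ^ 2
          * ((m.1 : ℂ) + (m.2.1 : ℂ) + (m.2.2 : ℂ) + 3) ^ 2) := by
    rintro ⟨a, b, c⟩
    have hm : phi (a, b, c) ∈ R1 := by
      simp only [phi, R1, Set.mem_setOf_eq]; omega
    rw [Set.indicator_of_mem hm]
    simp only [F, phi]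
    rw [show ((a:ℤ) + 1 + (a + b + 2) + (a + b + c + 3))
        = ((3 * (a + 1) + 2 * (b + 1) + (c + 1) : ℕ) : ℤ) by push_cast; ring,
      show ((a:ℤ) + 1 - (a + b + 2)) = -(b + 1) by ring,
      show ((a:ℤ) + 1 - (a + b + c + 3)) = -(b + c + 2) by ring,
      show ((a:ℤ) + b + 2 - (a + b + c + 3)) = -(c + 1) by ring, E, zpow_natCast]
    simp only [J_neg]
    simp only [J]
    push_cast
    rw [div_eq_mul_inv]
    congr 1
    simp only [mul_inv, mul_pow, inv_pow, neg_sq]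
    ring
  rw [tsum_congr h2] at h1
  linear_combination h1 / 24
end
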